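/- arXiv:0706.4102 — 5 statements merged into one kernel-verified Lean document; each statement's English description precedes it below -/
import Mathlib

section
/- For every integer s ≥ 3 there exists a constant c > 0 (depending only on s) such that for every graph G with m ≥ 2 edges, the Ramsey number satisfies r(K_s, G) ≥ c (m / log m)^{(s+1)/(s+3)}. -/
open SimpleGraph

/-- `G.ContainsCopy H` means the graph `G` contains a subgraph isomorphic to `H`,
i.e. there is an injective graph homomorphism from `H` into `G`. -/
def SimpleGraph.ContainsCopy {α β : Type*} (G : SimpleGraph α) (H : SimpleGraph β) : Prop :=
  ∃ f : H →g G, Function.Injective f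

/-- `RamseyProp n H G` : every graph `Γ` on `n` vertices contains a copy of `H`,
or its complement contains a copy of `G`. -/
def RamseyProp {α β : Type*} (n : ℕ) (H : SimpleGraph α) (G : SimpleGraph β) : Prop :=
  ∀ Γ : SimpleGraph (Fin n), Γ.ContainsCopy H ∨ Γᶜ.ContainsCopy G

/-- The Ramsey number `r(H, G)` : the least positive `n` such that every graph on `n`
vertices contains a copy of `H` or its complement contains a copy of `G`. -/
noncomputable def ramseyNumber {α β : Type*} (H : SimpleGraph α) (G : SimpleGraph β) : ℕ :=
  sInf {n : ℕ | 0 < n ∧ RamseyProp n H G}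

/-- The probability that a random subset of `ε`, containing each element independently with
probability `p`, equals `E`. -/
noncomputable def binomialWeight {ε : Type*} [Fintype ε] [DecidableEq ε] (p : ℝ)
    (E : Finset ε) : ℝ :=
  (∏ _e ∈ E, p) * ∏ _e ∈ Eᶜ, (1 - p)

theorem binomialWeight_nonneg {ε : Type*} [Fintype ε] [DecidableEq ε] {p : ℝ} (h0 : 0 ≤ p)
    (h1 : p ≤ 1) (E : Finset ε) : 0 ≤ binomialWeight p E :=
  mul_nonneg (Finset.prod_nonneg fun _ _ => h0)
    (Finset.prod_nonneg fun _ _ => sub_nonneg.2 h1)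

theorem sum_binomialWeight_mul_prod {ε : Type*} [Fintype ε] [DecidableEq ε] (p : ℝ)
    (a b : ε → ℝ) :
    ∑ E : Finset ε, binomialWeight p E * ((∏ e ∈ E, a e) * ∏ e ∈ Eᶜ, b e) =
      ∏ e, (p * a e + (1 - p) * b e) := by
  rw [Fintype.prod_add]
  refine Finset.sum_congr rfl fun E _ => ?_
  rw [Finset.prod_mul_distrib, Finset.prod_mul_distrib, binomialWeight]
  ring

theorem sum_binomialWeight {ε : Type*} [Fintype ε] [DecidableEq ε] (p : ℝ) :
    ∑ E : Finset ε, binomialWeight p E = 1 := by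
  simpa using sum_binomialWeight_mul_prod (ε := ε) p (fun _ => 1) (fun _ => 1)

theorem sum_binomialWeight_mul_half_pow {ε : Type*} [Fintype ε] [DecidableEq ε] (p : ℝ)
    (F : Finset ε) :
    ∑ E : Finset ε, binomialWeight p E * (1 / 2 : ℝ) ^ (F ∩ E).card = (1 - p / 2) ^ F.card := by
  have h := sum_binomialWeight_mul_prod p (fun e => if e ∈ F then (1 / 2 : ℝ) else 1)
    (fun _ => 1)
  have h2 : ∏ e, (p * (if e ∈ F then (1 / 2 : ℝ) else 1) + (1 - p) * 1) =
      (1 - p / 2) ^ F.card := by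
    rw [← Finset.prod_const, ← Finset.prod_subset (Finset.subset_univ F)]
    · refine Finset.prod_congr rfl fun e he => ?_
      rw [if_pos he]; ring
    · intro e _ he
      rw [if_neg he]; ring
  rw [← h2, ← h]
  refine Finset.sum_congr rfl fun E _ => ?_
  rw [Finset.prod_const_one, mul_one, ← Finset.prod_filter, Finset.prod_const,
    Finset.filter_mem_eq_inter, Finset.inter_comm]

theorem sum_binomialWeight_mul_superset {ε : Type*} [Fintype ε] [DecidableEq ε] (p : ℝ)
    (S : Finset ε) :
    ∑ E : Finset ε, binomialWeight p E * (if S ⊆ E then 1 else 0) = p ^ S.card := by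
  have h := sum_binomialWeight_mul_prod p (fun _ => 1) (fun e => if e ∈ S then (0 : ℝ) else 1)
  have h2 : ∏ e, (p * 1 + (1 - p) * (if e ∈ S then (0 : ℝ) else 1)) = p ^ S.card := by
    rw [← Finset.prod_const, ← Finset.prod_subset (Finset.subset_univ S)]
    · refine Finset.prod_congr rfl fun e he => ?_
      rw [if_pos he]; ring
    · intro e _ he
      rw [if_neg he]; ring
  rw [← h2, ← h]
  refine Finset.sum_congr rfl fun E _ => ?_
  rw [Finset.prod_const_one, one_mul]
  congr 1
  split_ifs with hS
  · rw [Finset.prod_eq_one]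
    intro e he
    rw [if_neg fun h => Finset.mem_compl.1 he (hS h)]
  · obtain ⟨e, heS, heE⟩ := Finset.not_subset.1 hS
    have hz : ∏ e ∈ Eᶜ, (if e ∈ S then (0 : ℝ) else 1) = 0 :=
      Finset.prod_eq_zero (i := e) (Finset.mem_compl.2 heE) (if_pos heS)
    exact hz.symm

open Classical in
/-- Disjoint subfamilies of `𝒞` with `k` members, all of which meet `F`. -/
noncomputable def disjointMeeting {ε : Type*} (𝒞 : Finset (Finset ε))
    (F : Finset ε) (k : ℕ) : Finset (Finset (Finset ε)) :=
  ((𝒞.filter fun K => ¬ Disjoint K F).powersetCard k).filter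
    fun 𝒦 => (𝒦 : Set (Finset ε)).PairwiseDisjoint id

theorem mem_disjointMeeting {ε : Type*} {𝒞 : Finset (Finset ε)} {F : Finset ε} {k : ℕ}
    {𝒦 : Finset (Finset ε)} :
    𝒦 ∈ disjointMeeting 𝒞 F k ↔ ((∀ K ∈ 𝒦, K ∈ 𝒞 ∧ ¬ Disjoint K F) ∧ 𝒦.card = k) ∧
      (𝒦 : Set (Finset ε)).PairwiseDisjoint id := by
  classical
  simp [disjointMeeting, Finset.mem_powersetCard, Finset.subset_iff]

/-- If every `F i` has more than `C * k` elements in `E`, and no `k` disjoint members of `𝒞` inside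
`E` all meet `F i`, then deleting a maximal disjoint family of members of `𝒞` from `E` leaves a set
which contains no member of `𝒞` and still meets every `F i`. -/
theorem exists_deletion {ε ι : Type*} [DecidableEq ε] (𝒞 : Finset (Finset ε)) (F : ι → Finset ε)
    (E : Finset ε) (C k : ℕ) (hC : 0 < C) (h𝒞 : ∀ K ∈ 𝒞, K.card = C)
    (hlarge : ∀ i, C * k < (F i ∩ E).card)
    (hfew : ∀ i, ∀ 𝒦 ∈ disjointMeeting 𝒞 (F i) k, ¬ 𝒦.biUnion id ⊆ E) :
    ∃ H : Finset ε, (∀ K ∈ 𝒞, ¬ K ⊆ H) ∧ ∀ i, ¬ Disjoint (F i) H := by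
  classical
  obtain ⟨𝒦, h𝒦⟩ := Finset.exists_maximal (s := (𝒞.filter (· ⊆ E)).powerset.filter
    fun 𝒦 : Finset (Finset ε) => (𝒦 : Set (Finset ε)).PairwiseDisjoint id) ⟨∅, by simp⟩
  obtain ⟨hmem, hmax⟩ := h𝒦
  simp only [Finset.mem_filter, Finset.mem_powerset] at hmem
  obtain ⟨hsub, hdis⟩ := hmem
  refine ⟨E \ 𝒦.biUnion id, ?_, ?_⟩
  · intro K hK hKH
    have hKE : K ⊆ E := hKH.trans Finset.sdiff_subset
    have hKd : ∀ L ∈ 𝒦, Disjoint K L := by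
      intro L hL
      refine Finset.disjoint_left.2 fun e heK heL => ?_
      exact (Finset.mem_sdiff.1 (hKH heK)).2 (Finset.mem_biUnion.2 ⟨L, hL, heL⟩)
    have hins : insert K 𝒦 ∈ (𝒞.filter (· ⊆ E)).powerset.filter
        fun 𝒦 : Finset (Finset ε) => (𝒦 : Set (Finset ε)).PairwiseDisjoint id := by
      simp only [Finset.mem_filter, Finset.mem_powerset]
      refine ⟨Finset.insert_subset (Finset.mem_filter.2 ⟨hK, hKE⟩) hsub, ?_⟩
      rw [Finset.coe_insert]
      exact hdis.insert fun L hL _ => hKd L hL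
    have hK𝒦 : K ∈ 𝒦 := hmax hins (Finset.subset_insert _ _) (Finset.mem_insert_self _ _)
    have hKe : K = ∅ := by simpa using hKd K hK𝒦
    have := h𝒞 K hK
    rw [hKe, Finset.card_empty] at this
    omega
  · intro i hi
    set 𝒦' := 𝒦.filter fun K => ¬ Disjoint K (F i) with h𝒦'
    have hcov : F i ∩ E ⊆ 𝒦'.biUnion id := by
      intro e he
      obtain ⟨heF, heE⟩ := Finset.mem_inter.1 he
      have h1 : e ∈ 𝒦.biUnion id := by
        by_contra h
        exact Finset.disjoint_left.1 hi heF (Finset.mem_sdiff.2 ⟨heE, h⟩)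
      obtain ⟨K, hK, heK⟩ := Finset.mem_biUnion.1 h1
      exact Finset.mem_biUnion.2 ⟨K, Finset.mem_filter.2
        ⟨hK, fun hd => Finset.disjoint_left.1 hd heK heF⟩, heK⟩
    have hcard : (F i ∩ E).card ≤ 𝒦'.card * C :=
      (Finset.card_le_card hcov).trans (Finset.card_biUnion_le_card_mul _ _ _ fun K hK =>
        (h𝒞 K (Finset.mem_filter.1 (hsub (Finset.mem_filter.1 hK).1)).1).le)
    have hk : k ≤ 𝒦'.card := by
      have h1 := hlarge i
      rw [mul_comm] at h1
      exact (lt_of_mul_lt_mul_right (h1.trans_le hcard) (Nat.zero_le C)).le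
    obtain ⟨𝒯, h𝒯, h𝒯k⟩ := Finset.exists_subset_card_eq hk
    have h𝒯𝒦 : 𝒯 ⊆ 𝒦 := h𝒯.trans (Finset.filter_subset _ _)
    refine hfew i 𝒯 (mem_disjointMeeting.2 ⟨⟨fun K hK => ?_, h𝒯k⟩, ?_⟩) ?_
    · exact ⟨(Finset.mem_filter.1 (hsub (h𝒯𝒦 hK))).1, (Finset.mem_filter.1 (h𝒯 hK)).2⟩
    · exact hdis.subset (Finset.coe_subset.2 h𝒯𝒦)
    · exact Finset.biUnion_subset.2 fun K hK => (Finset.mem_filter.1 (hsub (h𝒯𝒦 hK))).2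

theorem card_disjointMeeting_le {ε : Type*} [DecidableEq ε] {𝒞 : Finset (Finset ε)} {F : Finset ε}
    {M : ℕ} (hM : (𝒞.filter fun K => ¬ Disjoint K F).card ≤ M) (k : ℕ) :
    (disjointMeeting 𝒞 F k).card ≤ M.choose k := by
  classical
  refine (Finset.card_filter_le _ _).trans ?_
  rw [Finset.card_powersetCard]
  refine Nat.choose_le_choose k ?_
  convert hM

/-- The deletion method: if the expected number of failures is below one, some set contains no member
of `𝒞` and meets every `F i`. -/
theorem exists_free_hitting {ε ι : Type*} [Fintype ε] [DecidableEq ε] [Fintype ι]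
    (𝒞 : Finset (Finset ε)) (F : ι → Finset ε) (C k m M : ℕ) (p : ℝ) (hC : 0 < C)
    (h𝒞 : ∀ K ∈ 𝒞, K.card = C) (hF : ∀ i, (F i).card = m)
    (hM : ∀ i, (𝒞.filter fun K => ¬ Disjoint K (F i)).card ≤ M) (h0 : 0 ≤ p) (h1 : p ≤ 1)
    (hlt : (Fintype.card ι : ℝ) *
      (2 ^ (C * k) * (1 - p / 2) ^ m + (M.choose k : ℝ) * p ^ (C * k)) < 1) :
    ∃ H : Finset ε, (∀ K ∈ 𝒞, ¬ K ⊆ H) ∧ ∀ i, ¬ Disjoint (F i) H := by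
  set φ : ι → Finset ε → ℝ := fun i E => 2 ^ (C * k) * (1 / 2 : ℝ) ^ (F i ∩ E).card +
    ∑ 𝒦 ∈ disjointMeeting 𝒞 (F i) k, (if 𝒦.biUnion id ⊆ E then 1 else 0) with hφ
  have hterm : ∀ i, ∑ E : Finset ε, binomialWeight p E * φ i E ≤
      2 ^ (C * k) * (1 - p / 2) ^ m + (M.choose k : ℝ) * p ^ (C * k) := by
    intro i
    have e1 : ∑ E : Finset ε, binomialWeight p E * φ i E =
        2 ^ (C * k) * (∑ E : Finset ε, binomialWeight p E * (1 / 2 : ℝ) ^ (F i ∩ E).card) +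
        ∑ 𝒦 ∈ disjointMeeting 𝒞 (F i) k,
          ∑ E : Finset ε, binomialWeight p E * (if 𝒦.biUnion id ⊆ E then 1 else 0) := by
      rw [Finset.sum_comm, Finset.mul_sum, ← Finset.sum_add_distrib]
      refine Finset.sum_congr rfl fun E _ => ?_
      rw [← Finset.mul_sum]
      simp only [hφ]
      ring
    rw [e1, sum_binomialWeight_mul_half_pow, hF i]
    gcongr
    calc _ = ∑ 𝒦 ∈ disjointMeeting 𝒞 (F i) k, p ^ (C * k) := by
          refine Finset.sum_congr rfl fun 𝒦 h => ?_
          obtain ⟨⟨hsub, hk⟩, hd⟩ := mem_disjointMeeting.1 h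
          rw [sum_binomialWeight_mul_superset, Finset.card_biUnion hd,
            Finset.sum_const_nat (m := C) (f := fun K => (id K).card) fun K hK => h𝒞 K (hsub K hK).1,
            hk, mul_comm]
      _ = ((disjointMeeting 𝒞 (F i) k).card : ℝ) * p ^ (C * k) := by
          rw [Finset.sum_const, nsmul_eq_mul]
      _ ≤ _ := by
          gcongr
          exact card_disjointMeeting_le (hM i) k
  have hE : ∃ E : Finset ε, ∑ i, φ i E < 1 := by
    by_contra! h
    have h2 : (1 : ℝ) ≤ ∑ E : Finset ε, binomialWeight p E * ∑ i, φ i E := by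
      rw [← sum_binomialWeight (ε := ε) p]
      exact Finset.sum_le_sum fun E _ =>
        le_mul_of_one_le_right (binomialWeight_nonneg h0 h1 E) (h E)
    simp_rw [Finset.mul_sum] at h2
    rw [Finset.sum_comm] at h2
    have h3 := Finset.sum_le_sum fun i (_ : i ∈ Finset.univ) => hterm i
    rw [Finset.sum_const, nsmul_eq_mul, Finset.card_univ] at h3
    linarith
  obtain ⟨E, hE⟩ := hE
  have hsum0 : ∀ i, 0 ≤ ∑ 𝒦 ∈ disjointMeeting 𝒞 (F i) k,
      (if 𝒦.biUnion id ⊆ E then (1 : ℝ) else 0) :=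
    fun i => Finset.sum_nonneg fun 𝒦 _ => by split_ifs <;> norm_num
  have hpow0 : ∀ i, 0 ≤ (2 : ℝ) ^ (C * k) * (1 / 2 : ℝ) ^ (F i ∩ E).card := fun i => by positivity
  have hφ1 : ∀ i, φ i E < 1 := fun i => (Finset.single_le_sum
    (fun j _ => add_nonneg (hpow0 j) (hsum0 j)) (Finset.mem_univ i)).trans_lt hE
  refine exists_deletion 𝒞 F E C k hC h𝒞 (fun i => ?_) fun i 𝒦 h𝒦 hsub => ?_
  · have h2 : (2 : ℝ) ^ (C * k) * (1 / 2 : ℝ) ^ (F i ∩ E).card < 1 :=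
      (le_add_of_nonneg_right (hsum0 i)).trans_lt (hφ1 i)
    rw [one_div, inv_pow, ← div_eq_mul_inv, div_lt_one (by positivity)] at h2
    exact (pow_lt_pow_iff_right₀ one_lt_two).1 h2
  · have h2 : (1 : ℝ) ≤ ∑ 𝒦 ∈ disjointMeeting 𝒞 (F i) k,
        (if 𝒦.biUnion id ⊆ E then (1 : ℝ) else 0) := by
      refine le_trans ?_ (Finset.single_le_sum (fun 𝒦 _ => ?_) h𝒦)
      · rw [if_pos hsub]
      · split_ifs <;> norm_num
    have h3 := hφ1 i
    have h4 := hpow0 i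
    simp only [hφ] at h3
    linarith

theorem exists_isNClique_or_compl_isNClique (s t : ℕ) :
    ∃ n : ℕ, ∀ (V : Type) (Γ : SimpleGraph V) (A : Finset V), n ≤ A.card →
      (∃ B ⊆ A, Γ.IsNClique s B) ∨ ∃ B ⊆ A, Γᶜ.IsNClique t B := by
  classical
  induction s generalizing t with
  | zero => exact ⟨0, fun V Γ A _ => Or.inl ⟨∅, by simp, by simp⟩⟩
  | succ s ihs =>
    induction t with
    | zero => exact ⟨0, fun V Γ A _ => Or.inr ⟨∅, by simp, by simp⟩⟩
    | succ t iht =>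
      obtain ⟨n₁, h₁⟩ := ihs (t + 1)
      obtain ⟨n₂, h₂⟩ := iht
      refine ⟨n₁ + n₂ + 1, fun V Γ A hA => ?_⟩
      obtain ⟨v, hv⟩ : A.Nonempty := Finset.card_pos.1 (by omega)
      have hsplit := Finset.card_filter_add_card_filter_not (s := A.erase v) (p := Γ.Adj v)
      rw [Finset.card_erase_of_mem hv] at hsplit
      have hsub : ∀ (q : V → Prop) [DecidablePred q], (A.erase v).filter q ⊆ A := fun q _ =>
        (Finset.filter_subset _ _).trans (Finset.erase_subset _ _)
      by_cases hn : n₁ ≤ ((A.erase v).filter (Γ.Adj v)).card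
      · rcases h₁ V Γ _ hn with ⟨B, hB, hc⟩ | ⟨B, hB, hc⟩
        · refine Or.inl ⟨insert v B, Finset.insert_subset hv (hB.trans (hsub _)), ?_⟩
          exact hc.insert fun b hb => (Finset.mem_filter.1 (hB hb)).2
        · exact Or.inr ⟨B, hB.trans (hsub _), hc⟩
      · have hn2 : n₂ ≤ ((A.erase v).filter fun w => ¬ Γ.Adj v w).card := by omega
        rcases h₂ V Γ _ hn2 with ⟨B, hB, hc⟩ | ⟨B, hB, hc⟩
        · exact Or.inl ⟨B, hB.trans (hsub _), hc⟩
        · refine Or.inr ⟨insert v B, Finset.insert_subset hv (hB.trans (hsub _)), ?_⟩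
          refine hc.insert fun b hb => ?_
          have hb' := Finset.mem_filter.1 (hB hb)
          exact (SimpleGraph.compl_adj _ _ _).2 ⟨(Finset.ne_of_mem_erase hb'.1).symm, hb'.2⟩

theorem containsCopy_of_isNClique {V α : Type*} [Fintype α] {Γ : SimpleGraph V} {B : Finset V}
    (hB : Γ.IsNClique (Fintype.card α) B) (H : SimpleGraph α) : Γ.ContainsCopy H := by
  have e : α ≃ B := Fintype.equivOfCardEq (by rw [Fintype.card_coe, hB.card_eq])
  have hinj : Function.Injective fun a => (e a : V) := Subtype.val_injective.comp e.injective
  exact ⟨⟨fun a => (e a : V), fun {a b} hab =>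
    hB.isClique (e a).2 (e b).2 fun h => hab.ne (hinj h)⟩, hinj⟩

theorem exists_ramseyProp {α β : Type*} [Fintype α] [Fintype β] (H : SimpleGraph α)
    (G : SimpleGraph β) : ∃ n, 0 < n ∧ RamseyProp n H G := by
  obtain ⟨n, hn⟩ := exists_isNClique_or_compl_isNClique (Fintype.card α) (Fintype.card β)
  refine ⟨n + 1, n.succ_pos, fun Γ => ?_⟩
  rcases hn _ Γ Finset.univ (by simp) with ⟨B, -, hB⟩ | ⟨B, -, hB⟩
  · exact Or.inl (containsCopy_of_isNClique hB H)
  · exact Or.inr (containsCopy_of_isNClique hB G)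

theorem ramseyProp_ramseyNumber {α β : Type*} [Fintype α] [Fintype β] (H : SimpleGraph α)
    (G : SimpleGraph β) : 0 < ramseyNumber H G ∧ RamseyProp (ramseyNumber H G) H G :=
  Nat.sInf_mem (exists_ramseyProp H G)

/-- The edges of the complete graph on the vertex set `A`. -/
def cliqueEdges {V : Type*} [DecidableEq V] (A : Finset V) : Finset (Sym2 V) :=
  A.offDiag.image (Function.uncurry Sym2.mk)

theorem mk_mem_cliqueEdges {V : Type*} [DecidableEq V] {A : Finset V} {a b : V} :
    s(a, b) ∈ cliqueEdges A ↔ a ∈ A ∧ b ∈ A ∧ a ≠ b := by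
  simp only [cliqueEdges, Finset.mem_image, Finset.mem_offDiag, Prod.exists,
    Function.uncurry_apply_pair, Sym2.eq_iff]
  constructor
  · rintro ⟨x, y, ⟨hx, hy, hxy⟩, ⟨rfl, rfl⟩ | ⟨rfl, rfl⟩⟩
    · exact ⟨hx, hy, hxy⟩
    · exact ⟨hy, hx, hxy.symm⟩
  · exact fun h => ⟨a, b, h, Or.inl ⟨rfl, rfl⟩⟩

theorem card_filter_mem_cliqueEdges_le {n s : ℕ} (e : Sym2 (Fin n)) :
    ((Finset.univ.powersetCard s).filter fun A : Finset (Fin n) => e ∈ cliqueEdges A).card ≤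
      n ^ (s - 2) := by
  induction e with
  | h a b =>
    refine le_trans ?_ (Nat.choose_le_pow n (s - 2))
    have hcard : n.choose (s - 2) =
        (Finset.powersetCard (s - 2) (Finset.univ : Finset (Fin n))).card := by simp
    rw [hcard]
    refine Finset.card_le_card_of_injOn (fun A => A \ {a, b}) ?_ ?_
    · intro A hA
      simp only [Finset.coe_filter, Set.mem_ofPred_eq, Finset.mem_powersetCard,
        mk_mem_cliqueEdges] at hA
      obtain ⟨⟨-, hcard⟩, ha, hb, hab⟩ := hA
      simp only [Finset.mem_coe, Finset.mem_powersetCard, Finset.subset_univ, true_and]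
      rw [Finset.card_sdiff_of_subset (by simp [Finset.insert_subset_iff, ha, hb]), hcard,
        Finset.card_pair hab]
    · intro A hA A' hA' h
      simp only [Finset.coe_filter, Set.mem_ofPred_eq, mk_mem_cliqueEdges] at hA hA'
      have hsub : ∀ B : Finset (Fin n), a ∈ B → b ∈ B → {a, b} ⊆ B := fun B h1 h2 => by
        simp [Finset.insert_subset_iff, h1, h2]
      rw [← Finset.sdiff_union_of_subset (hsub A hA.2.1 hA.2.2.1),
        ← Finset.sdiff_union_of_subset (hsub A' hA'.2.1 hA'.2.2.1)]
      exact congrArg (· ∪ {a, b}) h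

theorem card_cliques_meeting_le {n s : ℕ} (F : Finset (Sym2 (Fin n))) :
    (((Finset.univ.powersetCard s).image fun A : Finset (Fin n) => cliqueEdges A).filter
      fun K => ¬ Disjoint K F).card ≤ F.card * n ^ (s - 2) := by
  rw [Finset.filter_image]
  refine Finset.card_image_le.trans ?_
  refine (Finset.card_le_card (t := F.biUnion fun e => (Finset.univ.powersetCard s).filter
    fun A : Finset (Fin n) => e ∈ cliqueEdges A) ?_).trans
    (Finset.card_biUnion_le_card_mul _ _ _ fun e _ => card_filter_mem_cliqueEdges_le e)
  intro A hA
  obtain ⟨hAs, hd⟩ := Finset.mem_filter.1 hA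
  obtain ⟨e, heA, heF⟩ := Finset.not_disjoint_iff.1 hd
  exact Finset.mem_biUnion.2 ⟨e, heF, Finset.mem_filter.2 ⟨hAs, heA⟩⟩

theorem card_embedding_fin_le_pow {β : Type*} [Fintype β] {n : ℕ} (hn : 0 < n) :
    Fintype.card (β ↪ Fin n) ≤ n ^ n := by
  rw [Fintype.card_embedding_eq, Fintype.card_fin]
  rcases lt_or_ge n (Fintype.card β) with h | h
  · rw [Nat.descFactorial_of_lt h]
    exact Nat.zero_le _
  · exact (Nat.descFactorial_le_pow _ _).trans (Nat.pow_le_pow_right hn h)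

theorem not_ramseyProp_of_lt {β : Type*} [Fintype β] (G : SimpleGraph β) {s n k : ℕ} {p : ℝ}
    (hs : 2 ≤ s) (hn : 0 < n) (h0 : 0 ≤ p) (h1 : p ≤ 1)
    (hlt : (n : ℝ) ^ n * (2 ^ (s.choose 2 * k) * (1 - p / 2) ^ G.edgeSet.ncard +
      ((G.edgeSet.ncard * n ^ (s - 2)).choose k : ℝ) * p ^ (s.choose 2 * k)) < 1) :
    ¬ RamseyProp n (⊤ : SimpleGraph (Fin s)) G := by
  classical
  set F : (β ↪ Fin n) → Finset (Sym2 (Fin n)) := fun f => G.edgeFinset.image (Sym2.map f) with hFdef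
  have hF : ∀ f, (F f).card = G.edgeSet.ncard := by
    intro f
    rw [hFdef, Finset.card_image_of_injective _ (Sym2.map.injective f.injective),
      Set.ncard_eq_toFinset_card', SimpleGraph.edgeFinset]
  obtain ⟨H, hfree, hhit⟩ := exists_free_hitting
    ((Finset.univ.powersetCard s).image fun A : Finset (Fin n) => cliqueEdges A) F (s.choose 2) k
    G.edgeSet.ncard (G.edgeSet.ncard * n ^ (s - 2)) p (Nat.choose_pos hs)
    (fun K hK => by
      obtain ⟨A, hA, rfl⟩ := Finset.mem_image.1 hK
      rw [cliqueEdges, Sym2.card_image_offDiag, (Finset.mem_powersetCard.1 hA).2])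
    hF (fun f => by
      rw [← hF f]
      exact card_cliques_meeting_le _) h0 h1
    (by
      refine lt_of_le_of_lt ?_ hlt
      refine mul_le_mul_of_nonneg_right ?_ ?_
      · exact_mod_cast card_embedding_fin_le_pow hn
      · have : 0 ≤ 1 - p / 2 := by linarith
        positivity)
  intro hR
  rcases hR (SimpleGraph.fromEdgeSet (H : Set (Sym2 (Fin n)))) with ⟨g, hg⟩ | ⟨f, hf⟩
  · refine hfree (cliqueEdges (Finset.univ.image g)) (Finset.mem_image_of_mem _ ?_) ?_
    · rw [Finset.mem_powersetCard, Finset.card_image_of_injective _ hg, Finset.card_univ,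
        Fintype.card_fin]
      exact ⟨Finset.subset_univ _, rfl⟩
    · intro e he
      induction e with
      | h a b =>
        obtain ⟨ha, hb, hab⟩ := mk_mem_cliqueEdges.1 he
        obtain ⟨x, -, rfl⟩ := Finset.mem_image.1 ha
        obtain ⟨y, -, rfl⟩ := Finset.mem_image.1 hb
        have hadj := g.map_adj (show (⊤ : SimpleGraph (Fin s)).Adj x y from
          fun h => hab (congrArg g h))
        exact Finset.mem_coe.1 ((SimpleGraph.fromEdgeSet_adj _).1 hadj).1
  · refine hhit ⟨f, hf⟩ (Finset.disjoint_left.2 fun e he heH => ?_)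
    obtain ⟨d, hd, rfl⟩ := Finset.mem_image.1 he
    induction d with
    | h a b =>
      have hab : G.Adj a b := by simpa using hd
      have hadj := (SimpleGraph.compl_adj _ _ _).1 (f.map_adj hab)
      exact hadj.2 ((SimpleGraph.fromEdgeSet_adj _).2 ⟨Finset.mem_coe.2 heH, hadj.1⟩)

theorem pow_mul_add_lt_one {C k m n M : ℕ} {p : ℝ} (hC : 0 < C) (hn : 0 < n) (h0 : 0 ≤ p)
    (h1 : p ≤ 1) (hM : (M : ℝ) * p ^ C ≤ k * Real.exp (-2)) (hCk : (C * k : ℝ) ≤ p * m / 4)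
    (hk : n * Real.log n + 1 ≤ k) :
    (n : ℝ) ^ n * (2 ^ (C * k) * (1 - p / 2) ^ m + (M.choose k : ℝ) * p ^ (C * k)) < 1 := by
  have hC1 : (1 : ℝ) ≤ C := by exact_mod_cast hC
  have hfirst : (2 : ℝ) ^ (C * k) * (1 - p / 2) ^ m ≤ Real.exp (-k) := by
    have e1 : (2 : ℝ) ^ (C * k) ≤ Real.exp (C * k) := by
      calc (2 : ℝ) ^ (C * k) ≤ Real.exp 1 ^ (C * k) := by
            gcongr
            linarith [Real.exp_one_gt_d9]
        _ = Real.exp (C * k) := by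
            rw [← Real.exp_nat_mul]
            push_cast
            ring_nf
    have e2 : (1 - p / 2) ^ m ≤ Real.exp (-(p * m / 2)) := by
      calc (1 - p / 2) ^ m ≤ Real.exp (-(p / 2)) ^ m :=
            pow_le_pow_left₀ (by linarith) (Real.one_sub_le_exp_neg _) _
        _ = Real.exp (-(p * m / 2)) := by
            rw [← Real.exp_nat_mul]
            ring_nf
    calc _ ≤ Real.exp (C * k) * Real.exp (-(p * m / 2)) := by
          refine mul_le_mul e1 e2 (pow_nonneg (by linarith) _) (Real.exp_pos _).le
      _ = Real.exp (C * k - p * m / 2) := by rw [← Real.exp_add]; ring_nf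
      _ ≤ Real.exp (-k) := by
          refine Real.exp_le_exp.2 ?_
          have : (k : ℝ) ≤ C * k := le_mul_of_one_le_left (Nat.cast_nonneg k) hC1
          linarith
  have hsecond : (M.choose k : ℝ) * p ^ (C * k) ≤ Real.exp (-k) := by
    calc (M.choose k : ℝ) * p ^ (C * k) ≤ (M : ℝ) ^ k / k.factorial * p ^ (C * k) := by
          gcongr
          exact Nat.choose_le_pow_div k M
      _ = (M * p ^ C) ^ k / k.factorial := by rw [mul_pow, ← pow_mul]; ring
      _ ≤ (k * Real.exp (-2)) ^ k / k.factorial := by gcongr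
      _ = (k : ℝ) ^ k / k.factorial * Real.exp (-2) ^ k := by rw [mul_pow]; ring
      _ ≤ Real.exp k * Real.exp (-2) ^ k := by
          gcongr
          exact Real.pow_div_factorial_le_exp _ (Nat.cast_nonneg k) k
      _ = Real.exp (-k) := by
          rw [← Real.exp_nat_mul, ← Real.exp_add]
          ring_nf
  have hnn : (n : ℝ) ^ n = Real.exp (n * Real.log n) := by
    rw [Real.exp_nat_mul, Real.exp_log (by exact_mod_cast hn)]
  calc _ ≤ Real.exp (n * Real.log n) * (Real.exp (-k) + Real.exp (-k)) := by
        rw [hnn]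
        gcongr
    _ = 2 * Real.exp (n * Real.log n - k) := by
        rw [sub_eq_add_neg, Real.exp_add]; ring
    _ ≤ 2 * Real.exp (-1) := by
        gcongr
        linarith
    _ < 1 := by
        rw [Real.exp_neg, ← div_eq_mul_inv, div_lt_one (Real.exp_pos _)]
        linarith [Real.exp_one_gt_d9]

theorem mul_rpow_lt_of_lt_rpow {s n : ℕ} {x : ℝ} (hn : 0 < n) (hx : 0 ≤ x)
    (h : (n : ℝ) < x ^ ((s + 1 : ℝ) / (s + 3))) :
    (n : ℝ) < x * (n : ℝ) ^ (-(2 / (s + 1 : ℝ))) := by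
  have hn' : (0 : ℝ) < n := by exact_mod_cast hn
  have h2 := Real.rpow_lt_rpow hn'.le h (show (0 : ℝ) < (s + 3) / (s + 1) by positivity)
  rw [← Real.rpow_mul hx, div_mul_div_comm, mul_comm ((s : ℝ) + 1), div_self (by positivity),
    Real.rpow_one] at h2
  have h3 : (n : ℝ) = (n : ℝ) ^ ((s + 3 : ℝ) / (s + 1)) * (n : ℝ) ^ (-(2 / (s + 1 : ℝ))) := by
    rw [← Real.rpow_add hn']
    conv_lhs => rw [← Real.rpow_one (n : ℝ)]
    congr 1
    field_simp
    ring
  calc (n : ℝ) = _ := h3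
    _ < _ := by gcongr

theorem pow_mul_rpow_pow_eq_one {s n : ℕ} (hs : 2 ≤ s) (hn : 0 < n) :
    (n : ℝ) ^ (s - 2) * ((n : ℝ) ^ (-(2 / (s + 1 : ℝ)))) ^ (s.choose 2 - 1) = 1 := by
  have hn' : (0 : ℝ) < n := by exact_mod_cast hn
  rw [← Real.rpow_natCast, ← Real.rpow_natCast, ← Real.rpow_mul hn'.le, ← Real.rpow_add hn',
    Nat.cast_sub hs, Nat.cast_sub (Nat.choose_pos hs), Nat.cast_choose_two]
  convert Real.rpow_zero (n : ℝ) using 2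
  push_cast
  field_simp
  ring

theorem exists_deletion_parameters {s : ℕ} (hs : 3 ≤ s) :
    ∃ c : ℝ, 0 < c ∧ ∀ m n : ℕ, 2 ≤ m → 0 < n →
      (n : ℝ) < c * ((m : ℝ) / Real.log m) ^ ((s + 1 : ℝ) / (s + 3)) →
      ∃ (p : ℝ) (k : ℕ), 0 ≤ p ∧ p ≤ 1 ∧
        (n : ℝ) ^ n * (2 ^ (s.choose 2 * k) * (1 - p / 2) ^ m +
          ((m * n ^ (s - 2)).choose k : ℝ) * p ^ (s.choose 2 * k)) < 1 := by
  have hpow := fun n => pow_mul_rpow_pow_eq_one (n := n) (show 2 ≤ s by omega)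
  have hC3 : 3 ≤ s.choose 2 := (Nat.choose_le_choose 2 hs : Nat.choose 3 2 ≤ _)
  set C := s.choose 2 with hCdef
  have hC : (3 : ℝ) ≤ C := by exact_mod_cast hC3
  set α : ℝ := Real.exp (-2) / (8 * C) with hα
  have hα0 : 0 < α := by positivity
  have hα1 : α ≤ 1 := by
    rw [hα, div_le_one (by positivity)]
    have : Real.exp (-2) ≤ 1 := Real.exp_le_one_iff.2 (by norm_num)
    linarith
  refine ⟨(α / (16 * C)) ^ ((s + 1 : ℝ) / (s + 3)), by positivity, fun m n hm hn hlt => ?_⟩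
  have hm' : (2 : ℝ) ≤ m := by exact_mod_cast hm
  have hn1 : (1 : ℝ) ≤ n := by exact_mod_cast hn
  have hlog : 0.69 < Real.log m := by
    have := Real.log_le_log (by norm_num) hm'
    linarith [Real.log_two_gt_d9]
  have hlog0 : 0 < Real.log m := by linarith
  rw [← Real.mul_rpow (by positivity) (by positivity)] at hlt
  have hnq := mul_rpow_lt_of_lt_rpow hn (by positivity) hlt
  have hq := hpow n hn
  have hq1 : (n : ℝ) ^ (-(2 / (s + 1 : ℝ))) ≤ 1 :=
    Real.rpow_le_one_of_one_le_of_nonpos hn1 (neg_nonpos.2 (by positivity))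
  have hq0 : 0 < (n : ℝ) ^ (-(2 / (s + 1 : ℝ))) := by positivity
  set q := (n : ℝ) ^ (-(2 / (s + 1 : ℝ)))
  have hp0 : 0 ≤ α * q := by positivity
  have hp1 : α * q ≤ 1 := mul_le_one₀ hα1 hq0.le hq1
  have hpm : 16 * C * (n * Real.log m) < α * q * m := by
    have e : α / (16 * C) * (m / Real.log m) * q = α * q * m / (16 * C * Real.log m) := by
      field_simp
    rw [e, lt_div_iff₀ (by positivity)] at hnq
    linarith
  have hnlog : 0.69 * n ≤ n * Real.log m := by
    rw [mul_comm]
    gcongr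
  have hnm : (n : ℝ) ≤ m := by
    have e1 : α * q * m ≤ m := mul_le_of_le_one_left (by positivity) hp1
    have e2 : 16 * 3 * (n * Real.log m) ≤ 16 * C * (n * Real.log m) := by gcongr
    linarith
  have hlognm : n * Real.log n ≤ n * Real.log m := by gcongr
  set y := α * q * m / (4 * C) with hy
  have hy4 : 4 * (n * Real.log m) < y := by
    rw [hy, lt_div_iff₀ (by positivity)]
    linarith
  have hk1 : y - 1 < ⌊y⌋₊ := Nat.sub_one_lt_floor y
  have hk2 : (⌊y⌋₊ : ℝ) ≤ y := Nat.floor_le (by positivity)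
  refine ⟨α * q, ⌊y⌋₊, hp0, hp1, pow_mul_add_lt_one (by omega) hn hp0 hp1 ?_ ?_ ?_⟩
  · have e1 : (α * q) ^ C = α * q * (α ^ (C - 1) * q ^ (C - 1)) := by
      rw [← mul_pow, ← pow_succ']
      congr 1
      omega
    have e2 : α ^ (C - 1) ≤ α := pow_le_of_le_one hα0.le hα1 (by omega)
    calc ((m * n ^ (s - 2) : ℕ) : ℝ) * (α * q) ^ C
        = α * q * m * α ^ (C - 1) * (n ^ (s - 2) * q ^ (C - 1)) := by
          rw [e1]; push_cast; ring
      _ = α * q * m * α ^ (C - 1) := by rw [hq, mul_one]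
      _ ≤ α * q * m * α := by gcongr
      _ = y / 2 * Real.exp (-2) := by
          rw [hy]
          conv_lhs => rw [show α * q * m * α = α * q * m * (Real.exp (-2) / (8 * C)) from rfl]
          field_simp
          ring
      _ ≤ ⌊y⌋₊ * Real.exp (-2) := by
          gcongr
          linarith
  · calc (C : ℝ) * ⌊y⌋₊ ≤ C * y := by gcongr
      _ = α * q * m / 4 := by
          rw [hy]
          field_simp
  · linarith

theorem stmt_0 (s : ℕ) (hs : 3 ≤ s) :
    ∃ c : ℝ, 0 < c ∧
      ∀ (β : Type) [Fintype β] (G : SimpleGraph β) (m : ℕ),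
        G.edgeSet.ncard = m → 2 ≤ m →
        c * ((m : ℝ) / Real.log m) ^ ((s + 1 : ℝ) / (s + 3)) ≤
          ramseyNumber (⊤ : SimpleGraph (Fin s)) G := by
  obtain ⟨c, hc, h⟩ := exists_deletion_parameters hs
  refine ⟨c, hc, fun β _ G m hm hm2 => ?_⟩
  subst hm
  by_contra! hlt
  obtain ⟨hpos, hR⟩ := ramseyProp_ramseyNumber (⊤ : SimpleGraph (Fin s)) G
  obtain ⟨p, k, h0, h1, hk⟩ := h _ _ hm2 hpos hlt
  exact not_ramseyProp_of_lt G (by omega) hpos h0 h1 hk hR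
end

section
/- For every integer s ≥ 3 there exists a constant C > 0 (depending only on s) such that for every sufficiently large integer m there exists a graph G with exactly m edges satisfying r(K_s, G) ≤ C · m^{(s-1)/s} / (log m)^{(s-2)/s}. -/
open SimpleGraph

section HardCore

open Finset

open scoped Classical in
/-- The independent sets of `G` contained in `S`. -/
noncomputable def indepSubsets {V : Type*} (G : SimpleGraph V) (S : Finset V) :
    Finset (Finset V) :=
  S.powerset.filter fun I => G.IsIndepSet (I : Set V)

/-- The partition function at fugacity `l` of the hard-core model on `S`. -/
noncomputable def hardCoreSum {V : Type*} (G : SimpleGraph V) (l : ℝ) (S : Finset V) : ℝ :=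
  ∑ I ∈ indepSubsets G S, l ^ #I

variable {V : Type*} {G : SimpleGraph V}

lemma mem_indepSubsets {S I : Finset V} :
    I ∈ indepSubsets G S ↔ I ⊆ S ∧ G.IsIndepSet (I : Set V) := by
  simp [indepSubsets]

lemma isIndepSet_mono {s t : Set V} (h : s ⊆ t) (ht : G.IsIndepSet t) : G.IsIndepSet s :=
  Set.Pairwise.mono h ht

lemma empty_mem_indepSubsets (S : Finset V) : ∅ ∈ indepSubsets G S := by
  simp [mem_indepSubsets, SimpleGraph.IsIndepSet]

lemma one_le_hardCoreSum {l : ℝ} (hl : 0 ≤ l) (S : Finset V) : 1 ≤ hardCoreSum G l S := by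
  have := single_le_sum (f := fun I : Finset V => l ^ #I) (fun I _ => by positivity)
    (empty_mem_indepSubsets (G := G) S)
  simpa [hardCoreSum] using this

open scoped Classical in
lemma hardCoreSum_le_mul {l : ℝ} (hl : 0 ≤ l) {S T : Finset V} :
    hardCoreSum G l S ≤ (1 + l) ^ #(S \ T) * hardCoreSum G l T := by
  have h1 : (1 + l) ^ #(S \ T) = ∑ J ∈ (S \ T).powerset, l ^ #J := by
    rw [add_comm, ← sum_pow_mul_eq_add_pow]
    simp
  rw [h1, hardCoreSum, hardCoreSum, sum_mul_sum, ← sum_product']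
  have hinj : Set.InjOn (fun I : Finset V => (I \ T, I ∩ T)) (indepSubsets G S) := by
    intro I _ J _ h
    simp only [Prod.mk.injEq] at h
    rw [← sdiff_union_inter I T, ← sdiff_union_inter J T, h.1, h.2]
  calc ∑ I ∈ indepSubsets G S, l ^ #I
      = ∑ I ∈ indepSubsets G S, l ^ #(I \ T) * l ^ #(I ∩ T) := by
        refine sum_congr rfl fun I _ => ?_
        rw [← pow_add, card_sdiff_add_card_inter]
    _ = ∑ p ∈ (indepSubsets G S).image (fun I : Finset V => (I \ T, I ∩ T)),
          l ^ #p.1 * l ^ #p.2 := by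
        rw [sum_image hinj]
    _ ≤ _ := by
        refine sum_le_sum_of_subset_of_nonneg ?_ (fun p _ _ => by positivity)
        intro p hp
        obtain ⟨I, hI, rfl⟩ := mem_image.1 hp
        rw [mem_indepSubsets] at hI
        rw [mem_product, mem_powerset, mem_indepSubsets]
        exact ⟨sdiff_subset_sdiff hI.1 le_rfl, inter_subset_right,
          isIndepSet_mono (by simp) hI.2⟩

lemma hardCoreSum_le_exp {l : ℝ} (hl : 0 ≤ l) (S : Finset V) :
    hardCoreSum G l S ≤ Real.exp (l * #S) := by
  classical
  have h := hardCoreSum_le_mul (G := G) hl (S := S) (T := ∅)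
  have h0 : hardCoreSum G l ∅ = 1 := by
    have : indepSubsets G (∅ : Finset V) = {∅} := by
      ext I
      simp only [mem_indepSubsets, subset_empty, mem_singleton]
      constructor
      · exact fun h => h.1
      · rintro rfl
        exact ⟨rfl, by simp [SimpleGraph.IsIndepSet]⟩
    simp [hardCoreSum, this]
  rw [h0, mul_one] at h
  refine (h.trans (pow_le_pow_left₀ (by positivity)
    ((add_comm _ _).le.trans (Real.add_one_le_exp l)) _)).trans ?_
  rw [← Real.exp_nat_mul]
  exact Real.exp_le_exp.2 (by rw [sdiff_empty, mul_comm])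

open scoped Classical in
lemma mul_hardCoreSum_le_sum_mem {l : ℝ} (hl : 0 ≤ l) {S : Finset V} {u : V} (hu : u ∈ S) :
    l * hardCoreSum G l (S.filter fun w => w ≠ u ∧ ¬ G.Adj u w) ≤
      ∑ I ∈ indepSubsets G S, if u ∈ I then l ^ #I else 0 := by
  set R := S.filter fun w => w ≠ u ∧ ¬ G.Adj u w with hR
  have hnot : ∀ J ∈ indepSubsets G R, u ∉ J := by
    intro J hJ hmem
    have := (mem_indepSubsets.1 hJ).1 hmem
    simp [hR] at this
  have hinj : Set.InjOn (fun J : Finset V => insert u J) (indepSubsets G R) := by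
    intro J hJ K hK h
    have h' : insert u J = insert u K := h
    rw [← erase_insert (hnot J hJ), h', erase_insert (hnot K hK)]
  rw [← sum_filter]
  calc l * hardCoreSum G l R = ∑ J ∈ indepSubsets G R, l ^ #(insert u J) := by
        rw [hardCoreSum, mul_sum]
        refine sum_congr rfl fun J hJ => ?_
        rw [card_insert_of_notMem (hnot J hJ), pow_succ']
    _ = ∑ I ∈ (indepSubsets G R).image (fun J : Finset V => insert u J), l ^ #I := by
        rw [sum_image hinj]
    _ ≤ _ := by
        refine sum_le_sum_of_subset_of_nonneg ?_ (fun p _ _ => by positivity)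
        intro I hI
        obtain ⟨J, hJ, rfl⟩ := mem_image.1 hI
        rw [mem_indepSubsets] at hJ
        simp only [mem_filter, mem_indepSubsets, mem_insert, true_or, and_true]
        refine ⟨insert_subset hu (hJ.1.trans (filter_subset _ _)), ?_⟩
        rw [coe_insert]
        refine (Set.pairwise_insert).2 ⟨hJ.2, fun b hb _ => ?_⟩
        have := hJ.1 hb
        simp only [hR, mem_filter] at this
        exact ⟨this.2.2, fun h => this.2.2 h.symm⟩

open scoped Classical in
/-- Lower bound for the total size of the hard-core model in a graph of small maximum degree. -/
lemma mul_hardCoreSum_le_sum_card {l D : ℝ} (hl : 0 ≤ l) (hD : l * D ≤ 1) {S : Finset V}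
    (hS : ∀ u ∈ S, (#(S.filter (G.Adj u)) : ℝ) + 1 ≤ D) :
    l * #S / Real.exp 1 * hardCoreSum G l S ≤ ∑ I ∈ indepSubsets G S, (#I : ℝ) * l ^ #I := by
  have h1 : ∀ I ∈ indepSubsets G S,
      (#I : ℝ) * l ^ #I = ∑ u ∈ S, if u ∈ I then l ^ #I else 0 := by
    intro I hI
    rw [← sum_filter, filter_mem_eq_inter, inter_eq_right.2 (mem_indepSubsets.1 hI).1]
    simp
  rw [sum_congr rfl h1, sum_comm]
  have h2 : ∀ u ∈ S, l / Real.exp 1 * hardCoreSum G l S ≤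
      ∑ I ∈ indepSubsets G S, if u ∈ I then l ^ #I else 0 := by
    intro u hu
    refine le_trans ?_ (mul_hardCoreSum_le_sum_mem hl hu)
    rw [div_mul_eq_mul_div, mul_div_assoc]
    refine mul_le_mul_of_nonneg_left ?_ hl
    rw [div_le_iff₀ (Real.exp_pos 1), mul_comm]
    have hZ : 0 ≤ hardCoreSum G l (S.filter fun w => w ≠ u ∧ ¬ G.Adj u w) :=
      zero_le_one.trans (one_le_hardCoreSum hl _)
    refine (hardCoreSum_le_mul hl (T := S.filter fun w => w ≠ u ∧ ¬ G.Adj u w)).trans ?_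
    refine mul_le_mul_of_nonneg_right ?_ hZ
    refine (pow_le_pow_left₀ (by positivity)
      ((add_comm _ _).le.trans (Real.add_one_le_exp l)) _).trans ?_
    rw [← Real.exp_nat_mul]
    refine Real.exp_le_exp.2 (le_trans ?_ hD)
    rw [mul_comm]
    refine mul_le_mul_of_nonneg_left (le_trans ?_ (hS u hu)) hl
    have : S \ (S.filter fun w => w ≠ u ∧ ¬ G.Adj u w) ⊆ insert u (S.filter (G.Adj u)) := by
      intro w
      simp only [mem_sdiff, mem_filter, mem_insert]
      tauto
    exact_mod_cast (card_le_card this).trans (card_insert_le _ _)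
  refine le_trans (le_of_eq ?_) (sum_le_sum h2)
  rw [sum_const, nsmul_eq_mul]
  ring

open scoped Classical in
lemma log_mul_hardCoreSum_le {l d D : ℝ} (hl : 0 < l) (hl1 : l ≤ 1) (hD : l * D ≤ 1)
    (hd : 1 ≤ l * d) {S : Finset V}
    (hS : ∀ u ∈ S, (#(S.filter (G.Adj u)) : ℝ) + 1 ≤ D) :
    Real.log (l * d) / (4 * Real.exp 1) * (l + hardCoreSum G l S) ≤
      l * d + ∑ I ∈ indepSubsets G S, (#I : ℝ) * l ^ #I := by
  have hZ1 := one_le_hardCoreSum (G := G) hl.le S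
  have hexp := hardCoreSum_le_exp (G := G) hl.le S
  refine le_trans ?_ (add_le_add_right (mul_hardCoreSum_le_sum_card hl.le hD hS) _)
  set Z := hardCoreSum G l S
  set y := l * (#S : ℝ) with hy
  have hy0 : 0 ≤ y := by positivity
  have he : 1 ≤ Real.exp 1 := Real.one_le_exp zero_le_one
  have he0 := Real.exp_pos 1
  set z := l * d
  have hlog : 0 ≤ Real.log z := Real.log_nonneg hd
  have key : Real.log z / (2 * Real.exp 1) * Z ≤ z + y / Real.exp 1 * Z := by
    rcases le_total (Real.log z / 2) y with h | h
    · have : Real.log z / (2 * Real.exp 1) ≤ y / Real.exp 1 := by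
        rw [← div_div]
        gcongr
      nlinarith [mul_le_mul_of_nonneg_right this (zero_le_one.trans hZ1)]
    · have hsq : Z ≤ √z := by
        rw [Real.sqrt_eq_rpow, Real.rpow_def_of_pos (by linarith)]
        exact hexp.trans (Real.exp_le_exp.2 (by linarith))
      have h2 : Real.log z / (2 * Real.exp 1) ≤ √z := by
        have h3 : Real.log (√z) ≤ √z := (Real.log_le_sub_one_of_pos (by positivity)).trans
          (by linarith)
        rw [Real.log_sqrt (by linarith)] at h3
        rw [← div_div]
        exact (div_le_self (by positivity) he).trans h3
      calc Real.log z / (2 * Real.exp 1) * Z ≤ √z * √z := by gcongr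
        _ = z := Real.mul_self_sqrt (by linarith)
        _ ≤ _ := le_add_of_nonneg_right (by positivity)
  refine le_trans ?_ key
  calc Real.log z / (4 * Real.exp 1) * (l + Z) ≤ Real.log z / (4 * Real.exp 1) * (2 * Z) := by
        gcongr
        linarith
    _ = _ := by field_simp; ring

open scoped Classical in
/-- Conditioning on the part `H` of the independent set outside the closed neighbourhood of `v`. -/
lemma sum_filter_sdiff_eq {S : Finset V} {v : V} (hv : v ∈ S) {H : Finset V}
    (hH : H ∈ indepSubsets G (S.filter fun w => w ≠ v ∧ ¬ G.Adj v w)) (g : Finset V → ℝ) :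
    ∑ W ∈ (indepSubsets G S).filter (fun W => W.filter (fun w => w ≠ v ∧ ¬ G.Adj v w) = H), g W =
      g (insert v H) + ∑ I ∈ indepSubsets G (S.filter fun u => G.Adj v u ∧ ∀ h ∈ H, ¬ G.Adj u h),
        g (H ∪ I) := by
  obtain ⟨hHS, hHi⟩ := mem_indepSubsets.1 hH
  have hHS' : ∀ w ∈ H, w ∈ S ∧ w ≠ v ∧ ¬ G.Adj v w := fun w hw => by
    simpa using hHS hw
  rw [← sum_filter_add_sum_filter_not _ (fun W => v ∈ W)]
  congr 1
  · have : ((indepSubsets G S).filter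
        (fun W => W.filter (fun w => w ≠ v ∧ ¬ G.Adj v w) = H)).filter (fun W => v ∈ W) =
        {insert v H} := by
      ext W
      simp only [mem_filter, mem_indepSubsets, mem_singleton]
      constructor
      · rintro ⟨⟨⟨hWS, hWi⟩, rfl⟩, hvW⟩
        ext w
        simp only [mem_insert, mem_filter]
        constructor
        · intro hw
          by_cases hwv : w = v
          · exact Or.inl hwv
          · exact Or.inr ⟨hw, hwv, hWi hvW hw (Ne.symm hwv)⟩
        · rintro (rfl | h)
          · exact hvW
          · exact h.1
      · rintro rfl
        refine ⟨⟨⟨insert_subset hv fun w hw => (hHS' w hw).1, ?_⟩, ?_⟩, mem_insert_self _ _⟩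
        · rw [coe_insert]
          refine (Set.pairwise_insert).2 ⟨hHi, fun b hb _ => ?_⟩
          exact ⟨(hHS' b hb).2.2, fun h => (hHS' b hb).2.2 h.symm⟩
        · ext w
          simp only [mem_filter, mem_insert]
          constructor
          · rintro ⟨h1 | h1, h2, _⟩
            · exact absurd h1 h2
            · exact h1
          · exact fun h => ⟨Or.inr h, (hHS' w h).2⟩
    rw [this, sum_singleton]
  · have hadj : ∀ I ∈ indepSubsets G (S.filter fun u => G.Adj v u ∧ ∀ h ∈ H, ¬ G.Adj u h),
        ∀ w ∈ I, w ∈ S ∧ G.Adj v w ∧ ∀ h ∈ H, ¬ G.Adj w h := fun I hI w hw => by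
      simpa using (mem_indepSubsets.1 hI).1 hw
    have hset : ((indepSubsets G S).filter
        (fun W => W.filter (fun w => w ≠ v ∧ ¬ G.Adj v w) = H)).filter (fun W => v ∉ W) =
        (indepSubsets G (S.filter fun u => G.Adj v u ∧ ∀ h ∈ H, ¬ G.Adj u h)).image
          (fun I => H ∪ I) := by
      ext W
      simp only [mem_filter, mem_image]
      constructor
      · rintro ⟨⟨hW, rfl⟩, hvW⟩
        obtain ⟨hWS, hWi⟩ := mem_indepSubsets.1 hW
        refine ⟨W.filter (G.Adj v), mem_indepSubsets.2 ⟨?_, isIndepSet_mono (coe_subset.2 (filter_subset _ _)) hWi⟩, ?_⟩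
        · intro w hw
          simp only [mem_filter] at hw ⊢
          exact ⟨hWS hw.1, hw.2, fun h hh hadj => hWi hw.1 hh.1 hadj.ne hadj⟩
        · ext w
          simp only [mem_union, mem_filter]
          constructor
          · rintro (h | h) <;> exact h.1
          · intro hw
            have : w ≠ v := fun h => hvW (h ▸ hw)
            tauto
      · rintro ⟨I, hI, rfl⟩
        have hI' := hadj I hI
        refine ⟨⟨mem_indepSubsets.2 ⟨union_subset (fun w hw => (hHS' w hw).1)
          fun w hw => (hI' w hw).1, ?_⟩, ?_⟩, ?_⟩
        · intro a ha b hb hab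
          rw [mem_coe, mem_union] at ha hb
          rcases ha with ha | ha <;> rcases hb with hb | hb
          · exact hHi ha hb hab
          · exact fun h => (hI' b hb).2.2 a ha h.symm
          · exact (hI' a ha).2.2 b hb
          · exact (mem_indepSubsets.1 hI).2 ha hb hab
        · ext w
          simp only [mem_filter, mem_union]
          constructor
          · rintro ⟨h | h, _, h2⟩
            · exact h
            · exact absurd (hI' w h).2.1 h2
          · exact fun h => ⟨Or.inl h, (hHS' w h).2⟩
        · rw [mem_union]
          rintro (h | h)
          · exact (hHS' v h).2.1 rfl
          · exact (hI' v h).2.1.ne rfl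
    rw [hset, sum_image]
    intro I hI J hJ h
    have h' : H ∪ I = H ∪ J := h
    have hf : ∀ K ∈ indepSubsets G (S.filter fun u => G.Adj v u ∧ ∀ h ∈ H, ¬ G.Adj u h),
        (H ∪ K).filter (G.Adj v) = K := by
      intro K hK
      ext w
      simp only [mem_filter, mem_union]
      constructor
      · rintro ⟨h | h, h2⟩
        · exact absurd h2 (hHS' w h).2.2
        · exact h
      · exact fun h => ⟨Or.inr h, (hadj K hK w h).2.1⟩
    rw [← hf I hI, h', hf J hJ]

open scoped Classical in
/-- In the hard-core model of a locally sparse graph, every closed neighbourhood contributes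
at least logarithmically to the expected size. -/
lemma sum_local_nonneg {l d D : ℝ} (hl : 0 < l) (hl1 : l ≤ 1) (hD : l * D ≤ 1)
    (hd : 1 ≤ l * d) {S : Finset V} {v : V} (hv : v ∈ S)
    (hS : ∀ u ∈ S, G.Adj v u → (#(S.filter fun w => G.Adj v w ∧ G.Adj u w) : ℝ) + 1 ≤ D) :
    0 ≤ ∑ W ∈ indepSubsets G S, l ^ #W * ((if v ∈ W then d else 0) + #(W.filter (G.Adj v)) -
      Real.log (l * d) / (4 * Real.exp 1)) := by
  set T := Real.log (l * d) / (4 * Real.exp 1) with hT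
  set R := S.filter fun w => w ≠ v ∧ ¬ G.Adj v w with hR
  have hmaps : ∀ W ∈ indepSubsets G S,
      W.filter (fun w => w ≠ v ∧ ¬ G.Adj v w) ∈ indepSubsets G R := by
    intro W hW
    rw [mem_indepSubsets] at hW ⊢
    exact ⟨filter_subset_filter _ hW.1, isIndepSet_mono (coe_subset.2 (filter_subset _ _)) hW.2⟩
  rw [← sum_fiberwise_of_maps_to hmaps]
  refine sum_nonneg fun H hH => ?_
  rw [sum_filter_sdiff_eq hv hH]
  set X := S.filter fun u => G.Adj v u ∧ ∀ h ∈ H, ¬ G.Adj u h with hX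
  have hHS' : ∀ w ∈ H, w ∈ S ∧ w ≠ v ∧ ¬ G.Adj v w := fun w hw => by
    simpa [hR] using (mem_indepSubsets.1 hH).1 hw
  have hvH : v ∉ H := fun h => (hHS' v h).2.1 rfl
  have hfH : H.filter (G.Adj v) = ∅ := filter_eq_empty_iff.2 fun w hw => (hHS' w hw).2.2
  have hXd : ∀ u ∈ X, (#(X.filter (G.Adj u)) : ℝ) + 1 ≤ D := by
    intro u hu
    simp only [hX, mem_filter] at hu
    refine le_trans ?_ (hS u hu.1 hu.2.1)
    gcongr
    intro w hw
    simp only [hX, mem_filter] at hw ⊢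
    exact ⟨hw.1.1, hw.1.2.1, hw.2⟩
  have hterm : ∀ I ∈ indepSubsets G X,
      l ^ #(H ∪ I) * ((if v ∈ H ∪ I then d else 0) + #((H ∪ I).filter (G.Adj v)) - T) =
      l ^ #H * ((#I : ℝ) * l ^ #I - T * l ^ #I) := by
    intro I hI
    have hI' : ∀ w ∈ I, w ∈ S ∧ G.Adj v w ∧ ∀ h ∈ H, ¬ G.Adj w h := fun w hw => by
      simpa [hX] using (mem_indepSubsets.1 hI).1 hw
    have hvI : v ∉ H ∪ I := by
      rw [mem_union]
      rintro (h | h)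
      · exact hvH h
      · exact (hI' v h).2.1.ne rfl
    have hdisj : Disjoint H I :=
      disjoint_left.2 fun w hw hw' => (hHS' w hw).2.2 (hI' w hw').2.1
    have hfI : I.filter (G.Adj v) = I := filter_true_of_mem fun w hw => (hI' w hw).2.1
    rw [if_neg hvI, card_union_of_disjoint hdisj, filter_union, hfH, hfI, empty_union]
    ring
  have hins : (insert v H).filter (G.Adj v) = ∅ := by
    rw [filter_insert, if_neg (G.irrefl), hfH]
  rw [sum_congr rfl hterm, ← mul_sum, sum_sub_distrib, ← mul_sum, if_pos (mem_insert_self _ _),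
    hins, card_insert_of_notMem hvH]
  have := log_mul_hardCoreSum_le hl hl1 hD hd hXd
  rw [← hT] at this
  have hpow : 0 < l ^ #H := by positivity
  have hnn : 0 ≤ l * d + ∑ I ∈ indepSubsets G X, (#I : ℝ) * l ^ #I
      - T * (l + hardCoreSum G l X) := sub_nonneg.2 this
  have := mul_nonneg hpow.le hnn
  refine this.trans (le_of_eq ?_)
  rw [hardCoreSum, card_empty]
  push_cast
  ring

open scoped Classical in
/-- A locally sparse graph contains a large independent set. -/
theorem exists_indepSet_of_locally_sparse {d D : ℝ} (hD : 1 ≤ D) (hd : D ≤ d) (S : Finset V)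
    (hdeg : ∀ v ∈ S, (#(S.filter (G.Adj v)) : ℝ) ≤ d)
    (hS : ∀ v ∈ S, ∀ u ∈ S, G.Adj v u →
      (#(S.filter fun w => G.Adj v w ∧ G.Adj u w) : ℝ) + 1 ≤ D) :
    ∃ W ⊆ S, G.IsIndepSet (W : Set V) ∧
      Real.log (d / D) / (4 * Real.exp 1) * #S ≤ 2 * d * #W := by
  have hD0 : 0 < D := by linarith
  set l := D⁻¹ with hl
  have hl0 : 0 < l := by positivity
  have hl1 : l ≤ 1 := inv_le_one_of_one_le₀ hD
  have hlD : l * D ≤ 1 := (inv_mul_cancel₀ hD0.ne').le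
  have hld : l * d = d / D := by rw [hl]; ring
  have hld1 : 1 ≤ l * d := by rw [hld]; exact (one_le_div hD0).2 hd
  rw [← hld]
  set T := Real.log (l * d) / (4 * Real.exp 1) with hT
  by_contra! hcon
  have hsum : 0 ≤ ∑ v ∈ S, ∑ W ∈ indepSubsets G S, l ^ #W *
      ((if v ∈ W then d else 0) + #(W.filter (G.Adj v)) - T) :=
    sum_nonneg fun v hv => sum_local_nonneg hl0 hl1 hlD hld1 hv (hS v hv)
  rw [sum_comm] at hsum
  refine absurd hsum (not_le.2 (sum_neg (fun W hW => ?_) ⟨∅, empty_mem_indepSubsets S⟩))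
  obtain ⟨hWS, hWi⟩ := mem_indepSubsets.1 hW
  rw [← mul_sum]
  refine mul_neg_of_pos_of_neg (by positivity) ?_
  rw [sum_sub_distrib, sum_add_distrib, ← sum_filter, filter_mem_eq_inter,
    inter_eq_right.2 hWS, sum_const, sum_const, nsmul_eq_mul, nsmul_eq_mul]
  have hcount : ∑ v ∈ S, (#(W.filter (G.Adj v)) : ℝ) ≤ #W * d := by
    have : ∑ v ∈ S, #(W.filter (G.Adj v)) = ∑ w ∈ W, #(S.filter (G.Adj w)) := by
      simp_rw [card_filter]
      rw [sum_comm]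
      simp_rw [G.adj_comm]
    rw [← Nat.cast_sum, this, Nat.cast_sum, ← nsmul_eq_mul]
    exact sum_le_card_nsmul _ _ _ fun w hw => hdeg w (hWS hw)
  have := hcon W hWS hWi
  linarith

end HardCore

section Ramsey

open Finset

/-- An upper bound for the Ramsey number `r(K_{k+1}, K_n)`. -/
noncomputable def cliqueRamseyBound (k n : ℕ) : ℝ :=
  50 ^ (k + 1) * Real.log n * (n / Real.log n) ^ k

lemma log_le_sqrt {x : ℝ} (hx : 0 < x) : Real.log x ≤ √x := by
  have h := Real.add_one_le_exp (Real.log (√x) - 1)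
  rw [Real.exp_sub, Real.exp_log (Real.sqrt_pos.2 hx), Real.log_sqrt hx.le] at h
  have h2 : (2 : ℝ) ≤ Real.exp 1 := by
    have := Real.add_one_le_exp (1 : ℝ)
    linarith
  have h3 : √x / Real.exp 1 ≤ √x / 2 := by gcongr
  linarith

lemma half_lt_log {n : ℕ} (hn : 2 ≤ n) : 1 / 2 < Real.log n := by
  have h1 : Real.log 2 ≤ Real.log n := Real.log_le_log (by norm_num) (by exact_mod_cast hn)
  have := Real.log_two_gt_d9
  linarith

lemma sqrt_le_div_log {n : ℕ} (hn : 2 ≤ n) : √(n : ℝ) ≤ n / Real.log n := by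
  have hn0 : (0 : ℝ) < n := by positivity
  have hL := half_lt_log hn
  rw [le_div_iff₀ (by linarith)]
  calc √(n : ℝ) * Real.log n ≤ √(n : ℝ) * √(n : ℝ) := by
        gcongr
        exact log_le_sqrt hn0
    _ = n := Real.mul_self_sqrt hn0.le

lemma one_le_div_log {n : ℕ} (hn : 2 ≤ n) : 1 ≤ (n : ℝ) / Real.log n :=
  le_trans (Real.one_le_sqrt.2 (by exact_mod_cast (by omega : 1 ≤ n))) (sqrt_le_div_log hn)

lemma one_le_cliqueRamseyBound {k n : ℕ} (hn : 2 ≤ n) : 1 ≤ cliqueRamseyBound k n := by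
  have hL := half_lt_log hn
  have h1 : (1 : ℝ) ≤ (n / Real.log n) ^ k := one_le_pow₀ (one_le_div_log hn)
  have h2 : (50 : ℝ) ≤ 50 ^ (k + 1) := le_self_pow₀ (by norm_num) (by omega)
  have h3 : (1 : ℝ) ≤ 50 ^ (k + 1) * Real.log n := by nlinarith
  exact one_le_mul_of_one_le_of_one_le h3 h1

lemma cliqueRamseyBound_succ (k n : ℕ) :
    cliqueRamseyBound (k + 1) n = 50 * (n / Real.log n) * cliqueRamseyBound k n := by
  unfold cliqueRamseyBound
  ring

variable {V : Type*} {G : SimpleGraph V}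

open scoped Classical in
lemma card_le_of_isClique_of_adj {S K : Finset V} {v : V} {k : ℕ} (hv : v ∈ S)
    (hS : ∀ K ⊆ S, G.IsClique (K : Set V) → #K ≤ k + 1)
    (hK : K ⊆ S.filter (G.Adj v)) (hKc : G.IsClique (K : Set V)) : #K ≤ k := by
  have hK' : ∀ w ∈ K, w ∈ S ∧ G.Adj v w := fun w hw => by simpa using hK hw
  have hvK : v ∉ K := fun h => (hK' v h).2.ne rfl
  have := hS (insert v K) (insert_subset hv fun w hw => (hK' w hw).1) (by
    rw [coe_insert]
    exact SimpleGraph.isClique_insert.2 ⟨hKc, fun w hw _ => (hK' w hw).2⟩)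
  rw [card_insert_of_notMem hvK] at this
  omega

/-- The Ajtai–Komlós–Szemerédi bound: a set with no clique on more than `k` vertices and
no independent set on `n` vertices has fewer than `cliqueRamseyBound k n` elements. -/
theorem card_lt_cliqueRamseyBound {n : ℕ} (hn : 2 ≤ n) (k : ℕ) (S : Finset V)
    (hK : ∀ K ⊆ S, G.IsClique (K : Set V) → #K ≤ k)
    (hI : ∀ W ⊆ S, G.IsIndepSet (W : Set V) → #W < n) :
    (#S : ℝ) < cliqueRamseyBound k n := by
  classical
  induction k using Nat.twoStepInduction generalizing S with
  | zero =>
    have : S = ∅ := by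
      by_contra h
      obtain ⟨v, hv⟩ := nonempty_iff_ne_empty.2 h
      have := hK {v} (singleton_subset_iff.2 hv) (by simp)
      simp at this
    rw [this]
    exact lt_of_lt_of_le (by simp) (one_le_cliqueRamseyBound hn)
  | one =>
    have h1 : #S < n := by
      refine hI S subset_rfl fun v hv w hw hvw hadj => ?_
      have := card_le_of_isClique_of_adj (k := 0) (K := {w}) hv hK
        (by simpa using ⟨mem_coe.1 hw, hadj⟩) (by simp)
      simp at this
    have h2 : (#S : ℝ) < n := by exact_mod_cast h1
    have hL := half_lt_log hn
    have h3 : cliqueRamseyBound 1 n = 2500 * n := by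
      have : Real.log n ≠ 0 := by linarith
      unfold cliqueRamseyBound
      field_simp
      norm_num
    rw [h3]
    have : (0 : ℝ) ≤ n := by positivity
    linarith
  | more k ih1 ih2 =>
    have hB1 := one_le_cliqueRamseyBound (k := k) hn
    have hx1 := one_le_div_log hn
    have hL := half_lt_log hn
    have hn0 : (0 : ℝ) < n := by positivity
    have hsucc := cliqueRamseyBound_succ k n
    have hsub : ∀ T ⊆ S, ∀ W ⊆ T, G.IsIndepSet (W : Set V) → #W < n :=
      fun T hT W hW => hI W (hW.trans hT)
    have hdeg : ∀ v ∈ S, (#(S.filter (G.Adj v)) : ℝ) ≤ cliqueRamseyBound (k + 1) n :=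
      fun v hv => (ih2 _ (fun K hKS hKc => card_le_of_isClique_of_adj hv hK hKS hKc)
        (hsub _ (filter_subset _ _))).le
    have hcodeg : ∀ v ∈ S, ∀ u ∈ S, G.Adj v u →
        (#(S.filter fun w => G.Adj v w ∧ G.Adj u w) : ℝ) + 1 ≤ 2 * cliqueRamseyBound k n := by
      intro v hv u hu huv
      have := ih1 (S.filter fun w => G.Adj v w ∧ G.Adj u w) (fun K hKS hKc => by
        refine card_le_of_isClique_of_adj (S := S.filter (G.Adj v)) (v := u)
          (by simp [hu, huv])
          (fun K' hK' hKc' => card_le_of_isClique_of_adj hv hK hK' hKc') ?_ hKc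
        rwa [filter_filter]) (hsub _ (filter_subset _ _))
      linarith
    obtain ⟨W, hWS, hWi, hW⟩ := exists_indepSet_of_locally_sparse
      (d := cliqueRamseyBound (k + 1) n) (D := 2 * cliqueRamseyBound k n) (by linarith)
      (by rw [hsucc]; nlinarith) S hdeg hcodeg
    have hratio : cliqueRamseyBound (k + 1) n / (2 * cliqueRamseyBound k n) =
        25 * (n / Real.log n) := by
      rw [hsucc]
      field_simp
      norm_num
    have hlog : Real.log n / 2 ≤
        Real.log (cliqueRamseyBound (k + 1) n / (2 * cliqueRamseyBound k n)) := by
      rw [hratio, ← Real.log_sqrt hn0.le]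
      exact Real.log_le_log (Real.sqrt_pos.2 hn0) (by linarith [sqrt_le_div_log hn])
    have hWn : (#W : ℝ) < n := by exact_mod_cast hI W hWS hWi
    have he := Real.exp_one_lt_d9
    have he0 := Real.exp_pos 1
    have hd0 : 0 < cliqueRamseyBound (k + 1) n :=
      zero_lt_one.trans_le (one_le_cliqueRamseyBound hn)
    rw [cliqueRamseyBound_succ (k + 1)]
    set d := cliqueRamseyBound (k + 1) n
    have h1 : Real.log n / 2 / (4 * Real.exp 1) * #S < 2 * d * n :=
      calc _ ≤ _ := by gcongr
        _ ≤ _ := hW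
        _ < _ := by gcongr
    have h2 : (#S : ℝ) < 16 * Real.exp 1 * (n / Real.log n) * d := by
      have : Real.log n / 2 / (4 * Real.exp 1) * #S = #S * (Real.log n / (8 * Real.exp 1)) := by
        ring
      rw [this, ← lt_div_iff₀ (by positivity)] at h1
      refine h1.trans_le (le_of_eq ?_)
      field_simp
      norm_num
    refine h2.trans_le ?_
    gcongr
    linarith

/-- Greedily extracting pairwise disjoint independent sets. -/
lemma exists_disjoint_indepSets {B : ℝ} {n : ℕ}
    (h : ∀ S : Finset V, B ≤ #S → ∃ W ⊆ S, G.IsIndepSet (W : Set V) ∧ #W = n)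
    (t : ℕ) (S : Finset V) (hS : t * n + B ≤ #S) :
    ∃ A : Fin t → Finset V, (∀ i, A i ⊆ S ∧ G.IsIndepSet (A i : Set V) ∧ #(A i) = n) ∧
      Pairwise fun i j => Disjoint (A i) (A j) := by
  classical
  induction t generalizing S with
  | zero => exact ⟨Fin.elim0, fun i => i.elim0, fun i => i.elim0⟩
  | succ t ih =>
    obtain ⟨W, hWS, hWi, hWn⟩ := h S (le_trans (by
      have : (0 : ℝ) ≤ ((t + 1 : ℕ) : ℝ) * n := by positivity
      linarith) hS)
    obtain ⟨A, hA, hAd⟩ := ih (S \ W) (by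
      rw [cast_card_sdiff hWS, hWn]
      push_cast at hS
      linarith)
    refine ⟨Fin.cons W A, ?_, ?_⟩
    · intro i
      refine Fin.cases ⟨hWS, hWi, hWn⟩ (fun j => ?_) i
      exact ⟨(hA j).1.trans sdiff_subset, (hA j).2⟩
    · have hWA : ∀ j, Disjoint W (A j) := fun j =>
        disjoint_sdiff.mono_right (hA j).1
      intro i j
      refine Fin.cases (fun hij => ?_) (fun i' hij => ?_) i
      · obtain ⟨j', rfl⟩ := Fin.exists_succ_eq.2 (Ne.symm hij)
        exact hWA j'
      · revert hij
        refine Fin.cases (fun _ => (hWA i').symm) (fun j' hij => ?_) j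
        exact hAd fun h => hij (congrArg Fin.succ h)

/-- The disjoint union of `t` cliques on `n` vertices. -/
def cliqueUnion (t n : ℕ) : SimpleGraph (Fin t × Fin n) where
  Adj p q := p.1 = q.1 ∧ p.2 ≠ q.2
  symm := ⟨fun _ _ h => ⟨h.1.symm, h.2.symm⟩⟩
  loopless := ⟨fun _ h => h.2 rfl⟩

lemma two_mul_ncard_edgeSet_cliqueUnion (t n : ℕ) :
    2 * (cliqueUnion t n).edgeSet.ncard = t * n * (n - 1) := by
  classical
  have h := (cliqueUnion t n).sum_degrees_eq_twice_card_edges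
  rw [← SimpleGraph.coe_edgeFinset, Set.ncard_coe_finset, ← h]
  have hdeg : ∀ p, (cliqueUnion t n).degree p = n - 1 := by
    intro p
    have : (cliqueUnion t n).neighborFinset p = {p.1} ×ˢ ({p.2}ᶜ : Finset (Fin n)) := by
      ext q
      rw [SimpleGraph.mem_neighborFinset, mem_product, mem_singleton, mem_compl, mem_singleton]
      exact and_congr eq_comm (not_congr eq_comm)
    rw [← SimpleGraph.card_neighborFinset_eq_degree, this, card_product, card_compl]
    simp
  simp [hdeg]

lemma ramseyProp_of_le_cliqueUnion {k n t N : ℕ} (hn : 2 ≤ n)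
    (hN : t * n + cliqueRamseyBound k n ≤ N) {H : SimpleGraph (Fin t × Fin n)}
    (hH : H ≤ cliqueUnion t n) : RamseyProp N (⊤ : SimpleGraph (Fin (k + 1))) H := by
  classical
  intro Γ
  by_cases hfree : Γ.CliqueFree (k + 1)
  · right
    obtain ⟨A, hA, hAd⟩ := exists_disjoint_indepSets (G := Γ) (B := cliqueRamseyBound k n)
      (n := n) (fun S hS => by
        by_contra! hcon
        refine absurd (card_lt_cliqueRamseyBound (G := Γ) hn k S (fun K _ hKc => ?_) fun W hWS hWi => ?_)
          (not_lt.2 hS)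
        · by_contra! hlt
          exact hfree.mono hlt K ⟨hKc, rfl⟩
        · by_contra! hle
          obtain ⟨W', hW', hcard⟩ := exists_subset_card_eq hle
          exact hcon W' (hW'.trans hWS) (isIndepSet_mono (coe_subset.2 hW') hWi) hcard)
      t univ (by simpa using hN)
    let f : Fin t × Fin n → Fin N := fun p => (A p.1).orderEmbOfFin (hA p.1).2.2 p.2
    have hf : ∀ p, f p ∈ A p.1 := fun p => orderEmbOfFin_mem _ _ _
    have hinj : Function.Injective f := by
      rintro ⟨i, a⟩ ⟨j, b⟩ h
      have hij : i = j := by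
        by_contra hij
        exact disjoint_left.1 (hAd hij) (hf (i, a)) (h ▸ hf (j, b))
      subst hij
      exact congrArg (Prod.mk i) (((A i).orderEmbOfFin (hA i).2.2).injective h)
    refine ⟨⟨f, fun {p q} hpq => ?_⟩, hinj⟩
    obtain ⟨h1, h2⟩ := hH hpq
    rw [SimpleGraph.compl_adj]
    have hne : f p ≠ f q := fun h => h2 (congrArg Prod.snd (hinj h))
    exact ⟨hne, (hA p.1).2.1 (hf p) (h1 ▸ hf q) hne⟩
  · left
    let e := SimpleGraph.topEmbeddingOfNotCliqueFree hfree
    exact ⟨e.toHom, e.injective⟩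

/-- A graph with exactly `m` edges whose Ramsey number is bounded in terms of a clique size. -/
lemma exists_ncard_edgeSet_eq_ramseyNumber_le {k n t m : ℕ} (hn : 2 ≤ n)
    (hm : 2 * m ≤ t * n * (n - 1)) :
    ∃ (β : Type) (_ : Fintype β) (H : SimpleGraph β), H.edgeSet.ncard = m ∧
      (ramseyNumber (⊤ : SimpleGraph (Fin (k + 1))) H : ℝ) ≤
        t * n + cliqueRamseyBound k n + 1 := by
  rw [← two_mul_ncard_edgeSet_cliqueUnion] at hm
  obtain ⟨E, hE, hEm⟩ := Set.exists_subset_card_eq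
    (show m ≤ (cliqueUnion t n).edgeSet.ncard by omega)
  have hedge : (SimpleGraph.fromEdgeSet E).edgeSet = E := by
    rw [SimpleGraph.edgeSet_fromEdgeSet]
    refine sdiff_eq_left.2 (Set.disjoint_left.2 fun e he hd => ?_)
    exact (cliqueUnion t n).not_isDiag_of_mem_edgeSet (hE he) hd
  have hpos : 0 < t * n + cliqueRamseyBound k n := by
    have := one_le_cliqueRamseyBound (k := k) hn
    positivity
  refine ⟨_, inferInstance, SimpleGraph.fromEdgeSet E, by rw [hedge, hEm], ?_⟩
  have hle : ramseyNumber (⊤ : SimpleGraph (Fin (k + 1))) (SimpleGraph.fromEdgeSet E) ≤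
      ⌈t * n + cliqueRamseyBound k n⌉₊ :=
    Nat.sInf_le ⟨Nat.ceil_pos.2 hpos, ramseyProp_of_le_cliqueUnion hn (Nat.le_ceil _)
      (SimpleGraph.edgeSet_subset_edgeSet.1 (hedge.symm ▸ hE))⟩
  exact (Nat.cast_le.2 hle).trans (Nat.ceil_lt_add_one hpos.le).le

end Ramsey

section Asymptotics

lemma cliqueRamseyBound_le {k n : ℕ} {x L : ℝ} (hk : 1 ≤ k) (hx : 2 ≤ x) (hL : 0 < L)
    (hxn : x ≤ n) (hnx : (n : ℝ) ≤ 2 * x) (hlog : L ≤ (k + 1) * Real.log x) :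
    cliqueRamseyBound k n ≤
      50 ^ (k + 1) * 2 ^ k * (k + 1) ^ (k - 1) * (x ^ k / L ^ (k - 1)) := by
  obtain ⟨j, rfl⟩ := Nat.exists_eq_add_of_le' hk
  rw [Nat.add_sub_cancel]
  have hx0 : 0 < x := by linarith
  have hc : (0 : ℝ) < ((j + 1 : ℕ) : ℝ) + 1 := by positivity
  have hl : L / (((j + 1 : ℕ) : ℝ) + 1) ≤ Real.log n := by
    rw [div_le_iff₀' hc]
    exact hlog.trans (mul_le_mul_of_nonneg_left (Real.log_le_log hx0 hxn) hc.le)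
  have hl0 : 0 < Real.log n := lt_of_lt_of_le (by positivity) hl
  calc cliqueRamseyBound (j + 1) n
      = 50 ^ (j + 1 + 1) * ((n : ℝ) ^ (j + 1) / Real.log n ^ j) := by
        unfold cliqueRamseyBound
        rw [div_pow]
        field_simp
        ring
    _ ≤ 50 ^ (j + 1 + 1) * ((2 * x) ^ (j + 1) / (L / (((j + 1 : ℕ) : ℝ) + 1)) ^ j) := by
        gcongr
    _ = _ := by
        rw [div_pow, mul_pow]
        field_simp

/-- The trade-off between the clique size `x` and the number of cliques. -/
lemma exists_clique_size {s : ℕ} (hs : 3 ≤ s) {m : ℝ} (hm : 2 ^ s ≤ m) :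
    ∃ x : ℝ, 2 ≤ x ∧ x ^ 2 ≤ m ∧ x ^ s = m * Real.log m ^ (s - 2) ∧
      Real.log m ≤ s * Real.log x ∧
      m / x = m ^ ((s - 1 : ℝ) / s) / Real.log m ^ ((s - 2 : ℝ) / s) := by
  have h8 : (8 : ℝ) ≤ m := by
    refine le_trans ?_ hm
    calc (8 : ℝ) = 2 ^ 3 := by norm_num
      _ ≤ 2 ^ s := pow_le_pow_right₀ (by norm_num) hs
  have hm0 : 0 < m := by linarith
  have hL : 1 ≤ Real.log m := by
    rw [Real.le_log_iff_exp_le hm0]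
    linarith [Real.exp_one_lt_d9]
  have hL0 : 0 < Real.log m := by linarith
  have hs0 : s ≠ 0 := by omega
  have hsR : (s : ℝ) ≠ 0 := by exact_mod_cast hs0
  set y := m * Real.log m ^ (s - 2) with hy
  have hmy : m ≤ y := le_mul_of_one_le_right hm0.le (one_le_pow₀ hL)
  have hy0 : 0 < y := by linarith
  set x := y ^ ((s : ℝ)⁻¹) with hx
  have hxs : x ^ s = y := Real.rpow_inv_natCast_pow hy0.le hs0
  have hx0 : 0 < x := Real.rpow_pos_of_pos hy0 _
  refine ⟨x, ?_, ?_, hxs, ?_, ?_⟩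
  · exact le_of_pow_le_pow_left₀ hs0 hx0.le (by rw [hxs]; exact hm.trans hmy)
  · refine le_of_pow_le_pow_left₀ hs0 hm0.le ?_
    have hLm : Real.log m ^ 2 ≤ m := by
      rw [← Real.le_sqrt hL0.le hm0.le]
      exact log_le_sqrt hm0
    calc (x ^ 2) ^ s = y ^ 2 := by rw [← hxs]; ring
      _ = m ^ 2 * (Real.log m ^ 2) ^ (s - 2) := by rw [hy]; ring
      _ ≤ m ^ 2 * m ^ (s - 2) := by gcongr
      _ = m ^ s := by rw [← pow_add]; congr 1; omega
  · rw [← Real.log_pow, hxs]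
    exact Real.log_le_log hm0 hmy
  · have hcast : ((s - 2 : ℕ) : ℝ) = (s : ℝ) - 2 := by
      rw [Nat.cast_sub (by omega)]
      norm_num
    have hx' : x = m ^ ((s : ℝ)⁻¹) * Real.log m ^ ((s - 2 : ℝ) / s) := by
      rw [hx, hy, Real.mul_rpow hm0.le (by positivity), ← Real.rpow_natCast,
        ← Real.rpow_mul hL0.le, hcast, div_eq_mul_inv ((s : ℝ) - 2)]
    have he : (s - 1 : ℝ) / s = 1 - (s : ℝ)⁻¹ := by field_simp
    rw [hx', he, Real.rpow_sub hm0, Real.rpow_one, div_div]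

end Asymptotics

theorem stmt_1 (s : ℕ) (hs : 3 ≤ s) :
    ∃ C : ℝ, 0 < C ∧ ∃ M : ℕ, ∀ m : ℕ, M ≤ m →
      ∃ (β : Type) (_ : Fintype β) (G : SimpleGraph β),
        G.edgeSet.ncard = m ∧
        (ramseyNumber (⊤ : SimpleGraph (Fin s)) G : ℝ) ≤
          C * (m : ℝ) ^ ((s - 1 : ℝ) / s) / Real.log m ^ ((s - 2 : ℝ) / s) := by
  obtain ⟨k, rfl⟩ : ∃ k, s = k + 1 := ⟨s - 1, by omega⟩
  refine ⟨11 + 50 ^ (k + 1) * 2 ^ k * (k + 1) ^ (k - 1), by positivity, 2 ^ (k + 1),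
    fun m hm => ?_⟩
  have hmR : (2 : ℝ) ^ (k + 1) ≤ m := by exact_mod_cast hm
  obtain ⟨x, hx2, hxm, hxs, hlog, hQ⟩ := exists_clique_size hs hmR
  have hx0 : 0 < x := by linarith
  have hm0 : (0 : ℝ) < m := lt_of_lt_of_le (by positivity) hmR
  have hL0 : 0 < Real.log m := Real.log_pos (by nlinarith)
  set Q : ℝ := m / x with hQdef
  have hxQ : x ≤ Q := by rw [hQdef, le_div_iff₀ hx0]; nlinarith
  set n := ⌈x⌉₊ with hn
  have hxn : x ≤ n := Nat.le_ceil x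
  have hnx : (n : ℝ) ≤ 2 * x := by linarith [Nat.ceil_lt_add_one hx0.le]
  have hn2 : 2 ≤ n := by
    have : (2 : ℝ) ≤ n := hx2.trans hxn
    exact_mod_cast this
  set t := ⌈4 * m / x ^ 2⌉₊ with ht
  have ht1 : 4 * m / x ^ 2 ≤ t := Nat.le_ceil _
  have ht2 : (t : ℝ) ≤ 4 * m / x ^ 2 + 1 := (Nat.ceil_lt_add_one (by positivity)).le
  have hedges : 2 * m ≤ t * n * (n - 1) := by
    have h1 : x / 2 ≤ (n : ℝ) - 1 := by linarith
    have h2 : (2 * m : ℝ) ≤ t * n * ((n : ℝ) - 1) :=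
      calc (2 * m : ℝ) = 4 * m / x ^ 2 * x * (x / 2) := by field_simp; norm_num
        _ ≤ t * n * ((n : ℝ) - 1) := by gcongr
    rw [← Nat.cast_pred (by omega : 0 < n)] at h2
    exact_mod_cast h2
  obtain ⟨β, hβ, H, hHm, hH⟩ := exists_ncard_edgeSet_eq_ramseyNumber_le (k := k) hn2 hedges
  refine ⟨β, hβ, H, hHm, hH.trans ?_⟩
  have htn : (t * n : ℝ) ≤ 10 * Q :=
    calc (t * n : ℝ) ≤ (4 * m / x ^ 2 + 1) * (2 * x) := by gcongr
      _ = 8 * Q + 2 * x := by rw [hQdef]; field_simp; ring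
      _ ≤ 10 * Q := by linarith
  have hB := cliqueRamseyBound_le (k := k) (by omega) hx2 hL0 hxn hnx (by exact_mod_cast hlog)
  have hxk : x ^ k / Real.log m ^ (k - 1) = Q := by
    rw [hQdef, div_eq_div_iff (by positivity) hx0.ne', ← pow_succ, hxs]
    rfl
  rw [hxk] at hB
  rw [mul_div_assoc, ← hQ, add_mul]
  linarith
end

section
/- For every integer s ≥ 3 there exists a constant c > 0 (depending only on s) such that for every graph G with m ≥ 2 edges and without isolated vertices, the Ramsey number satisfies r(K_s, G) ≤ c · m^{(s-1)/2} / (log m)^{(s-3)/2}. -/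
open SimpleGraph

section
open Finset

theorem log_mul_le_add_mul_two_pow {Δ : ℝ} (hΔ : 0 < Δ) (x : ℕ) :
    Real.log Δ / 8 * (2 ^ x + 1) ≤ Δ + x * 2 ^ x / 2 := by
  have hz : (1 : ℝ) ≤ 2 ^ x := one_le_pow₀ (by norm_num)
  have hx : (0 : ℝ) ≤ x := Nat.cast_nonneg x
  set z : ℝ := 2 ^ x with hzdef
  rcases le_or_gt (z ^ 2) Δ with h | h
  · have h1 : z ≤ √Δ := Real.le_sqrt_of_sq_le h
    have h2 : Real.log Δ ≤ 2 * √Δ := by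
      have := Real.log_le_sub_one_of_pos (Real.sqrt_pos.2 hΔ)
      rw [Real.log_sqrt hΔ.le] at this
      linarith
    have h3 : √Δ * √Δ = Δ := Real.mul_self_sqrt hΔ.le
    have h4 : Real.log Δ * (z + 1) ≤ 2 * √Δ * (2 * √Δ) :=
      mul_le_mul h2 (by linarith) (by linarith) (by positivity)
    have : 0 ≤ x * z := by positivity
    nlinarith
  · have h1 : Real.log Δ ≤ 2 * x := by
      have h2 : Real.log Δ ≤ Real.log (z ^ 2) := Real.log_le_log hΔ h.le
      rw [hzdef, ← pow_mul, Real.log_pow] at h2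
      have h3 : Real.log 2 ≤ 1 := by linarith [Real.log_two_lt_d9]
      push_cast at h2
      nlinarith
    have h2 : Real.log Δ * (z + 1) ≤ 2 * x * (2 * z) :=
      mul_le_mul h1 (by linarith) (by linarith) (by positivity)
    nlinarith

theorem two_mul_sum_card_powerset {α : Type*} [DecidableEq α] (s : Finset α) :
    2 * ∑ t ∈ s.powerset, #t = #s * 2 ^ #s := by
  induction s using Finset.induction_on with
  | empty => simp
  | insert a s ha ih =>
    rw [sum_powerset_insert ha, card_insert_of_notMem ha]
    have : ∀ t ∈ s.powerset, #(insert a t) = #t + 1 := fun t ht =>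
      card_insert_of_notMem fun h => ha (mem_powerset.1 ht h)
    rw [sum_congr rfl this, sum_add_distrib]
    simp only [sum_const, card_powerset, smul_eq_mul, mul_one]
    rw [pow_succ]
    linarith

theorem isIndepSet_map_val {V : Type*} (Γ : SimpleGraph V) {S : Finset V} {T : Finset S}
    (hT : (Γ.comap (Subtype.val : S → V)).IsIndepSet ↑T) :
    Γ.IsIndepSet ↑(T.map ⟨Subtype.val, Subtype.val_injective⟩) := by
  intro a ha b hb hab
  simp only [coe_map, Function.Embedding.coeFn_mk, Set.mem_image, mem_coe] at ha hb
  obtain ⟨a, ha, rfl⟩ := ha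
  obtain ⟨b, hb, rfl⟩ := hb
  exact hT ha hb fun h => hab (congrArg _ h)

theorem cliqueFree_comap_val {V : Type*} (Γ : SimpleGraph V) {s : ℕ} {S : Finset V}
    (h : ∀ T ⊆ S, ¬ Γ.IsNClique s T) : (Γ.comap (Subtype.val : S → V)).CliqueFree s := by
  intro T hT
  refine h (T.map ⟨Subtype.val, Subtype.val_injective⟩) ?_ ⟨?_, by rw [card_map, hT.card_eq]⟩
  · intro a ha
    obtain ⟨a, -, rfl⟩ := mem_map.1 ha
    exact a.2
  · intro a ha b hb hab
    simp only [coe_map, Function.Embedding.coeFn_mk, Set.mem_image, mem_coe] at ha hb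
    obtain ⟨a, ha, rfl⟩ := ha
    obtain ⟨b, hb, rfl⟩ := hb
    exact hT.isClique ha hb fun h => hab (congrArg _ h)

section
variable {V : Type*} [Fintype V] [DecidableEq V] (Γ : SimpleGraph V) [DecidableRel Γ.Adj]

open Classical in
theorem log_mul_card_indepSets_le (h3 : Γ.CliqueFree 3) (v : V) {Δ : ℝ} (hΔ : 0 < Δ) :
    Real.log Δ / 8 * #{W : Finset V | Γ.IsIndepSet ↑W} ≤
      ∑ W ∈ ({W | Γ.IsIndepSet ↑W} : Finset (Finset V)),
        ((if v ∈ W then Δ else 0) + #(Γ.neighborFinset v ∩ W)) := by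
  have hN : Γ.IsIndepSet ↑(Γ.neighborFinset v) := by
    simpa using isIndepSet_neighborSet_of_triangleFree Γ h3 v
  set I : Finset (Finset V) := {W : Finset V | Γ.IsIndepSet ↑W} with hI
  set N := Γ.neighborFinset v with hNdef
  have hvN : v ∉ N := by simp [hNdef]
  have hmem : ∀ W, W ∈ I ↔ ∀ a ∈ W, ∀ b ∈ W, ¬ Γ.Adj a b := by
    intro W
    simp only [hI, mem_filter, mem_univ, true_and, IsIndepSet, Set.Pairwise, mem_coe]
    exact ⟨fun h a ha b hb hab => h ha hb hab.ne hab, fun h a ha b hb _ => h a ha b hb⟩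
  have hNN : ∀ a ∈ N, ∀ b ∈ N, ¬ Γ.Adj a b := (hmem N).1 (by simpa [hI] using hN)
  set g : Finset V → Finset V := fun W => W \ insert v N with hg
  have key : ∀ H ∈ I.image g, Real.log Δ / 8 * #{W ∈ I | g W = H} ≤
      ∑ W ∈ I with g W = H, ((if v ∈ W then Δ else 0) + #(N ∩ W) : ℝ) := by
    intro H hH
    obtain ⟨W₀, hW₀, rfl⟩ := mem_image.1 hH
    set H := g W₀ with hHdef
    have hHI : ∀ a ∈ H, ∀ b ∈ H, ¬ Γ.Adj a b := fun a ha b hb =>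
      (hmem W₀).1 hW₀ a (mem_sdiff.1 ha).1 b (mem_sdiff.1 hb).1
    have hHN : ∀ a ∈ H, a ≠ v ∧ a ∉ N := fun a ha => by
      have := (mem_sdiff.1 ha).2
      simpa [not_or] using this
    have hadjv : ∀ a, Γ.Adj v a ↔ a ∈ N := fun a => by simp [hNdef]
    set X : Finset V := {u ∈ N | ∀ w ∈ H, ¬ Γ.Adj u w} with hX
    have hXN : X ⊆ N := filter_subset _ _
    have hfib : {W ∈ I | g W = H} = insert (insert v H) (X.powerset.image (H ∪ ·)) := by
      ext W
      simp only [mem_filter, mem_insert, mem_image, mem_powerset, hmem]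
      constructor
      · rintro ⟨hW, hWH⟩
        have hHW : H ⊆ W := by rw [← hWH]; exact sdiff_subset
        by_cases hv : v ∈ W
        · left
          ext a
          constructor
          · intro ha
            by_cases hav : a = v
            · simp [hav]
            · refine mem_insert_of_mem ?_
              rw [← hWH]
              simp only [hg, mem_sdiff, mem_insert, not_or]
              exact ⟨ha, hav, fun h => hW v hv a ha ((hadjv a).2 h)⟩
          · intro ha
            rcases mem_insert.1 ha with rfl | ha
            · exact hv
            · exact hHW ha
        · right
          refine ⟨W ∩ N, ?_, ?_⟩
          · intro a ha
            rw [mem_inter] at ha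
            exact mem_filter.2 ⟨ha.2, fun w hw => hW a ha.1 w (hHW hw)⟩
          · ext a
            rw [← hWH]
            simp only [hg, mem_union, mem_sdiff, mem_insert, mem_inter]
            by_cases hav : a = v
            · subst hav; simp [hv]
            · tauto
      · rintro (rfl | ⟨B, hB, rfl⟩)
        · constructor
          · intro a ha b hb hab
            rcases mem_insert.1 ha with rfl | ha <;> rcases mem_insert.1 hb with rfl | hb
            · exact hab.ne rfl
            · exact (hHN b hb).2 ((hadjv b).1 hab)
            · exact (hHN a ha).2 ((hadjv a).1 hab.symm)
            · exact hHI a ha b hb hab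
          · ext a
            simp only [hg, mem_sdiff, mem_insert]
            have := hHN a
            tauto
        · constructor
          · intro a ha b hb hab
            rcases mem_union.1 ha with ha | ha <;> rcases mem_union.1 hb with hb | hb
            · exact hHI a ha b hb hab
            · exact (mem_filter.1 (hB hb)).2 a ha hab.symm
            · exact (mem_filter.1 (hB ha)).2 b hb hab
            · exact hNN a (hXN (hB ha)) b (hXN (hB hb)) hab
          · ext a
            simp only [hg, mem_sdiff, mem_insert, mem_union]
            have h1 := hHN a
            have h2 : a ∈ B → a ∈ N := fun h => hXN (hB h)
            tauto
    have hinj : Set.InjOn (H ∪ ·) (X.powerset : Set (Finset V)) := by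
      have hr : ∀ B, B ⊆ X → (H ∪ B) ∩ N = B := by
        intro B hB
        ext a
        have h1 := hHN a
        have h2 : a ∈ B → a ∈ N := fun h => hXN (hB h)
        simp only [mem_inter, mem_union]
        tauto
      intro B hB C hC hBC
      rw [← hr B (by simpa using hB), ← hr C (by simpa using hC)]
      exact congrArg (· ∩ N) hBC
    have hnot : insert v H ∉ X.powerset.image (H ∪ ·) := by
      simp only [mem_image, mem_powerset, not_exists, not_and]
      intro B hB heq
      have : v ∈ H ∪ B := heq ▸ mem_insert_self v H
      rcases mem_union.1 this with h | h
      · exact (hHN v h).1 rfl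
      · exact hvN (hXN (hB h))
    rw [hfib, card_insert_of_notMem hnot, sum_insert hnot, card_image_of_injOn hinj,
      sum_image hinj, card_powerset]
    have hcard : ∑ B ∈ X.powerset, (#B : ℝ) ≤
        ∑ B ∈ X.powerset, ((if v ∈ H ∪ B then Δ else 0) + #(N ∩ (H ∪ B)) : ℝ) := by
      refine sum_le_sum fun B hB => ?_
      have h1 : #B ≤ #(N ∩ (H ∪ B)) := card_le_card fun a ha =>
        mem_inter.2 ⟨hXN (mem_powerset.1 hB ha), mem_union_right _ ha⟩
      have h2 : (0 : ℝ) ≤ if v ∈ H ∪ B then Δ else 0 := by split_ifs <;> positivity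
      have h3 : (#B : ℝ) ≤ #(N ∩ (H ∪ B)) := by exact_mod_cast h1
      linarith
    have hp : 2 * ∑ B ∈ X.powerset, (#B : ℝ) = #X * 2 ^ #X := by
      exact_mod_cast two_mul_sum_card_powerset X
    have hn := log_mul_le_add_mul_two_pow hΔ #X
    have h0 : (0 : ℝ) ≤ #(N ∩ insert v H) := Nat.cast_nonneg _
    rw [if_pos (mem_insert_self v H)]
    push_cast
    linarith
  have hmaps : ∀ W ∈ I, g W ∈ I.image g := fun W hW => mem_image_of_mem g hW
  rw [← sum_fiberwise_of_maps_to hmaps, card_eq_sum_card_fiberwise hmaps, Nat.cast_sum, mul_sum]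
  exact sum_le_sum key

theorem exists_isIndepSet_of_triangleFree (h3 : Γ.CliqueFree 3) {Δ : ℝ} (hΔ : 0 < Δ)
    (hdeg : ∀ v, (Γ.degree v : ℝ) ≤ Δ) :
    ∃ S : Finset V, Γ.IsIndepSet ↑S ∧ Fintype.card V * Real.log Δ ≤ 16 * Δ * #S := by
  classical
  set I : Finset (Finset V) := {W : Finset V | Γ.IsIndepSet ↑W} with hI
  have hne : I.Nonempty := ⟨∅, by simp [hI, IsIndepSet]⟩
  have hsum : ∑ W ∈ I, (Fintype.card V * (Real.log Δ / 8)) ≤ ∑ W ∈ I, 2 * Δ * (#W : ℝ) := by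
    calc ∑ W ∈ I, (Fintype.card V * (Real.log Δ / 8))
        = ∑ v : V, Real.log Δ / 8 * #I := by simp; ring
      _ ≤ ∑ v : V, ∑ W ∈ I, ((if v ∈ W then Δ else 0) + #(Γ.neighborFinset v ∩ W) : ℝ) :=
          sum_le_sum fun v _ => log_mul_card_indepSets_le Γ h3 v hΔ
      _ = ∑ W ∈ I, ∑ v : V, ((if v ∈ W then Δ else 0) + #(Γ.neighborFinset v ∩ W) : ℝ) :=
          sum_comm
      _ ≤ ∑ W ∈ I, 2 * Δ * (#W : ℝ) := by
          refine sum_le_sum fun W _ => ?_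
          have h1 : ∑ v : V, (if v ∈ W then Δ else 0) = Δ * #W := by
            rw [← sum_filter]; simp [mul_comm]
          have h2 : ∑ v : V, (#(Γ.neighborFinset v ∩ W) : ℝ) = ∑ w ∈ W, (Γ.degree w : ℝ) := by
            have h4 : ∀ v, #(Γ.neighborFinset v ∩ W) = ∑ w ∈ W, if Γ.Adj v w then 1 else 0 := by
              intro v
              rw [card_eq_sum_ones, ← sum_filter]
              refine sum_congr ?_ fun _ _ => rfl
              ext a; simp [and_comm]
            have h5 : ∀ w, Γ.degree w = ∑ v : V, if Γ.Adj v w then 1 else 0 := by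
              intro w
              rw [← card_neighborFinset_eq_degree, card_eq_sum_ones, ← sum_filter]
              refine sum_congr ?_ fun _ _ => rfl
              ext a; simp [adj_comm]
            simp_rw [h4, h5]
            push_cast
            exact sum_comm
          have h3 : ∑ w ∈ W, (Γ.degree w : ℝ) ≤ ∑ w ∈ W, Δ := sum_le_sum fun w _ => hdeg w
          rw [sum_const, nsmul_eq_mul] at h3
          rw [sum_add_distrib, h1, h2]
          linarith
  obtain ⟨W, hW, hle⟩ := exists_le_of_sum_le hne hsum
  exact ⟨W, by simpa [hI] using hW, by linarith⟩

theorem sum_pow_mul_pow_of_subset (A : Finset V) (p : ℝ) :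
    ∑ S : Finset V, p ^ #S * (1 - p) ^ (Fintype.card V - #S) * (if A ⊆ S then 1 else 0) =
      p ^ #A := by
  have h := sum_pow_mul_eq_add_pow p (1 - p) Aᶜ
  rw [add_sub_cancel, one_pow] at h
  have hinj : Set.InjOn (A ∪ ·) (Aᶜ.powerset : Set (Finset V)) := by
    have hr : ∀ B ∈ (Aᶜ.powerset : Set (Finset V)), (A ∪ B) \ A = B := by
      intro B hB
      rw [union_sdiff_left, Finset.sdiff_eq_self_iff_disjoint]
      exact (subset_compl_iff_disjoint_left.1 (mem_powerset.1 hB)).symm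
    intro B hB C hC hBC
    rw [← hr B hB, ← hr C hC]
    exact congrArg (· \ A) hBC
  have himg : ({S : Finset V | A ⊆ S} : Finset (Finset V)) = Aᶜ.powerset.image (A ∪ ·) := by
    ext S
    simp only [mem_filter, mem_univ, true_and, mem_image, mem_powerset]
    constructor
    · intro hS
      exact ⟨S \ A, fun a ha => mem_compl.2 (mem_sdiff.1 ha).2, union_sdiff_of_subset hS⟩
    · rintro ⟨B, -, rfl⟩
      exact subset_union_left
  simp_rw [mul_ite, mul_one, mul_zero]
  rw [← sum_filter, himg, sum_image hinj]
  trans p ^ #A * ∑ B ∈ Aᶜ.powerset, p ^ #B * (1 - p) ^ (#Aᶜ - #B)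
  · rw [mul_sum]
    refine sum_congr rfl fun B hB => ?_
    have hd : Disjoint A B := by
      rw [mem_powerset] at hB
      exact subset_compl_iff_disjoint_left.1 hB
    rw [card_union_of_disjoint hd, card_compl, pow_add, Nat.sub_sub, mul_assoc]
  · rw [h, mul_one]

theorem exists_sparse_subset {D t p : ℝ} (hD : 0 < D) (ht : 0 ≤ t) (hp : 0 < p) (hp1 : p ≤ 1)
    (hpt : D * t * p ^ 2 ≤ 1 / 4) (hdeg : ∀ v, (Γ.degree v : ℝ) ≤ D)
    (hcodeg : ∀ u v, Γ.Adj u v → (#(Γ.neighborFinset u ∩ Γ.neighborFinset v) : ℝ) ≤ t) :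
    ∃ S : Finset V, p * Fintype.card V / 2 ≤ #S ∧
      (∀ v ∈ S, (#(Γ.neighborFinset v ∩ S) : ℝ) ≤ 4 * p * D) ∧
      ∀ a ∈ S, ∀ b ∈ S, ∀ c ∈ S, Γ.Adj a b → Γ.Adj a c → ¬ Γ.Adj b c := by
  classical
  set w : Finset V → ℝ := fun S => p ^ #S * (1 - p) ^ (Fintype.card V - #S) with hw
  have hw0 : ∀ S, 0 ≤ w S := fun S =>
    mul_nonneg (pow_nonneg hp.le _) (pow_nonneg (by linarith) _)
  have hwA : ∀ A : Finset V, ∑ S, w S * (if A ⊆ S then 1 else 0) = p ^ #A :=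
    fun A => sum_pow_mul_pow_of_subset A p
  have hw1 : ∑ S, w S = 1 := by simpa using hwA ∅
  set good : Finset V → Finset V := fun S => {v ∈ S | (#(Γ.neighborFinset v ∩ S) : ℝ) ≤ 4 * p * D ∧
    ∀ b ∈ S, ∀ c ∈ S, Γ.Adj v b → Γ.Adj v c → ¬ Γ.Adj b c} with hgood
  have hsub : ∀ S, good S ⊆ S := fun S => filter_subset _ _
  have hpD : 0 < 4 * p * D := by positivity
  have hvertex : ∀ v, p / 2 ≤ ∑ S, w S * (if v ∈ good S then 1 else 0) := by
    intro v
    have hpt' : ∀ S, (if {v} ⊆ S then 1 else 0 : ℝ)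
        - (∑ u ∈ Γ.neighborFinset v, (if {v, u} ⊆ S then 1 else 0 : ℝ)) / (4 * p * D)
        - ∑ u ∈ Γ.neighborFinset v, ∑ x ∈ Γ.neighborFinset v ∩ Γ.neighborFinset u,
            (if {v, u, x} ⊆ S then 1 else 0 : ℝ) ≤ if v ∈ good S then 1 else 0 := by
      intro S
      have h1 : (0 : ℝ) ≤ (∑ u ∈ Γ.neighborFinset v, (if {v, u} ⊆ S then 1 else 0 : ℝ)) /
          (4 * p * D) := div_nonneg (sum_nonneg fun _ _ => by split_ifs <;> norm_num) hpD.le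
      have h2 : ∀ u ∈ Γ.neighborFinset v, (0 : ℝ) ≤
          ∑ x ∈ Γ.neighborFinset v ∩ Γ.neighborFinset u, (if {v, u, x} ⊆ S then 1 else 0 : ℝ) :=
        fun _ _ => sum_nonneg fun _ _ => by split_ifs <;> norm_num
      have h3 := sum_nonneg h2
      by_cases hv : v ∈ S
      · rw [if_pos (singleton_subset_iff.2 hv)]
        split_ifs with hg
        · linarith
        · have hor : 4 * p * D < #(Γ.neighborFinset v ∩ S) ∨
              ∃ b ∈ S, ∃ c ∈ S, Γ.Adj v b ∧ Γ.Adj v c ∧ Γ.Adj b c := by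
            by_contra! hcon
            exact hg (mem_filter.2 ⟨hv, hcon.1, hcon.2⟩)
          rcases hor with h | ⟨b, hb, c, hc, hvb, hvc, hbc⟩
          · have h4 : ∑ u ∈ Γ.neighborFinset v, (if {v, u} ⊆ S then 1 else 0 : ℝ) =
                #(Γ.neighborFinset v ∩ S) := by
              rw [← sum_filter]
              simp only [sum_const, nsmul_eq_mul, mul_one, Nat.cast_inj]
              congr 1
              ext u
              simp [insert_subset_iff, hv]
            have h5 : 1 ≤ (∑ u ∈ Γ.neighborFinset v, (if {v, u} ⊆ S then 1 else 0 : ℝ)) /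
                (4 * p * D) := by
              rw [h4, le_div_iff₀ hpD]; linarith
            linarith
          · have hb' : b ∈ Γ.neighborFinset v := by simpa using hvb
            have h4 := single_le_sum h2 hb'
            have hc' : c ∈ Γ.neighborFinset v ∩ Γ.neighborFinset b := by simp [hvc, hbc]
            have h5 := single_le_sum (f := fun x => (if {v, b, x} ⊆ S then 1 else 0 : ℝ))
              (fun _ _ => by split_ifs <;> norm_num) hc'
            have h6 : ({v, b, c} : Finset V) ⊆ S := by simp [insert_subset_iff, hv, hb, hc]
            simp only [if_pos h6] at h5
            linarith
      · have hg : v ∉ good S := fun h => hv (hsub S h)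
        rw [if_neg (by simpa using hv), if_neg hg]
        linarith
    have hle := sum_le_sum fun S (_ : S ∈ (univ : Finset (Finset V))) =>
      mul_le_mul_of_nonneg_left (hpt' S) (hw0 S)
    refine le_trans ?_ hle
    have h1 : ∑ S, w S * ((∑ u ∈ Γ.neighborFinset v, (if {v, u} ⊆ S then 1 else 0 : ℝ)) /
        (4 * p * D)) = Γ.degree v * p ^ 2 / (4 * p * D) := by
      simp_rw [← mul_div_assoc, ← sum_div, mul_sum]
      rw [sum_comm]
      simp_rw [hwA]
      rw [← card_neighborFinset_eq_degree, ← nsmul_eq_mul, ← sum_const]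
      congr 1
      refine sum_congr rfl fun u hu => ?_
      rw [card_pair]
      rintro rfl
      simp at hu
    have h2 : ∑ S, w S * (∑ u ∈ Γ.neighborFinset v, ∑ x ∈ Γ.neighborFinset v ∩ Γ.neighborFinset u,
        (if {v, u, x} ⊆ S then 1 else 0 : ℝ)) ≤ D * t * p ^ 3 := by
      calc _ = ∑ u ∈ Γ.neighborFinset v, ∑ x ∈ Γ.neighborFinset v ∩ Γ.neighborFinset u,
            p ^ #{v, u, x} := by
            simp_rw [mul_sum]
            rw [sum_comm]
            refine sum_congr rfl fun u _ => ?_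
            rw [sum_comm]
            simp_rw [hwA]
        _ ≤ ∑ u ∈ Γ.neighborFinset v, t * p ^ 3 := by
            refine sum_le_sum fun u hu => ?_
            have hvu : Γ.Adj v u := by simpa using hu
            calc _ = ∑ x ∈ Γ.neighborFinset v ∩ Γ.neighborFinset u, p ^ 3 := by
                  refine sum_congr rfl fun x hx => ?_
                  simp only [mem_inter, mem_neighborFinset] at hx
                  rw [card_eq_three.2 ⟨v, u, x, hvu.ne, hx.1.ne, hx.2.ne, rfl⟩]
              _ ≤ t * p ^ 3 := by
                  rw [sum_const, nsmul_eq_mul]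
                  exact mul_le_mul_of_nonneg_right (hcodeg v u hvu) (by positivity)
        _ ≤ D * t * p ^ 3 := by
            rw [sum_const, nsmul_eq_mul, card_neighborFinset_eq_degree, mul_assoc]
            exact mul_le_mul_of_nonneg_right (hdeg v) (by positivity)
    simp_rw [mul_sub]
    rw [sum_sub_distrib, sum_sub_distrib, hwA, h1]
    have h3 : Γ.degree v * p ^ 2 / (4 * p * D) ≤ p / 4 := by
      rw [div_le_iff₀ hpD]
      have := mul_le_mul_of_nonneg_right (hdeg v) (sq_nonneg p)
      linarith
    have h4 : D * t * p ^ 3 ≤ p / 4 := by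
      have := mul_le_mul_of_nonneg_right hpt hp.le
      linarith
    rw [card_singleton, pow_one]
    linarith
  have htot : ∑ S, w S * (p * Fintype.card V / 2) ≤ ∑ S, w S * (#(good S) : ℝ) := by
    calc _ = ∑ v : V, p / 2 := by
          rw [← sum_mul, hw1]; simp; ring
      _ ≤ ∑ v : V, ∑ S, w S * (if v ∈ good S then 1 else 0) := sum_le_sum fun v _ => hvertex v
      _ = _ := by
          rw [sum_comm]
          refine sum_congr rfl fun S _ => ?_
          rw [← mul_sum]; simp
  obtain ⟨S, hS⟩ : ∃ S, p * Fintype.card V / 2 ≤ #(good S) := by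
    by_contra! hcon
    have hle : ∀ S, w S * (#(good S) : ℝ) ≤ w S * (p * Fintype.card V / 2) := fun S =>
      mul_le_mul_of_nonneg_left (hcon S).le (hw0 S)
    have heq := (sum_eq_sum_iff_of_le fun S (_ : S ∈ univ) => hle S).1
      (le_antisymm (sum_le_sum fun S _ => hle S) htot)
    have hz : ∀ S, w S = 0 := fun S => by
      by_contra h
      exact (hcon S).ne (mul_left_cancel₀ h (heq S (mem_univ S)))
    simp [hz] at hw1
  refine ⟨good S, hS, fun v hv => ?_, fun a ha b hb c hc => ?_⟩
  · refine le_trans ?_ (mem_filter.1 hv).2.1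
    exact_mod_cast card_le_card (inter_subset_inter_left (hsub S))
  · exact (mem_filter.1 ha).2.2 b (hsub S hb) c (hsub S hc)

theorem degree_comap_val (S : Finset V) (v : S) :
    (Γ.comap (Subtype.val : S → V)).degree v = #(Γ.neighborFinset v ∩ S) := by
  rw [← card_neighborFinset_eq_degree, ← card_map ⟨Subtype.val, Subtype.val_injective⟩]
  congr 1
  ext a
  simp

theorem exists_isIndepSet_of_codegree_le {D t : ℝ} (ht : 0 < t) (hD : 0 < D) (hDt : 1 ≤ 4 * (D * t))
    (hdeg : ∀ v, (Γ.degree v : ℝ) ≤ D)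
    (hcodeg : ∀ u v, Γ.Adj u v → (#(Γ.neighborFinset u ∩ Γ.neighborFinset v) : ℝ) ≤ t) :
    ∃ S : Finset V, Γ.IsIndepSet ↑S ∧ Fintype.card V * Real.log (D / t) ≤ 256 * D * #S := by
  set r := √(D * t) with hr
  have hr2 : r ^ 2 = D * t := Real.sq_sqrt (by positivity)
  have hr0 : 0 < r := Real.sqrt_pos.2 (by positivity)
  have hr1 : 1 ≤ 2 * r := by nlinarith
  set p := 1 / (2 * r) with hpdef
  have hp : 0 < p := by positivity
  have hpr : p * r = 1 / 2 := by rw [hpdef]; field_simp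
  have hp2 : D * t * p ^ 2 ≤ 1 / 4 := by
    rw [← hr2, ← mul_pow, mul_comm, hpr]; norm_num
  obtain ⟨S, hS, hSdeg, hStri⟩ := exists_sparse_subset Γ hD ht.le hp
    (by rw [hpdef, div_le_one (by positivity)]; exact hr1) hp2 hdeg hcodeg
  have hfree : (Γ.comap (Subtype.val : S → V)).CliqueFree 3 := by
    intro T hT
    obtain ⟨a, b, c, hab, hac, hbc, rfl⟩ := is3Clique_iff.1 hT
    exact hStri a a.2 b b.2 c c.2 hab hac hbc
  obtain ⟨T, hT, hle⟩ := exists_isIndepSet_of_triangleFree _ hfree (Δ := 4 * p * D)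
    (by positivity) fun v => by rw [degree_comap_val]; exact hSdeg v v.2
  refine ⟨T.map ⟨Subtype.val, Subtype.val_injective⟩, isIndepSet_map_val Γ hT, ?_⟩
  rw [card_map]
  rw [Fintype.card_coe] at hle
  have hlog : Real.log (D / t) ≤ 2 * Real.log (4 * p * D) := by
    have h1 : D / t ≤ (4 * p * D) ^ 2 := by
      rw [div_le_iff₀ ht]
      have : (4 * p * D) ^ 2 * t = 16 * (p * r) ^ 2 * D := by
        rw [mul_pow p r, hr2]; ring
      rw [this, hpr]; linarith
    have h2 := Real.log_le_log (by positivity) h1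
    rw [Real.log_pow] at h2
    exact_mod_cast h2
  rcases le_or_gt (Real.log (4 * p * D)) 0 with h0 | h0
  · have h1 : Fintype.card V * Real.log (D / t) ≤ 0 :=
      mul_nonpos_of_nonneg_of_nonpos (Nat.cast_nonneg _) (by linarith)
    have h2 : 0 ≤ 256 * D * #T := by positivity
    linarith
  · have h1 : p * (Fintype.card V * Real.log (D / t)) ≤ p * (256 * D * #T) := by
      calc p * (Fintype.card V * Real.log (D / t))
          ≤ p * (Fintype.card V * (2 * Real.log (4 * p * D))) := by gcongr
        _ = 4 * (p * Fintype.card V / 2 * Real.log (4 * p * D)) := by ring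
        _ ≤ 4 * (#S * Real.log (4 * p * D)) := by gcongr
        _ ≤ 4 * (16 * (4 * p * D) * #T) := by gcongr
        _ = p * (256 * D * #T) := by ring
    exact le_of_mul_le_mul_left h1 hp

end

theorem card_le_of_isIndepSet_card_lt (s : ℕ) : ∃ C : ℝ, 1 ≤ C ∧
    ∀ (V : Type) [Fintype V] (Γ : SimpleGraph V) (k : ℕ), 3 ≤ k → Γ.CliqueFree (s + 1) →
      (∀ S : Finset V, Γ.IsIndepSet ↑S → #S < k) →
      (Fintype.card V : ℝ) ≤ C * (k / Real.log k) ^ s * Real.log k := by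
  have hlog : ∀ k : ℕ, 3 ≤ k → 1 ≤ Real.log k := fun k hk => by
    rw [Real.le_log_iff_exp_le (by positivity)]
    have h3 : (3 : ℝ) ≤ k := by exact_mod_cast hk
    linarith [Real.exp_one_lt_d9]
  induction s using Nat.twoStepInduction with
  | zero =>
    refine ⟨1, le_rfl, fun V _ Γ k hk h _ => ?_⟩
    have : IsEmpty V := by simpa using h
    rw [Fintype.card_eq_zero, pow_zero]
    push_cast
    linarith [hlog k hk]
  | one =>
    refine ⟨1, le_rfl, fun V _ Γ k hk h hS => ?_⟩
    have hb : Γ = ⊥ := by simpa using h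
    have h1 := hS univ fun a _ b _ _ => by simp [hb]
    have h0 : Real.log k ≠ 0 := by linarith [hlog k hk]
    rw [pow_one, one_mul, div_mul_cancel₀ _ h0]
    exact_mod_cast h1.le
  | more s ih₀ ih₁ =>
    obtain ⟨C₀, hC₀, ih₀⟩ := ih₀
    obtain ⟨C₁, hC₁, ih₁⟩ := ih₁
    set C := max C₀ C₁ with hC
    have hC1 : 1 ≤ C := le_max_of_le_left hC₀
    refine ⟨512 * C, by linarith, fun V _ Γ k hk h hS => ?_⟩
    classical
    have hL := hlog k hk
    set L := Real.log k with hLdef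
    have hk0 : (0 : ℝ) < k := by positivity
    set x := k / L with hx
    have hxL : x * L = k := div_mul_cancel₀ _ (by linarith)
    have hx0 : 0 < x := by positivity
    have hlogx : L / 2 ≤ Real.log x := by
      have h4 : 0 < √(√(k : ℝ)) := by positivity
      have h1 := Real.log_le_sub_one_of_pos h4
      rw [Real.log_sqrt (by positivity), Real.log_sqrt (by positivity)] at h1
      have h2 : √(√(k : ℝ)) ^ 2 = √(k : ℝ) := Real.sq_sqrt (by positivity)
      have h3 : √(k : ℝ) ^ 2 = k := Real.sq_sqrt (by positivity)
      have h5 : L ≤ √(k : ℝ) := by nlinarith [sq_nonneg (√(√(k : ℝ)) - 2)]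
      have h6 : √(k : ℝ) ≤ x := by
        rw [hx, le_div_iff₀ (by linarith)]
        nlinarith [Real.sqrt_nonneg (k : ℝ)]
      have h7 := Real.log_le_log (by positivity) h6
      rwa [Real.log_sqrt (by positivity)] at h7
    have hx1 : 1 ≤ x := by
      by_contra! hlt
      linarith [Real.log_nonpos hx0.le hlt.le]
    have hsub : ∀ (S : Finset V) (T : Finset S),
        (Γ.comap (Subtype.val : S → V)).IsIndepSet ↑T → #T < k := fun S T hT => by
      have := hS _ (isIndepSet_map_val Γ hT)
      rwa [card_map] at this
    obtain ⟨S, hSi, hle⟩ := exists_isIndepSet_of_codegree_le Γ (D := C * x ^ (s + 1) * L)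
      (t := C * x ^ s * L) (by positivity) (by positivity) (by
        have h1 : 1 ≤ C * x ^ (s + 1) * L :=
          one_le_mul_of_one_le_of_one_le (one_le_mul_of_one_le_of_one_le hC1 (one_le_pow₀ hx1)) hL
        have h2 : 1 ≤ C * x ^ s * L :=
          one_le_mul_of_one_le_of_one_le (one_le_mul_of_one_le_of_one_le hC1 (one_le_pow₀ hx1)) hL
        nlinarith) (fun v => by
        have h1 := ih₁ _ (Γ.comap (Subtype.val : Γ.neighborFinset v → V)) k hk
          (cliqueFree_comap_val Γ fun T hT hc => h _ (hc.insert (a := v) fun b hb => by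
            simpa using hT hb)) (hsub _)
        rw [Fintype.card_coe, card_neighborFinset_eq_degree] at h1
        refine h1.trans ?_
        gcongr
        exact le_max_right _ _) (fun u v huv => by
        have h1 := ih₀ _ (Γ.comap
          (Subtype.val : (Γ.neighborFinset u ∩ Γ.neighborFinset v : Finset V) → V)) k hk
          (cliqueFree_comap_val Γ fun T hT hc => h _ ((hc.insert (a := v) fun b hb => by
              have := hT hb
              simp_all).insert (a := u) fun b hb => by
                rcases mem_insert.1 hb with rfl | hb
                · exact huv
                · have := hT hb
                  simp_all)) (hsub _)
        rw [Fintype.card_coe] at h1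
        refine h1.trans ?_
        gcongr
        exact le_max_left _ _)
    have hDt : C * x ^ (s + 1) * L / (C * x ^ s * L) = x := by
      rw [div_eq_iff (by positivity)]; ring
    rw [hDt] at hle
    have hSk : (#S : ℝ) ≤ k := by exact_mod_cast (hS S hSi).le
    have h1 : (Fintype.card V : ℝ) * (L / 2) ≤ 256 * (C * x ^ (s + 1) * L) * k :=
      calc (Fintype.card V : ℝ) * (L / 2) ≤ Fintype.card V * Real.log x := by gcongr
        _ ≤ _ := hle
        _ ≤ _ := by gcongr
    rw [← hxL] at h1
    have h2 : (Fintype.card V : ℝ) * (L / 2) ≤ (512 * C * x ^ (s + 2) * L) * (L / 2) := by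
      refine h1.trans (le_of_eq ?_)
      ring
    exact le_of_mul_le_mul_right h2 (by linarith)

theorem containsCopy_compl_of_isIndepSet {V β : Type*} [Fintype V] [Fintype β]
    (Γ : SimpleGraph V) [DecidableRel Γ.Adj] (G : SimpleGraph β) [DecidableRel G.Adj]
    {S : Finset V} (hS : Γ.IsIndepSet ↑S) {Δ d : ℝ} (hΔ : 0 ≤ Δ) (hd : 0 ≤ d)
    (hdeg : ∀ v, (Γ.degree v : ℝ) ≤ Δ) (hGS : 2 * #G.edgeFinset ≤ #S * d)
    (hcard : d * Δ + Fintype.card β < Fintype.card V) : Γᶜ.ContainsCopy G := by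
  classical
  set T : Finset β := {v | d < G.degree v} with hT
  have hTS : #T ≤ #S := by
    rcases T.eq_empty_or_nonempty with h | h
    · simp [h]
    · have h1 : ∑ v ∈ T, d < ∑ v ∈ T, (G.degree v : ℝ) :=
        sum_lt_sum_of_nonempty h fun v hv => (mem_filter.1 hv).2
      have h2 : ∑ v ∈ T, (G.degree v : ℝ) ≤ ∑ v, (G.degree v : ℝ) :=
        sum_le_sum_of_subset_of_nonneg (subset_univ _) fun _ _ _ => Nat.cast_nonneg _
      have h3 : ∑ v, (G.degree v : ℝ) = 2 * #G.edgeFinset := by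
        exact_mod_cast G.sum_degrees_eq_twice_card_edges
      rw [sum_const, nsmul_eq_mul] at h1
      have h4 : (#T : ℝ) * d < #S * d := by linarith
      exact_mod_cast (lt_of_mul_lt_mul_right h4 hd).le
  have hV : 0 < Fintype.card V := by
    have : (0 : ℝ) < Fintype.card V := lt_of_le_of_lt (by positivity) hcard
    exact_mod_cast this
  have hVne : Nonempty V := Fintype.card_pos_iff.1 hV
  have hext : ∀ W : Finset β, ∃ f : β → V, Set.InjOn f ↑(T ∪ W) ∧
      ∀ a ∈ T ∪ W, ∀ b ∈ T ∪ W, G.Adj a b → ¬ Γ.Adj (f a) (f b) := by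
    intro W
    induction W using Finset.induction_on with
    | empty =>
      obtain ⟨e⟩ := Function.Embedding.nonempty_of_card_le (α := T) (β := S) (by simpa using hTS)
      refine ⟨fun a => if h : a ∈ T then e ⟨a, h⟩ else Classical.arbitrary V, ?_, ?_⟩
      · intro a ha b hb hab
        simp only [union_empty, mem_coe] at ha hb
        simp only [ha, hb, dif_pos] at hab
        simpa using e.injective (Subtype.ext hab)
      · intro a ha b hb _ hab
        simp only [union_empty] at ha hb
        simp only [ha, hb, dif_pos] at hab
        exact hS (e ⟨a, ha⟩).2 (e ⟨b, hb⟩).2 hab.ne hab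
    | insert v W _ ih =>
      obtain ⟨f, hf, hfadj⟩ := ih
      rw [union_insert]
      set U := T ∪ W with hU
      by_cases hv : v ∈ U
      · rw [insert_eq_of_mem hv]
        exact ⟨f, hf, hfadj⟩
      · have hvd : (G.degree v : ℝ) ≤ d := by
          by_contra! h
          exact hv (mem_union_left _ (by simpa [hT] using h))
        set F : Finset V := U.image f ∪
          (G.neighborFinset v).biUnion fun u => Γ.neighborFinset (f u) with hF
        have hFcard : (#F : ℝ) < #(univ : Finset V) := by
          have h1 : #F ≤ #U + ∑ u ∈ G.neighborFinset v, Γ.degree (f u) :=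
            (card_union_le _ _).trans (add_le_add card_image_le card_biUnion_le)
          have h2 : ∑ u ∈ G.neighborFinset v, (Γ.degree (f u) : ℝ) ≤ d * Δ := by
            refine (sum_le_sum fun u _ => hdeg (f u)).trans ?_
            rw [sum_const, nsmul_eq_mul, card_neighborFinset_eq_degree]
            exact mul_le_mul_of_nonneg_right hvd hΔ
          have h3 : (#U : ℝ) ≤ Fintype.card β := by exact_mod_cast card_le_univ U
          have h4 : (#F : ℝ) ≤ #U + ∑ u ∈ G.neighborFinset v, (Γ.degree (f u) : ℝ) := by
            exact_mod_cast h1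
          rw [card_univ]
          linarith
        obtain ⟨x, -, hx⟩ := exists_mem_notMem_of_card_lt_card
          (show #F < #(univ : Finset V) by exact_mod_cast hFcard)
        simp only [hF, mem_union, mem_image, mem_biUnion, mem_neighborFinset, not_or, not_exists,
          not_and] at hx
        obtain ⟨hx1, hx2⟩ := hx
        have hne : ∀ a ∈ U, a ≠ v := fun a ha h => hv (h ▸ ha)
        refine ⟨Function.update f v x, ?_, ?_⟩
        · intro a ha b hb hab
          rcases mem_insert.1 (mem_coe.1 ha) with rfl | ha' <;>
            rcases mem_insert.1 (mem_coe.1 hb) with rfl | hb'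
          · rfl
          · rw [Function.update_self, Function.update_of_ne (hne b hb')] at hab
            exact (hx1 b hb' hab.symm).elim
          · rw [Function.update_self, Function.update_of_ne (hne a ha')] at hab
            exact (hx1 a ha' hab).elim
          · rw [Function.update_of_ne (hne a ha'), Function.update_of_ne (hne b hb')] at hab
            exact hf ha' hb' hab
        · intro a ha b hb hab
          rcases mem_insert.1 ha with rfl | ha' <;> rcases mem_insert.1 hb with rfl | hb'
          · exact (hab.ne rfl).elim
          · rw [Function.update_self, Function.update_of_ne (hne b hb')]
            exact fun h => hx2 b hab h.symm
          · rw [Function.update_self, Function.update_of_ne (hne a ha')]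
            exact hx2 a hab.symm
          · rw [Function.update_of_ne (hne a ha'), Function.update_of_ne (hne b hb')]
            exact hfadj a ha' b hb' hab
  obtain ⟨f, hf, hfadj⟩ := hext univ
  have hmem : ∀ a, a ∈ T ∪ univ := fun a => mem_union_right _ (mem_univ a)
  have hinj : Function.Injective f := fun a b h =>
    hf (mem_coe.2 (hmem a)) (mem_coe.2 (hmem b)) h
  exact ⟨⟨f, fun {a b} hab => (compl_adj _ _ _).2
    ⟨hinj.ne hab.ne, hfadj a (hmem a) b (hmem b) hab⟩⟩, hinj⟩

theorem card_le_two_mul_card_edgeFinset {β : Type*} [Fintype β] (G : SimpleGraph β)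
    [DecidableRel G.Adj] (hG : ∀ v, ∃ w, G.Adj v w) : Fintype.card β ≤ 2 * #G.edgeFinset := by
  rw [← G.sum_degrees_eq_twice_card_edges, ← card_univ, card_eq_sum_ones]
  refine sum_le_sum fun v _ => ?_
  exact Nat.one_le_iff_ne_zero.2 ((G.degree_pos_iff_exists_adj v).2 (hG v)).ne'

theorem containsCopy_compl_of_comap_val {V β : Type*} {Γ : SimpleGraph V} {G : SimpleGraph β}
    {S : Finset V} (h : (Γ.comap (Subtype.val : S → V))ᶜ.ContainsCopy G) :
    Γᶜ.ContainsCopy G := by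
  obtain ⟨f, hf⟩ := h
  have hinj : Function.Injective fun a => (f a : V) := Subtype.val_injective.comp hf
  refine ⟨⟨fun a => f a, fun {a b} hab => (compl_adj _ _ _).2 ⟨hinj.ne hab.ne, ?_⟩⟩, hinj⟩
  exact ((compl_adj _ _ _).1 (f.map_rel hab)).2

theorem card_le_of_not_containsCopy (s : ℕ) : ∃ c : ℝ, 1 ≤ c ∧
    ∀ (β : Type) [Fintype β] (G : SimpleGraph β) (m : ℕ), G.edgeSet.ncard = m → 2 ≤ m →
      (∀ v, ∃ w, G.Adj v w) → ∀ (V : Type) [Fintype V] (Γ : SimpleGraph V),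
        Γ.CliqueFree (s + 3) → ¬ Γᶜ.ContainsCopy G →
          (Fintype.card V : ℝ) ≤ c * √(m / Real.log m) ^ (s + 2) * Real.log m := by
  classical
  have hsq : ∀ m : ℕ, 2 ≤ m → √(m / Real.log m) ^ 2 * Real.log m = m := fun m hm => by
    have hL : 0 < Real.log m := Real.log_pos (by exact_mod_cast hm)
    rw [Real.sq_sqrt (by positivity), div_mul_cancel₀ _ hL.ne']
  have hedge : ∀ (β : Type) [Fintype β] (G : SimpleGraph β), G.edgeSet.ncard = #G.edgeFinset :=
    fun β _ G => Set.ncard_eq_toFinset_card' _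
  induction s with
  | zero =>
    refine ⟨4, by norm_num, fun β _ G m hGm hm hG V _ Γ hΓ hcopy => ?_⟩
    rw [zero_add, mul_assoc, hsq m hm]
    have hβ := card_le_two_mul_card_edgeFinset G hG
    rw [hedge] at hGm
    rw [hGm] at hβ
    have hβ' : (Fintype.card β : ℝ) ≤ 2 * m := by exact_mod_cast hβ
    rcases isEmpty_or_nonempty V with hV | ⟨⟨v₀⟩⟩
    · rw [Fintype.card_eq_zero, Nat.cast_zero]; positivity
    obtain ⟨S, hS, hmax⟩ := exists_max_image
      ({W | Γ.IsIndepSet ↑W} : Finset (Finset V)) card ⟨∅, by simp [IsIndepSet]⟩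
    have hS' : Γ.IsIndepSet ↑S := by simpa using hS
    have hS1 : 1 ≤ #S := by
      have := hmax {v₀} (by simp [IsIndepSet])
      simpa using this
    have hS0 : (0 : ℝ) < #S := by exact_mod_cast hS1
    have hdeg : ∀ v, (Γ.degree v : ℝ) ≤ #S := fun v => by
      have h1 : Γ.IsIndepSet ↑(Γ.neighborFinset v) := by
        simpa using isIndepSet_neighborSet_of_triangleFree Γ hΓ v
      exact_mod_cast hmax (Γ.neighborFinset v) (by simpa using h1)
    by_contra! hlt
    refine hcopy (containsCopy_compl_of_isIndepSet Γ G hS' (Δ := #S) (d := 2 * m / #S)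
      hS0.le (by positivity) hdeg ?_ ?_)
    · rw [mul_div_cancel₀ _ hS0.ne', hGm]
    · rw [div_mul_cancel₀ _ hS0.ne']; linarith
  | succ s ih =>
    obtain ⟨c, hc, ih⟩ := ih
    obtain ⟨C, hC, hind⟩ := card_le_of_isIndepSet_card_lt (s + 3)
    refine ⟨C * 6 ^ (s + 3) + c + 2, by
      have : 0 ≤ C * 6 ^ (s + 3) := by positivity
      linarith, fun β _ G m hGm hm hG V _ Γ hΓ hcopy => ?_⟩
    have hβ := card_le_two_mul_card_edgeFinset G hG
    have hdegree : ∀ v, (Γ.degree v : ℝ) ≤ c * √(m / Real.log m) ^ (s + 2) * Real.log m := by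
      intro v
      have h1 := ih β G m hGm hm hG _ (Γ.comap (Subtype.val : Γ.neighborFinset v → V))
        (cliqueFree_comap_val Γ fun T hT hc => hΓ _ (hc.insert (a := v) fun b hb => by
          simpa using hT hb)) fun h => hcopy (containsCopy_compl_of_comap_val h)
      rwa [Fintype.card_coe, card_neighborFinset_eq_degree] at h1
    rw [hedge] at hGm
    rw [hGm] at hβ
    have hβ' : (Fintype.card β : ℝ) ≤ 2 * m := by exact_mod_cast hβ
    have hm2 : (2 : ℝ) ≤ m := by exact_mod_cast hm
    set L := Real.log m with hLdef
    have hL : 0.69 < L := by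
      have := Real.log_le_log (by norm_num) hm2
      linarith [Real.log_two_gt_d9]
    have hL0 : 0 < L := by linarith
    set y := √(m / L) with hy
    have hyL : y ^ 2 * L = m := hsq m hm
    have hy1 : 1 ≤ y := by
      rw [hy, Real.one_le_sqrt, one_le_div hL0]
      exact Real.log_le_self (by positivity)
    have hy0 : 0 < y := by linarith
    have hyL1 : 1 < y * L := by
      have h1 : (y * L) ^ 2 = m * L := by rw [← hyL]; ring
      nlinarith
    set k := ⌈2 * (y * L)⌉₊ with hk
    have hk1 : 2 * (y * L) ≤ k := Nat.le_ceil _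
    have hk2 : (k : ℝ) ≤ 3 * (y * L) := by
      have := Nat.ceil_lt_add_one (show 0 ≤ 2 * (y * L) by positivity)
      linarith
    have hk3 : 3 ≤ k := by
      have : (2 : ℝ) < k := by linarith
      exact_mod_cast this
    have hk0 : (0 : ℝ) < k := by positivity
    have hlogk : L / 2 ≤ Real.log k := by
      have h1 : (m : ℝ) ≤ k ^ 2 := by
        have h2 : (2 * (y * L)) ^ 2 ≤ (k : ℝ) ^ 2 := by gcongr
        have h3 : (2 * (y * L)) ^ 2 = 4 * L * m := by rw [← hyL]; ring
        nlinarith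
      have h2 := Real.log_le_log (by positivity) h1
      rw [Real.log_pow] at h2
      push_cast at h2
      linarith
    have hx : k / Real.log k ≤ 6 * y := by
      rw [div_le_iff₀ (by linarith)]
      nlinarith
    by_cases hS : ∀ S : Finset V, Γ.IsIndepSet ↑S → #S < k
    · refine (hind V Γ k hk3 hΓ hS).trans ?_
      have hlk : 0 < Real.log k := by linarith
      calc C * (k / Real.log k) ^ (s + 3) * Real.log k
          = C * (k / Real.log k) ^ (s + 2) * k := by
            rw [pow_succ (_ / _) (s + 2)]; field_simp
        _ ≤ C * (6 * y) ^ (s + 2) * (6 * (y * L)) := by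
            gcongr
            linarith [show 0 < y * L by positivity]
        _ = C * 6 ^ (s + 3) * (y ^ (s + 3) * L) := by ring
        _ ≤ (C * 6 ^ (s + 3) + c + 2) * (y ^ (s + 3) * L) := by
            gcongr; linarith
        _ = _ := by ring
    · push Not at hS
      obtain ⟨S, hSi, hSk⟩ := hS
      have hSk' : (k : ℝ) ≤ #S := by exact_mod_cast hSk
      by_contra! hlt
      refine hcopy (containsCopy_compl_of_isIndepSet Γ G hSi (d := y)
        (by positivity) hy0.le hdegree ?_ ?_)
      · rw [hGm, ← hyL]
        have : 2 * (y * L) * y ≤ #S * y := by gcongr; linarith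
        linarith
      · refine lt_of_le_of_lt ?_ hlt
        have h1 : (m : ℝ) ≤ y ^ (s + 3) * L := by
          rw [← hyL]
          gcongr
          omega
        have h2 : 0 ≤ C * 6 ^ (s + 3) * (y ^ (s + 3) * L) := by positivity
        have h3 : y * (c * y ^ (s + 2) * L) = c * (y ^ (s + 3) * L) := by ring
        have h4 : (C * 6 ^ (s + 3) + c + 2) * y ^ (s + 1 + 2) * L =
          C * 6 ^ (s + 3) * (y ^ (s + 3) * L) + c * (y ^ (s + 3) * L) + 2 * (y ^ (s + 3) * L) := by
          ring
        rw [h3, h4]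
        linarith

end

theorem stmt_2 (s : ℕ) (hs : 3 ≤ s) :
    ∃ c : ℝ, 0 < c ∧
      ∀ (β : Type) [Fintype β] (G : SimpleGraph β) (m : ℕ),
        G.edgeSet.ncard = m → 2 ≤ m → (∀ v, ∃ w, G.Adj v w) →
        (ramseyNumber (⊤ : SimpleGraph (Fin s)) G : ℝ) ≤
          c * (m : ℝ) ^ ((s - 1 : ℝ) / 2) / Real.log m ^ ((s - 3 : ℝ) / 2) := by
  obtain ⟨s, rfl⟩ := Nat.exists_eq_add_of_le' hs
  obtain ⟨c, hc, hcard⟩ := card_le_of_not_containsCopy s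
  refine ⟨c + 1, by linarith, fun β _ G m hGm hm hG => ?_⟩
  have hm2 : (2 : ℝ) ≤ m := by exact_mod_cast hm
  have hL : 0 < Real.log m := Real.log_pos (by linarith)
  set L := Real.log m with hLdef
  set y := √(m / L) with hy
  have hyL : y ^ 2 * L = m := by
    rw [hy, Real.sq_sqrt (by positivity), div_mul_cancel₀ _ hL.ne']
  have hy1 : 1 ≤ y := by
    rw [hy, Real.one_le_sqrt, one_le_div hL]
    exact Real.log_le_self (by positivity)
  have hbound : 1 ≤ y ^ (s + 2) * L := by
    have h1 : y ^ 2 * L ≤ y ^ (s + 2) * L := by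
      gcongr
      omega
    linarith
  have hrhs : (c + 1) * (m : ℝ) ^ (((s + 3 : ℕ) - 1 : ℝ) / 2) / L ^ (((s + 3 : ℕ) - 3 : ℝ) / 2) =
      (c + 1) * (y ^ (s + 2) * L) := by
    have h1 : y ^ (s + 2) = (m : ℝ) ^ (((s + 3 : ℕ) - 1 : ℝ) / 2) / L ^ ((s : ℝ) / 2 + 1) := by
      rw [hy, Real.sqrt_eq_rpow, ← Real.rpow_natCast, ← Real.rpow_mul (by positivity),
        Real.div_rpow (by positivity) hL.le]
      congr 2 <;> push_cast <;> ring
    rw [h1, Real.rpow_add hL, Real.rpow_one]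
    have h2 : (((s + 3 : ℕ) - 3 : ℝ) / 2) = (s : ℝ) / 2 := by push_cast; ring
    rw [h2]
    field_simp
  rw [hrhs]
  set N := ⌊c * (y ^ (s + 2) * L)⌋₊ + 1 with hN
  have hprop : RamseyProp N (⊤ : SimpleGraph (Fin (s + 3))) G := by
    intro Γ
    by_contra! hcon
    have hfree : Γ.CliqueFree (s + 3) := by
      by_contra hnot
      obtain ⟨f⟩ := (not_cliqueFree_iff_top_isContained _).1 hnot
      exact hcon.1 ⟨f.toHom, f.injective⟩
    have h1 := hcard β G m hGm hm hG (Fin N) Γ hfree hcon.2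
    rw [Fintype.card_fin, hN, mul_assoc] at h1
    push_cast at h1
    exact absurd h1 (not_le.2 (Nat.lt_floor_add_one _))
  have hle : ramseyNumber (⊤ : SimpleGraph (Fin (s + 3))) G ≤ N :=
    Nat.sInf_le ⟨Nat.succ_pos _, hprop⟩
  have hle' : (ramseyNumber (⊤ : SimpleGraph (Fin (s + 3))) G : ℝ) ≤ N := by exact_mod_cast hle
  refine hle'.trans ?_
  rw [hN]
  push_cast
  have := Nat.floor_le (show 0 ≤ c * (y ^ (s + 2) * L) by positivity)
  linarith
end

section
/- Let H be a fixed graph having at least 3 vertices and at least 2 edges, and define ρ*(H) as the maximum, over all subgraphs H' of H with at least 3 vertices, of the density ρ(H') = (e(H') − 1)/(v(H') − 2), where e(H') and v(H') are the number of edges and vertices of H'. Then there exists a constant c > 0 (depending only on H) such that for every graph G with m ≥ 2 edges, r(H, G) ≥ c (m / log m)^{ρ*(H)/(1 + ρ*(H))}. -/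
open SimpleGraph

/-- `maxDensity H` is `ρ*(H)`, the maximum over all subgraphs `H'` of `H` with at least 3
vertices of the density `ρ(H') = (e(H') - 1) / (v(H') - 2)`. -/
noncomputable def maxDensity {α : Type} [Fintype α] (H : SimpleGraph α) : ℝ :=
  sSup {ρ : ℝ | ∃ H' : H.Subgraph, 3 ≤ H'.verts.ncard ∧
    ρ = ((H'.edgeSet.ncard : ℝ) - 1) / ((H'.verts.ncard : ℝ) - 2)}

open Finset in
theorem sum_weight_of_subset_of_disjoint {X : Type*} [Fintype X] [DecidableEq X] (p : ℝ)
    {A B : Finset X} (hAB : Disjoint A B) :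
    ∑ S : Finset X with A ⊆ S ∧ Disjoint S B, p ^ #S * (1 - p) ^ #Sᶜ
      = p ^ #A * (1 - p) ^ #B := by
  have h := Finset.prod_add (fun x => if x ∈ B then 0 else p)
    (fun x => if x ∈ A then 0 else 1 - p) (univ : Finset X)
  have hl : ∏ x : X, ((if x ∈ B then 0 else p) + (if x ∈ A then 0 else 1 - p))
      = p ^ #A * (1 - p) ^ #B := by
    have : ∀ x : X, ((if x ∈ B then 0 else p) + (if x ∈ A then 0 else 1 - p))
        = (if x ∈ A then p else 1) * (if x ∈ B then 1 - p else 1) := by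
      intro x
      have : x ∈ A → x ∉ B := fun h => Finset.disjoint_left.mp hAB h
      split_ifs <;> simp_all
    rw [prod_congr rfl fun x _ => this x, prod_mul_distrib, prod_ite_mem, prod_ite_mem]
    simp
  rw [← hl, h, powerset_univ, sum_filter]
  refine sum_congr rfl fun S _ => ?_
  rw [← compl_eq_univ_sdiff]
  split_ifs with hS
  · rw [prod_congr rfl (g := fun _ => p), prod_congr rfl (s₁ := Sᶜ) (g := fun _ => 1 - p)]
    · simp
    · intro x hx
      rw [if_neg]
      exact fun hxA => (mem_compl.mp hx) (hS.1 hxA)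
    · intro x hx
      rw [if_neg]
      exact Finset.disjoint_left.mp hS.2 hx
  · symm
    rw [not_and_or] at hS
    rcases hS with hS | hS
    · obtain ⟨x, hxA, hxS⟩ := Finset.not_subset.mp hS
      rw [prod_eq_zero (s := Sᶜ) (mem_compl.mpr hxS) (by simp [hxA]), mul_zero]
    · obtain ⟨x, hxS, hxB⟩ := Finset.not_disjoint_iff.mp hS
      rw [prod_eq_zero (s := S) hxS (by simp [hxB]), zero_mul]

open Finset in
/-- Alteration of a random set: delete a maximal packing of edges. -/
theorem exists_independent_transversal {X ι κ : Type*} [Fintype X] [DecidableEq X]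
    [Fintype ι] [DecidableEq ι] [Fintype κ]
    (E : ι → Finset X) (M : κ → Finset X) {e m D : ℕ} {p : ℝ} (he : 0 < e)
    (hp₀ : 0 ≤ p) (hp₁ : p < 1)
    (hE : ∀ i, #(E i) = e) (hM : ∀ k, #(M k) = m)
    (hD : ∀ k, #{i | ¬ Disjoint (E i) (M k)} ≤ D)
    (h : Fintype.card κ * ((1 - p) ^ m * (1 + (p / (1 - p)) ^ e) ^ D) < 1) :
    ∃ S : Finset X, (∀ i, ¬ E i ⊆ S) ∧ ∀ k, ¬ Disjoint (M k) S := by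
  classical
  by_contra! hcon
  have hq : 0 < 1 - p := by linarith
  have key : ∀ S : Finset X, ∃ k : κ, ∃ F ∈ ({i | ¬ Disjoint (E i) (M k)} : Finset ι).powerset,
      (F : Set ι).PairwiseDisjoint E ∧
      (F.biUnion E ⊆ S ∧ Disjoint S (M k \ F.biUnion E)) := by
    intro S
    obtain ⟨F, hF⟩ := (Set.toFinite {F : Finset ι | (F : Set ι).PairwiseDisjoint E ∧
      F.biUnion E ⊆ S}).exists_maximal ⟨∅, by simp⟩
    have hfree : ∀ i, ¬ E i ⊆ S \ F.biUnion E := by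
      intro i hi
      rw [subset_sdiff] at hi
      have hdisj : ∀ j ∈ F, Disjoint (E i) (E j) := fun j hj =>
        hi.2.mono_right (subset_biUnion_of_mem E hj)
      have hiF : i ∉ F := by
        intro hiF
        have := hdisj i hiF
        rw [disjoint_self, bot_eq_empty, ← card_eq_zero, hE] at this
        omega
      have := hF.le_of_ge (y := insert i F) ⟨by
          rw [coe_insert]
          exact hF.prop.1.insert fun j hj _ => hdisj j hj, by
          rw [biUnion_insert]
          exact union_subset hi.1 hF.prop.2⟩ (subset_insert i F)
      exact hiF (this (mem_insert_self i F))
    obtain ⟨k, hk⟩ := hcon _ hfree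
    refine ⟨k, F.filter fun i => ¬ Disjoint (E i) (M k), ?_, ?_, ?_, ?_⟩
    · rw [mem_powerset]
      exact filter_subset_filter _ (subset_univ F)
    · exact hF.prop.1.subset (coe_subset.mpr (filter_subset _ F))
    · exact (biUnion_subset_biUnion_of_subset_left _ (filter_subset _ F)).trans hF.prop.2
    · rw [Finset.disjoint_left] at hk ⊢
      intro x hxS hx
      rw [mem_sdiff] at hx
      have := hk hx.1
      simp only [mem_sdiff, hxS, true_and, not_not, mem_biUnion] at this
      obtain ⟨i, hi, hxi⟩ := this
      exact hx.2 (mem_biUnion.mpr ⟨i, mem_filter.mpr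
        ⟨hi, Finset.not_disjoint_iff.mpr ⟨x, hxi, hx.1⟩⟩, hxi⟩)
  have hw : ∀ S : Finset X, 0 ≤ p ^ #S * (1 - p) ^ #Sᶜ := fun S => by positivity
  have hbound : ∀ k, ∀ F : Finset ι, (F : Set ι).PairwiseDisjoint E →
      ∑ S : Finset X with F.biUnion E ⊆ S ∧ Disjoint S (M k \ F.biUnion E),
        p ^ #S * (1 - p) ^ #Sᶜ ≤ (1 - p) ^ m * ((p / (1 - p)) ^ e) ^ #F := by
    intro k F hF
    rw [sum_weight_of_subset_of_disjoint p disjoint_sdiff]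
    have hc : #(F.biUnion E) = e * #F := by
      rw [card_biUnion hF, sum_congr rfl fun i _ => hE i]
      simp [mul_comm]
    have hle : m ≤ #(M k \ F.biUnion E) + e * #F := by
      rw [← hc, ← hM k]
      exact card_le_card_sdiff_add_card
    rw [hc, ← pow_mul, div_pow, mul_div_assoc', le_div_iff₀ (by positivity), mul_assoc, ← pow_add,
      mul_comm]
    exact mul_le_mul_of_nonneg_right (pow_le_pow_of_le_one hq.le (by linarith) hle) (by positivity)
  have hone : ∑ S : Finset X, p ^ #S * (1 - p) ^ #Sᶜ = 1 := by
    simpa using sum_weight_of_subset_of_disjoint (X := X) p (disjoint_bot_left (a := ∅))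
  have hx : 0 ≤ (p / (1 - p)) ^ e := by positivity
  refine absurd h (not_lt.mpr ?_)
  calc (1 : ℝ) = ∑ S : Finset X, p ^ #S * (1 - p) ^ #Sᶜ := hone.symm
    _ ≤ ∑ S : Finset X, ∑ k : κ, ∑ F ∈ ({i | ¬ Disjoint (E i) (M k)} : Finset ι).powerset,
          if (F : Set ι).PairwiseDisjoint E ∧
            (F.biUnion E ⊆ S ∧ Disjoint S (M k \ F.biUnion E))
          then p ^ #S * (1 - p) ^ #Sᶜ else 0 := by
        refine sum_le_sum fun S _ => ?_
        obtain ⟨k, F, hF, hFS⟩ := key S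
        have hnn : ∀ (k : κ) (F : Finset ι), 0 ≤ if (F : Set ι).PairwiseDisjoint E ∧
            (F.biUnion E ⊆ S ∧ Disjoint S (M k \ F.biUnion E))
          then p ^ #S * (1 - p) ^ #Sᶜ else 0 := fun k F => by
          split_ifs
          exacts [hw S, le_rfl]
        refine le_trans ?_ (single_le_sum (fun k _ => sum_nonneg fun F _ => hnn k F) (mem_univ k))
        refine le_trans ?_ (single_le_sum (fun F _ => hnn k F) hF)
        rw [if_pos hFS]
    _ = ∑ k : κ, ∑ F ∈ ({i | ¬ Disjoint (E i) (M k)} : Finset ι).powerset, ∑ S : Finset X,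
          if (F : Set ι).PairwiseDisjoint E ∧
            (F.biUnion E ⊆ S ∧ Disjoint S (M k \ F.biUnion E))
          then p ^ #S * (1 - p) ^ #Sᶜ else 0 := by
        rw [sum_comm]
        exact sum_congr rfl fun k _ => sum_comm
    _ ≤ ∑ k : κ, ∑ F ∈ ({i | ¬ Disjoint (E i) (M k)} : Finset ι).powerset,
          (1 - p) ^ m * ((p / (1 - p)) ^ e) ^ #F := by
        refine sum_le_sum fun k _ => sum_le_sum fun F _ => ?_
        by_cases hF : (F : Set ι).PairwiseDisjoint E
        · simp only [hF, true_and]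
          rw [← sum_filter]
          exact hbound k F hF
        · simp only [hF, false_and, if_false, sum_const_zero]
          positivity
    _ ≤ ∑ _k : κ, (1 - p) ^ m * (1 + (p / (1 - p)) ^ e) ^ D := by
        refine sum_le_sum fun k _ => ?_
        rw [← mul_sum]
        refine mul_le_mul_of_nonneg_left ?_ (by positivity)
        have := sum_pow_mul_eq_add_pow ((p / (1 - p)) ^ e) 1
          ({i | ¬ Disjoint (E i) (M k)} : Finset ι)
        simp only [one_pow, mul_one] at this
        rw [this, add_comm]
        exact pow_le_pow_right₀ (by linarith) (hD k)
    _ = Fintype.card κ * ((1 - p) ^ m * (1 + (p / (1 - p)) ^ e) ^ D) := by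
        simp

open Finset in
theorem card_embedding_map_pair_le {γ V : Type*} [Fintype γ] [Fintype V] [DecidableEq γ]
    [DecidableEq V] {a b : γ} (hab : a ≠ b) (c d : V) :
    #{f : γ ↪ V | f a = c ∧ f b = d} ≤ Fintype.card V ^ (Fintype.card γ - 2) := by
  have hcard : Fintype.card {z : γ // z ∉ ({a, b} : Finset γ)} = Fintype.card γ - 2 := by
    rw [Fintype.card_subtype_compl, Fintype.card_coe, card_pair hab]
  rw [← hcard, ← Fintype.card_fun, ← card_univ]
  refine card_le_card_of_injOn (fun f z => f z) (fun _ _ => mem_coe.mpr (mem_univ _)) ?_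
  intro f hf g hg hfg
  simp only [coe_filter, mem_univ, true_and, Set.mem_ofPred_eq] at hf hg
  ext z
  by_cases hza : z = a
  · rw [hza, hf.1, hg.1]
  by_cases hzb : z = b
  · rw [hzb, hf.2, hg.2]
  exact congrFun hfg ⟨z, by simp [hza, hzb]⟩

open Finset in
theorem card_embedding_sym2_map_eq_le {γ V : Type*} [Fintype γ] [Fintype V] [DecidableEq γ]
    [DecidableEq V] {x : Sym2 γ} (hx : ¬ x.IsDiag) (y : Sym2 V) :
    #{f : γ ↪ V | Sym2.map f x = y} ≤ 2 * Fintype.card V ^ (Fintype.card γ - 2) := by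
  induction x with | _ a b
  induction y with | _ c d
  rw [Sym2.mk_isDiag_iff] at hx
  have hsub : ({f : γ ↪ V | Sym2.map f s(a, b) = s(c, d)} : Finset (γ ↪ V)) ⊆
      univ.filter (fun f => f a = c ∧ f b = d) ∪ univ.filter fun f => f a = d ∧ f b = c := by
    intro f hf
    simpa using hf
  refine (card_le_card hsub).trans ((card_union_le _ _).trans ?_)
  rw [two_mul]
  exact add_le_add (card_embedding_map_pair_le hx c d) (card_embedding_map_pair_le hx d c)

open Finset in
theorem card_embedding_not_disjoint_le {γ V : Type*} [Fintype γ] [Fintype V] [DecidableEq γ]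
    [DecidableEq V] {A : Finset (Sym2 γ)} (hA : ∀ x ∈ A, ¬ x.IsDiag) (B : Finset (Sym2 V)) :
    #{f : γ ↪ V | ¬ Disjoint (A.image (Sym2.map f)) B} ≤
      #A * #B * (2 * Fintype.card V ^ (Fintype.card γ - 2)) := by
  have hsub : ({f : γ ↪ V | ¬ Disjoint (A.image (Sym2.map f)) B} : Finset (γ ↪ V)) ⊆
      (A ×ˢ B).biUnion fun z => {f : γ ↪ V | Sym2.map f z.1 = z.2} := by
    intro f hf
    simp only [mem_filter, mem_univ, true_and, Finset.not_disjoint_iff, mem_image] at hf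
    obtain ⟨_, ⟨x, hx, rfl⟩, hy⟩ := hf
    simp only [mem_biUnion, mem_product, mem_filter, mem_univ, true_and]
    exact ⟨(x, _), ⟨hx, hy⟩, rfl⟩
  rw [← card_product]
  refine (card_le_card hsub).trans (card_biUnion_le_card_mul _ _ _ fun z hz => ?_)
  exact card_embedding_sym2_map_eq_le (hA _ (mem_product.mp hz).1) _

open Finset in
theorem exists_isNClique_or_compl (s t : ℕ) :
    ∃ N : ℕ, ∀ (V : Type) [DecidableEq V] (Γ : SimpleGraph V) (A : Finset V), N ≤ #A →
      (∃ S ⊆ A, Γ.IsNClique s S) ∨ ∃ S ⊆ A, Γᶜ.IsNClique t S := by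
  induction s generalizing t with
  | zero => exact ⟨0, fun V _ Γ A _ => Or.inl ⟨∅, by simp, by simp⟩⟩
  | succ s ihs =>
    induction t with
    | zero => exact ⟨0, fun V _ Γ A _ => Or.inr ⟨∅, by simp, by simp⟩⟩
    | succ t iht =>
      obtain ⟨N₁, h₁⟩ := ihs (t + 1)
      obtain ⟨N₂, h₂⟩ := iht
      refine ⟨N₁ + N₂ + 1, fun V _ Γ A hA => ?_⟩
      classical
      obtain ⟨v, hv⟩ : A.Nonempty := card_pos.mp (by omega)
      have hsplit := card_filter_add_card_filter_not (s := A.erase v) (Γ.Adj v)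
      rw [card_erase_of_mem hv] at hsplit
      have hins : ∀ {S : Finset V} {P : V → Prop} [DecidablePred P],
          S ⊆ (A.erase v).filter P → insert v S ⊆ A := fun hS =>
        insert_subset hv ((hS.trans (filter_subset _ _)).trans (erase_subset _ _))
      rcases Nat.lt_or_ge #((A.erase v).filter (Γ.Adj v)) N₁ with hlt | hge
      · rcases h₂ V Γ ((A.erase v).filter fun w => ¬ Γ.Adj v w) (by omega) with
          ⟨S, hS, hc⟩ | ⟨S, hS, hc⟩
        · exact Or.inl ⟨S, (subset_insert v S).trans (hins hS), hc⟩
        · refine Or.inr ⟨insert v S, hins hS, hc.insert fun w hw => ?_⟩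
          have := mem_filter.mp (hS hw)
          exact (SimpleGraph.compl_adj _ _ _).mpr ⟨(ne_of_mem_erase this.1).symm, this.2⟩
      · rcases h₁ V Γ _ hge with ⟨S, hS, hc⟩ | ⟨S, hS, hc⟩
        · exact Or.inl ⟨insert v S, hins hS, hc.insert fun w hw => (mem_filter.mp (hS hw)).2⟩
        · exact Or.inr ⟨S, (subset_insert v S).trans (hins hS), hc⟩

theorem SimpleGraph.IsNClique.containsCopy {V α : Type*} [Fintype α] {Γ : SimpleGraph V}
    {S : Finset V} (hS : Γ.IsNClique (Fintype.card α) S) (H : SimpleGraph α) :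
    Γ.ContainsCopy H := by
  have hcard : Fintype.card α = Fintype.card S := by rw [Fintype.card_coe, hS.card_eq]
  let φ := Fintype.equivOfCardEq hcard
  refine ⟨⟨fun a => φ a, fun {a b} hab => ?_⟩, fun a b hab => φ.injective (Subtype.ext hab)⟩
  exact hS.isClique (φ a).2 (φ b).2 fun h => hab.ne (φ.injective (Subtype.ext h))

open Finset in
/-- The union bound over all embeddings of `G`, for `H` with `e` edges and `G` with `m` edges. -/
theorem not_ramseyProp_of_lt_one {γ β : Type*} [Fintype γ] [Fintype β] {K : SimpleGraph γ}
    {G : SimpleGraph β} {n e m : ℕ} {p : ℝ} (hK : K.edgeSet.ncard = e) (hG : G.edgeSet.ncard = m)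
    (hn : 0 < n) (he : 0 < e) (hp₀ : 0 ≤ p) (hp₁ : p < 1)
    (h : (n : ℝ) ^ n * ((1 - p) ^ m *
      (1 + (p / (1 - p)) ^ e) ^ (e * m * (2 * n ^ (Fintype.card γ - 2)))) < 1) :
    ∃ Γ : SimpleGraph (Fin n), ¬ Γ.ContainsCopy K ∧ ¬ Γᶜ.ContainsCopy G := by
  classical
  rw [Set.ncard_eq_toFinset_card', ← SimpleGraph.edgeFinset] at hK hG
  have hq : 0 < 1 - p := by linarith
  have hcard : (Fintype.card (β ↪ Fin n) : ℝ) ≤ (n : ℝ) ^ n := by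
    rw [Fintype.card_embedding_eq, Fintype.card_fin]
    rcases Nat.lt_or_ge n (Fintype.card β) with hlt | hge
    · rw [Nat.descFactorial_eq_zero_iff_lt.mpr hlt]
      simp
    · exact_mod_cast (Nat.descFactorial_le_pow n _).trans (Nat.pow_le_pow_right hn hge)
  have hM : ∀ g : β ↪ Fin n, #(G.edgeFinset.image (Sym2.map g)) = m := fun g => by
    rw [card_image_of_injective _ (Sym2.map.injective g.injective), hG]
  obtain ⟨S, hSK, hSG⟩ := exists_independent_transversal
    (fun f : γ ↪ Fin n => K.edgeFinset.image (Sym2.map f))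
    (fun g : β ↪ Fin n => G.edgeFinset.image (Sym2.map g)) he hp₀ hp₁
    (fun f => by rw [card_image_of_injective _ (Sym2.map.injective f.injective), hK])
    hM
    (fun g => by
      have := card_embedding_not_disjoint_le
        (fun x hx => K.not_isDiag_of_mem_edgeSet (SimpleGraph.mem_edgeFinset.mp hx))
        (G.edgeFinset.image (Sym2.map g))
      rwa [hK, hM, Fintype.card_fin] at this)
    (lt_of_le_of_lt (mul_le_mul_of_nonneg_right hcard (by positivity)) h)
  refine ⟨SimpleGraph.fromEdgeSet S, ?_, ?_⟩
  · rintro ⟨f, hf⟩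
    refine hSK ⟨f, hf⟩ fun y hy => ?_
    obtain ⟨x, hx, rfl⟩ := mem_image.mp hy
    induction x with | _ a b
    exact ((SimpleGraph.fromEdgeSet_adj _).mp (f.map_adj (SimpleGraph.mem_edgeFinset.mp hx))).1
  · rintro ⟨g, hg⟩
    obtain ⟨y, hy, hyS⟩ := Finset.not_disjoint_iff.mp (hSG ⟨g, hg⟩)
    obtain ⟨x, hx, rfl⟩ := mem_image.mp hy
    induction x with | _ a b
    have hadj := (SimpleGraph.compl_adj _ _ _).mp (g.map_adj (SimpleGraph.mem_edgeFinset.mp hx))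
    exact hadj.2 ((SimpleGraph.fromEdgeSet_adj _).mpr ⟨hyS, hadj.1⟩)

theorem pow_mul_one_add_pow_lt_one {j k n m : ℕ} (hj : 0 < j) (hk : 0 < k) (hn : 0 < n)
    (hm : 2 ≤ m) {ρ c p : ℝ} (hρ : ρ = j / k) (hc : c = 1 / (4 * (j + 1) * 2 ^ (j + 1)))
    (hp : p = c * (n : ℝ) ^ (-(1 / ρ)))
    (hle : (n : ℝ) ≤ c / 4 * ((m : ℝ) / Real.log m) ^ (ρ / (1 + ρ))) :
    0 ≤ p ∧ p < 1 ∧ (n : ℝ) ^ n * ((1 - p) ^ m *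
      (1 + (p / (1 - p)) ^ (j + 1)) ^ ((j + 1) * m * (2 * n ^ k))) < 1 := by
  have hj' : (1 : ℝ) ≤ j := by exact_mod_cast hj
  have hk' : (0 : ℝ) < k := by exact_mod_cast hk
  have hn' : (1 : ℝ) ≤ n := by exact_mod_cast hn
  have hm' : (2 : ℝ) ≤ m := by exact_mod_cast hm
  have hρ₀ : 0 < ρ := by rw [hρ]; positivity
  have hc₀ : 0 < c := by rw [hc]; positivity
  have hc₁ : c ≤ 1 / 2 := by
    rw [hc]
    refine one_div_le_one_div_of_le (by norm_num) ?_
    have : (1 : ℝ) ≤ 2 ^ (j + 1) := one_le_pow₀ (by norm_num)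
    nlinarith
  have hp₀ : 0 < p := by rw [hp]; positivity
  have hpc : p ≤ c := by
    rw [hp]
    refine mul_le_of_le_one_right hc₀.le (Real.rpow_le_one_of_one_le_of_nonpos hn' ?_)
    exact neg_nonpos.mpr (by positivity)
  have hp₂ : p ≤ 1 / 2 := hpc.trans hc₁
  have hlog : 0 < Real.log m := Real.log_pos (by linarith)
  have hbase : 1 ≤ (m : ℝ) / Real.log m := by
    rw [le_div_iff₀ hlog]
    linarith [Real.log_le_sub_one_of_pos (by linarith : (0 : ℝ) < m)]
  have hbase₂ : (m : ℝ) / Real.log m ≤ 2 * m := by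
    rw [div_le_iff₀ hlog]
    have h1 : Real.log 2 ≤ Real.log m := Real.log_le_log (by norm_num) hm'
    have h2 := Real.log_two_gt_d9
    nlinarith
  have hnm : (n : ℝ) ≤ m := by
    have h1 : ((m : ℝ) / Real.log m) ^ (ρ / (1 + ρ)) ≤ m / Real.log m :=
      Real.rpow_le_self_of_one_le hbase (by rw [div_le_one (by linarith)]; linarith)
    have h2 : c / 4 * ((m : ℝ) / Real.log m) ^ (ρ / (1 + ρ)) ≤ c / 4 * (2 * m) :=
      mul_le_mul_of_nonneg_left (h1.trans hbase₂) (by linarith)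
    nlinarith
  have hpn : p * (n : ℝ) ^ (1 / ρ) = c := by
    rw [hp, mul_assoc, ← Real.rpow_add (by linarith)]
    simp
  have hpow : (n : ℝ) * (n : ℝ) ^ (1 / ρ) ≤ c / 4 * (m / Real.log m) := by
    have h1 : (n : ℝ) * (n : ℝ) ^ (1 / ρ) = (n : ℝ) ^ (1 + 1 / ρ) := by
      rw [Real.rpow_add (by linarith), Real.rpow_one]
    have h2 : (1 : ℝ) ≤ 1 + 1 / ρ := by
      have : 0 < 1 / ρ := by positivity
      linarith
    have h3 : ρ / (1 + ρ) * (1 + 1 / ρ) = 1 := by field_simp; ring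
    rw [h1]
    refine (Real.rpow_le_rpow (by linarith) hle (by linarith)).trans ?_
    rw [Real.mul_rpow (by linarith) (by positivity), ← Real.rpow_mul (by linarith), h3,
      Real.rpow_one]
    exact mul_le_mul_of_nonneg_right
      (Real.rpow_le_self_of_le_one (by linarith) (by linarith) h2) (by linarith)
  have hentropy : (n : ℝ) * Real.log n < p * m / 2 := by
    have hlog_le : Real.log n ≤ Real.log m := Real.log_le_log (by linarith) hnm
    have h1 : (n : ℝ) * (n : ℝ) ^ (1 / ρ) * Real.log n ≤ c / 4 * m := by
      calc (n : ℝ) * (n : ℝ) ^ (1 / ρ) * Real.log n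
          ≤ c / 4 * (m / Real.log m) * Real.log m :=
            mul_le_mul hpow hlog_le (Real.log_nonneg hn') (by positivity)
        _ = c / 4 * m := by field_simp
    have hpos : 0 < (n : ℝ) ^ (1 / ρ) := by positivity
    have h2 : (n : ℝ) ^ (1 / ρ) * (n * Real.log n) < (n : ℝ) ^ (1 / ρ) * (p * m / 2) := by
      calc (n : ℝ) ^ (1 / ρ) * (n * Real.log n) ≤ c / 4 * m := by linarith
        _ < c / 2 * m := by nlinarith
        _ = (n : ℝ) ^ (1 / ρ) * (p * m / 2) := by rw [← hpn]; ring
    exact lt_of_mul_lt_mul_left h2 hpos.le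
  have hpj : p ^ j * (n : ℝ) ^ k ≤ c := by
    have h1 : ((n : ℝ) ^ (-(1 / ρ))) ^ j * (n : ℝ) ^ k = 1 := by
      rw [← Real.rpow_natCast, ← Real.rpow_mul (by linarith), ← Real.rpow_natCast,
        ← Real.rpow_add (by linarith)]
      have : -(1 / ρ) * j + k = 0 := by rw [hρ]; field_simp; ring
      rw [this, Real.rpow_zero]
    rw [hp, mul_pow, mul_assoc, h1, mul_one]
    exact pow_le_of_le_one hc₀.le (by linarith) hj.ne'
  have hq : 0 < 1 - p := by linarith
  set x := (p / (1 - p)) ^ (j + 1) with hx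
  have hx₀ : 0 ≤ x := by positivity
  have hx₁ : x ≤ 2 ^ (j + 1) * (p * p ^ j) := by
    rw [hx, ← pow_succ', ← mul_pow]
    refine pow_le_pow_left₀ (by positivity) ?_ _
    rw [div_le_iff₀ hq]
    nlinarith
  have hxD : x * (((j + 1) * m * (2 * n ^ k) : ℕ) : ℝ) ≤ p * m / 2 := by
    push_cast
    calc x * ((j + 1) * m * (2 * (n : ℝ) ^ k))
        ≤ 2 ^ (j + 1) * (p * p ^ j) * ((j + 1) * m * (2 * (n : ℝ) ^ k)) :=
          mul_le_mul_of_nonneg_right hx₁ (by positivity)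
      _ = 2 ^ (j + 1) * p * ((j + 1) * m * 2) * (p ^ j * (n : ℝ) ^ k) := by ring
      _ ≤ 2 ^ (j + 1) * p * ((j + 1) * m * 2) * c :=
          mul_le_mul_of_nonneg_left hpj (by positivity)
      _ = p * m / 2 := by rw [hc]; field_simp; ring
  refine ⟨hp₀.le, by linarith, ?_⟩
  have hn_exp : (n : ℝ) ^ n = Real.exp (n * Real.log n) := by
    rw [Real.exp_nat_mul, Real.exp_log (by linarith)]
  have hq_exp : (1 - p) ^ m ≤ Real.exp (-(p * m)) := by
    rw [show -(p * m) = m * -p by ring, Real.exp_nat_mul]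
    exact pow_le_pow_left₀ hq.le (Real.one_sub_le_exp_neg p) m
  have hx_exp : (1 + x) ^ ((j + 1) * m * (2 * n ^ k)) ≤ Real.exp (p * m / 2) := by
    refine le_trans ?_ (Real.exp_le_exp.mpr hxD)
    rw [mul_comm x, Real.exp_nat_mul]
    exact pow_le_pow_left₀ (by linarith) (by linarith [Real.add_one_le_exp x]) _
  calc (n : ℝ) ^ n * ((1 - p) ^ m * (1 + x) ^ ((j + 1) * m * (2 * n ^ k)))
      ≤ Real.exp (n * Real.log n) * (Real.exp (-(p * m)) * Real.exp (p * m / 2)) := by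
        rw [hn_exp]
        refine mul_le_mul_of_nonneg_left ?_ (Real.exp_pos _).le
        exact mul_le_mul hq_exp hx_exp (by positivity) (Real.exp_pos _).le
    _ = Real.exp (n * Real.log n + (-(p * m) + p * m / 2)) := by
        rw [Real.exp_add, Real.exp_add]
    _ < 1 := by
        rw [Real.exp_lt_one_iff]
        linarith

theorem exists_subgraph_density_eq_maxDensity {α : Type} [Fintype α] (H : SimpleGraph α)
    (hv : 3 ≤ Fintype.card α) (he : 2 ≤ H.edgeSet.ncard) :
    ∃ H' : H.Subgraph, 3 ≤ H'.verts.ncard ∧ 2 ≤ H'.edgeSet.ncard ∧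
      maxDensity H = ((H'.edgeSet.ncard : ℝ) - 1) / ((H'.verts.ncard : ℝ) - 2) := by
  classical
  set D : Set ℝ := {ρ : ℝ | ∃ H' : H.Subgraph, 3 ≤ H'.verts.ncard ∧
    ρ = ((H'.edgeSet.ncard : ℝ) - 1) / ((H'.verts.ncard : ℝ) - 2)} with hD
  have hfin : D.Finite := by
    refine (Set.finite_range fun H' : H.Subgraph =>
      ((H'.edgeSet.ncard : ℝ) - 1) / ((H'.verts.ncard : ℝ) - 2)).subset ?_
    rintro _ ⟨H', -, rfl⟩
    exact ⟨H', rfl⟩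
  have htop : ((H.edgeSet.ncard : ℝ) - 1) / ((Fintype.card α : ℝ) - 2) ∈ D := by
    refine ⟨⊤, ?_, ?_⟩ <;> simp [Set.ncard_univ, hv]
  have hpos : 0 < maxDensity H := by
    refine lt_of_lt_of_le ?_ (le_csSup hfin.bddAbove htop)
    have h1 : (2 : ℝ) ≤ H.edgeSet.ncard := by exact_mod_cast he
    have h2 : (3 : ℝ) ≤ Fintype.card α := by exact_mod_cast hv
    exact div_pos (by linarith) (by linarith)
  obtain ⟨H', hv', hρ⟩ : maxDensity H ∈ D := Set.Nonempty.csSup_mem ⟨_, htop⟩ hfin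
  refine ⟨H', hv', ?_, hρ⟩
  by_contra! hlt
  have h1 : (H'.edgeSet.ncard : ℝ) ≤ 1 := by exact_mod_cast Nat.lt_succ_iff.mp hlt
  have h2 : (3 : ℝ) ≤ H'.verts.ncard := by exact_mod_cast hv'
  have := div_nonpos_of_nonpos_of_nonneg (sub_nonpos.mpr h1)
    (by linarith : (0 : ℝ) ≤ (H'.verts.ncard : ℝ) - 2)
  linarith

theorem stmt_3 {α : Type} [Fintype α] (H : SimpleGraph α)
    (hv : 3 ≤ Fintype.card α) (he : 2 ≤ H.edgeSet.ncard) :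
    ∃ c : ℝ, 0 < c ∧
      ∀ (β : Type) [Fintype β] (G : SimpleGraph β) (m : ℕ),
        G.edgeSet.ncard = m → 2 ≤ m →
        c * ((m : ℝ) / Real.log m) ^ (maxDensity H / (1 + maxDensity H)) ≤
          ramseyNumber H G := by
  classical
  obtain ⟨H', hv', he', hρ⟩ := exists_subgraph_density_eq_maxDensity H hv he
  obtain ⟨j, hj⟩ : ∃ j, H'.edgeSet.ncard = j + 1 := ⟨_, (Nat.sub_add_cancel (by omega)).symm⟩
  obtain ⟨k, hk⟩ : ∃ k, H'.verts.ncard = k + 2 := ⟨_, (Nat.sub_add_cancel (by omega)).symm⟩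
  have hcard : Fintype.card H'.verts - 2 = k := by
    rw [← Set.toFinset_card, ← Set.ncard_eq_toFinset_card', hk, Nat.add_sub_cancel]
  have hedges : H'.coe.edgeSet.ncard = j + 1 := by
    rw [← hj, ← H'.image_coe_edgeSet_coe,
      Set.ncard_image_of_injective _ (Sym2.map.injective Subtype.val_injective)]
  rw [hj, hk] at hρ
  push_cast at hρ
  rw [add_sub_cancel_right, add_sub_cancel_right] at hρ
  refine ⟨1 / (4 * (j + 1) * 2 ^ (j + 1)) / 4, by positivity, fun β _ G m hm hm₂ => ?_⟩
  by_contra! hlt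
  obtain ⟨hn, hR⟩ := ramseyProp_ramseyNumber H G
  obtain ⟨hp₀, hp₁, h⟩ := pow_mul_one_add_pow_lt_one (by omega) (by omega) hn hm₂ hρ rfl rfl hlt.le
  rw [← hcard] at h
  obtain ⟨Γ, hK, hG⟩ := not_ramseyProp_of_lt_one hedges hm hn j.succ_pos hp₀ hp₁ h
  refine (hR Γ).elim (fun ⟨f, hf⟩ => hK ?_) hG
  exact ⟨f.comp H'.hom, hf.comp Subtype.val_injective⟩
end

section
/- For every integer ℓ ≥ 2 there exists a constant c > 0 (depending only on ℓ) such that the following holds for all sufficiently large m: if H is a graph with t edges, chromatic number ℓ, and no isolated vertices, and G is a graph with m edges and no isolated vertices, then r(H, G) ≤ m^{c√t}. -/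
open SimpleGraph

namespace RamseySize

open Finset
open scoped Classical

variable {W α : Type*}

/-- Every `n`-element set of vertices spans an edge. -/
def NoIndep (Γ : SimpleGraph W) (n : ℕ) : Prop :=
  ∀ I : Finset W, #I = n → ∃ x ∈ I, ∃ y ∈ I, Γ.Adj x y

/-- The part of `H` spanned by `P` embeds into the part of `Γ` spanned by `S`. -/
def EmbedsOn (H : SimpleGraph α) (Γ : SimpleGraph W) (P : Finset α) (S : Finset W) : Prop :=
  ∃ f : α → W, Set.InjOn f P ∧ (∀ x ∈ P, f x ∈ S) ∧
    ∀ x ∈ P, ∀ y ∈ P, H.Adj x y → Γ.Adj (f x) (f y)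

/-- Every set of at most `k` vertices of `U` has at least `b` common neighbours in `S`. -/
def CommonlyRich (Γ : SimpleGraph W) (k b : ℕ) (U S : Finset W) : Prop :=
  ∀ Q ⊆ U, #Q ≤ k → b ≤ #{y ∈ S | ∀ x ∈ Q, Γ.Adj x y}

/-- A greedy independent set in a set of vertices of small degree. -/
lemma exists_indep_of_small_degree (Γ : SimpleGraph W) (S : Finset W) (d n : ℕ) (hd : 0 < d) :
    ∀ L ⊆ S, (∀ x ∈ L, #{y ∈ S | Γ.Adj x y} < d) → n * d ≤ #L →
      ∃ I ⊆ L, #I = n ∧ ∀ x ∈ I, ∀ y ∈ I, ¬ Γ.Adj x y := by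
  induction n with
  | zero => intro L _ _ _; exact ⟨∅, by simp⟩
  | succ n ih =>
    intro L hLS hL hc
    have hne : L.Nonempty := by
      rw [← Finset.card_pos]; nlinarith
    obtain ⟨v, hv⟩ := hne
    set L' := {y ∈ L | y ≠ v ∧ ¬ Γ.Adj v y} with hL'
    have hsub : L' ⊆ L := filter_subset _ _
    have hcov : L ⊆ L' ∪ insert v {y ∈ S | Γ.Adj v y} := by
      intro y hy
      have := hLS hy
      simp only [hL', mem_union, mem_filter, mem_insert]
      tauto
    have h1 := (card_le_card hcov).trans (card_union_le _ _)
    have h2 := card_insert_le v {y ∈ S | Γ.Adj v y}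
    have h3 := hL v hv
    have h4 : n * d ≤ #L' := by
      have : (n + 1) * d = n * d + d := by ring
      omega
    obtain ⟨I, hI, hIc, hIi⟩ := ih L' (hsub.trans hLS) (fun x hx => hL x (hsub hx)) h4
    have hvI : v ∉ I := fun h => by simpa [hL'] using hI h
    refine ⟨insert v I, ?_, by rw [card_insert_of_notMem hvI, hIc], ?_⟩
    · exact insert_subset hv (hI.trans hsub)
    · intro x hx y hy
      have key : ∀ z ∈ I, ¬ Γ.Adj v z := fun z hz => by
        have := hI hz
        simp only [hL', mem_filter] at this
        exact this.2.2
      rcases mem_insert.1 hx with rfl | hx'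
      · rcases mem_insert.1 hy with rfl | hy'
        · exact Γ.loopless.irrefl _
        · exact key y hy'
      · rcases mem_insert.1 hy with rfl | hy'
        · exact fun h => key x hx' h.symm
        · exact hIi x hx' y hy'

lemma NoIndep.card_small_degree_lt {Γ : SimpleGraph W} {n : ℕ} (h : NoIndep Γ n)
    (S : Finset W) {d : ℕ} (hd : 0 < d) :
    #{x ∈ S | #{y ∈ S | Γ.Adj x y} < d} < n * d := by
  by_contra! hc
  obtain ⟨I, -, hI, hI'⟩ := exists_indep_of_small_degree Γ S d n hd _ (filter_subset _ _)
    (fun x hx => (mem_filter.1 hx).2) hc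
  obtain ⟨x, hx, y, hy, hxy⟩ := h I hI
  exact hI' x hx y hy hxy

lemma NoIndep.exists_large_degree {Γ : SimpleGraph W} {n : ℕ} (h : NoIndep Γ n)
    (S : Finset W) {d : ℕ} (hd : 0 < d) (hS : n * d ≤ #S) :
    ∃ v ∈ S, d ≤ #{y ∈ S | Γ.Adj v y} := by
  by_contra! hc
  have := h.card_small_degree_lt S hd
  rw [filter_true_of_mem hc] at this
  omega

lemma card_tuples_forall (S : Finset W) (s : ℕ) (p : W → Prop)
    [DecidablePred p] [DecidablePred fun T : Fin s → W => ∀ j, p (T j)] :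
    #{T ∈ Fintype.piFinset (fun _ : Fin s => S) | ∀ j, p (T j)} = #{y ∈ S | p y} ^ s := by
  have : {T ∈ Fintype.piFinset (fun _ : Fin s => S) | ∀ j, p (T j)} =
      Fintype.piFinset (fun _ : Fin s => {y ∈ S | p y}) := by
    ext T
    simp [Fintype.mem_piFinset, forall_and]
  rw [this, Fintype.card_piFinset_const]

lemma exists_tuple_of_card_le {k : ℕ} {U Q : Finset W} (hU : U.Nonempty) (hQ : Q ⊆ U)
    (hk : #Q ≤ k) : ∃ g : Fin k → W, (∀ i, g i ∈ U) ∧ ∀ x ∈ Q, ∃ i, g i = x := by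
  obtain ⟨u, hu⟩ := hU
  refine ⟨fun i => if h : i.1 < #Q then Q.equivFin.symm ⟨i, h⟩ else u, ?_, ?_⟩
  · intro i
    dsimp only
    split_ifs
    · exact hQ (Subtype.prop _)
    · exact hu
  · intro x hx
    refine ⟨⟨Q.equivFin ⟨x, hx⟩, (Q.equivFin ⟨x, hx⟩).2.trans_le hk⟩, ?_⟩
    simp

/-- Dependent random choice in a graph without independent sets of size `n`. -/
lemma NoIndep.exists_commonlyRich {Γ : SimpleGraph W} {n : ℕ} (h : NoIndep Γ n) (hn : 2 ≤ n)
    {k b a e : ℕ} (hk : 0 < k) (ha : 2 * b + 7 ≤ a) (he : e + 4 * k + 2 ≤ a)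
    {S : Finset W} (hS : #S = n ^ a) :
    ∃ U ⊆ S, n ^ e ≤ #U ∧ CommonlyRich Γ k (n ^ b) U S := by
  have hn0 : 0 < n := by omega
  set s := 2 * k with hs
  set 𝒯 := Fintype.piFinset (fun _ : Fin s => S) with h𝒯
  set B := {g ∈ Fintype.piFinset (fun _ : Fin k => S) |
    #{y ∈ S | ∀ i, Γ.Adj (g i) y} < n ^ b} with hB
  have h𝒯c : #𝒯 = n ^ (a * s) := by
    rw [h𝒯, Fintype.card_piFinset_const, hS, ← pow_mul]
  have hBc : #B ≤ n ^ (a * k) := by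
    refine (card_filter_le _ _).trans ?_
    rw [Fintype.card_piFinset_const, hS, ← pow_mul]
  have sumU : n ^ (a - 1 + (a - 2) * s) ≤
      ∑ T ∈ 𝒯, #{x ∈ S | ∀ j, Γ.Adj (T j) x} := by
    have e1 : ∑ T ∈ 𝒯, #{x ∈ S | ∀ j, Γ.Adj (T j) x} =
        ∑ x ∈ S, #{T ∈ 𝒯 | ∀ j, Γ.Adj (T j) x} :=
      sum_card_bipartiteAbove_eq_sum_card_bipartiteBelow
        (fun (T : Fin s → W) x => ∀ j, Γ.Adj (T j) x)
    rw [e1]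
    have hlow := h.card_small_degree_lt S (d := n ^ (a - 2)) (by positivity)
    have hsplit := card_filter_add_card_filter_not (s := S)
      (fun x => #{y ∈ S | Γ.Adj x y} < n ^ (a - 2))
    have p1 : n * n ^ (a - 2) = n ^ (a - 1) := by
      rw [← pow_succ']; congr 1; omega
    have p2 : n * n ^ (a - 1) = n ^ a := by
      rw [← pow_succ']; congr 1; omega
    have hhigh : n ^ (a - 1) ≤ #{x ∈ S | ¬ #{y ∈ S | Γ.Adj x y} < n ^ (a - 2)} := by
      nlinarith
    calc n ^ (a - 1 + (a - 2) * s)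
        = n ^ (a - 1) * (n ^ (a - 2)) ^ s := by rw [pow_add, pow_mul]
      _ ≤ #{x ∈ S | ¬ #{y ∈ S | Γ.Adj x y} < n ^ (a - 2)} * (n ^ (a - 2)) ^ s := by gcongr
      _ ≤ ∑ x ∈ S with ¬ #{y ∈ S | Γ.Adj x y} < n ^ (a - 2),
            #{T ∈ 𝒯 | ∀ j, Γ.Adj (T j) x} := by
          rw [← smul_eq_mul]
          refine card_nsmul_le_sum _ _ _ fun x hx => ?_
          rw [h𝒯, card_tuples_forall S s (fun y => Γ.Adj y x)]
          have := (mem_filter.1 hx).2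
          simp only [Γ.adj_comm _ x]
          gcongr
          omega
      _ ≤ _ := sum_le_sum_of_subset (filter_subset _ _)
  have sumB : ∑ T ∈ 𝒯, #{g ∈ B | ∀ j, ∀ i, Γ.Adj (g i) (T j)} ≤ n ^ (a * k + b * s) := by
    have e1 : ∑ T ∈ 𝒯, #{g ∈ B | ∀ j, ∀ i, Γ.Adj (g i) (T j)} =
        ∑ g ∈ B, #{T ∈ 𝒯 | ∀ j, ∀ i, Γ.Adj (g i) (T j)} :=
      sum_card_bipartiteAbove_eq_sum_card_bipartiteBelow
        (fun (T : Fin s → W) (g : Fin k → W) => ∀ j, ∀ i, Γ.Adj (g i) (T j))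
    rw [e1]
    calc _ ≤ #B • (n ^ b) ^ s := by
          refine sum_le_card_nsmul _ _ _ fun g hg => ?_
          rw [h𝒯, card_tuples_forall S s (fun y => ∀ i, Γ.Adj (g i) y)]
          have := (mem_filter.1 hg).2
          gcongr
      _ ≤ n ^ (a * k) * (n ^ b) ^ s := by
          rw [smul_eq_mul]; gcongr
      _ = _ := by rw [pow_add, pow_mul n b]
  obtain ⟨T, hT, hTU, hTB⟩ : ∃ T ∈ 𝒯, n ^ e ≤ #{x ∈ S | ∀ j, Γ.Adj (T j) x} ∧
      {g ∈ B | ∀ j, ∀ i, Γ.Adj (g i) (T j)} = ∅ := by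
    by_contra! hc
    have hb : ∀ T ∈ 𝒯, #{x ∈ S | ∀ j, Γ.Adj (T j) x} + 1 ≤
        n ^ e + 2 * n ^ a * #{g ∈ B | ∀ j, ∀ i, Γ.Adj (g i) (T j)} := by
      intro T hT
      by_cases h1 : n ^ e ≤ #{x ∈ S | ∀ j, Γ.Adj (T j) x}
      · have h2 := (hc T hT h1).card_pos
        have h3 : #{x ∈ S | ∀ j, Γ.Adj (T j) x} ≤ n ^ a := hS ▸ card_filter_le _ _
        have h4 : 0 < n ^ a := by positivity
        nlinarith [Nat.zero_le (n ^ e)]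
      · have := Nat.zero_le (2 * n ^ a * #{g ∈ B | ∀ j, ∀ i, Γ.Adj (g i) (T j)})
        omega
    have hsum := sum_le_sum hb
    rw [sum_add_distrib, sum_add_distrib, ← mul_sum, sum_const, sum_const, h𝒯c, smul_eq_mul,
      smul_eq_mul, mul_one] at hsum
    have q0 : 0 < n ^ (a * s) := by positivity
    have q1 : 2 * (n ^ (a * s) * n ^ e) ≤ n ^ (a - 1 + (a - 2) * s) := by
      calc 2 * (n ^ (a * s) * n ^ e) ≤ n * (n ^ (a * s) * n ^ e) := by gcongr
        _ = n ^ (a * s + e + 1) := by ring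
        _ ≤ _ := by
          apply Nat.pow_le_pow_right hn0
          obtain ⟨c, rfl⟩ : ∃ c, a = c + 2 := ⟨a - 2, by omega⟩
          have : c + 2 - 2 = c := by omega
          rw [this]
          have : c + 2 - 1 = c + 1 := by omega
          rw [this]
          nlinarith
    have q2 : 2 * (2 * n ^ a * n ^ (a * k + b * s)) ≤ n ^ (a - 1 + (a - 2) * s) := by
      calc 2 * (2 * n ^ a * n ^ (a * k + b * s)) ≤ n * (n * n ^ a * n ^ (a * k + b * s)) := by
            gcongr
        _ = n ^ (a + (a * k + b * s) + 2) := by ring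
        _ ≤ _ := by
          apply Nat.pow_le_pow_right hn0
          obtain ⟨c, rfl⟩ : ∃ c, a = c + 2 := ⟨a - 2, by omega⟩
          have : c + 2 - 2 = c := by omega
          rw [this]
          have : c + 2 - 1 = c + 1 := by omega
          rw [this, hs]
          have : (2 * b + 5) * k ≤ c * k := Nat.mul_le_mul_right _ (by omega)
          nlinarith
    have q3 : 2 * n ^ a * ∑ T ∈ 𝒯, #{g ∈ B | ∀ j, ∀ i, Γ.Adj (g i) (T j)} ≤
        2 * n ^ a * n ^ (a * k + b * s) := by gcongr
    omega
  refine ⟨_, filter_subset _ _, hTU, fun Q hQ hQk => ?_⟩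
  have hne : ({x ∈ S | ∀ j, Γ.Adj (T j) x}).Nonempty :=
    card_pos.1 (lt_of_lt_of_le (by positivity) hTU)
  obtain ⟨g, hgU, hgQ⟩ := exists_tuple_of_card_le hne hQ hQk
  have hgB : g ∉ B := by
    intro hg
    have : g ∈ {g ∈ B | ∀ j, ∀ i, Γ.Adj (g i) (T j)} :=
      mem_filter.2 ⟨hg, fun j i => ((mem_filter.1 (hgU i)).2 j).symm⟩
    simp [hTB] at this
  have hgS : g ∈ Fintype.piFinset (fun _ : Fin k => S) :=
    Fintype.mem_piFinset.2 fun i => (mem_filter.1 (hgU i)).1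
  have : n ^ b ≤ #{y ∈ S | ∀ i, Γ.Adj (g i) y} := by
    by_contra! hc
    exact hgB (mem_filter.2 ⟨hgS, hc⟩)
  refine this.trans (card_le_card fun y hy => ?_)
  simp only [mem_filter] at hy ⊢
  refine ⟨hy.1, fun x hx => ?_⟩
  obtain ⟨i, rfl⟩ := hgQ x hx
  exact hy.2 i

/-- Greedy extension of an embedding by an independent set of vertices. -/
lemma EmbedsOn.union_indep [Fintype α] {H : SimpleGraph α} {Γ : SimpleGraph W} {k b : ℕ}
    {U S : Finset W} (hUS : U ⊆ S) (hrich : CommonlyRich Γ k b U S)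
    (hb : Fintype.card α ≤ b) {P : Finset α} (hP : EmbedsOn H Γ P U) (R : Finset α)
    (hdeg : ∀ x ∈ R, #{y ∈ P | H.Adj x y} ≤ k) (hR : ∀ x ∈ R, ∀ y ∈ R, ¬ H.Adj x y) :
    EmbedsOn H Γ (P ∪ R) S := by
  suffices h : ∃ f : α → W, (∀ x ∈ P, f x ∈ U) ∧ Set.InjOn f (P ∪ R : Finset α) ∧
      (∀ x ∈ P ∪ R, f x ∈ S) ∧
      ∀ x ∈ P ∪ R, ∀ y ∈ P ∪ R, H.Adj x y → Γ.Adj (f x) (f y) by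
    obtain ⟨f, -, hf⟩ := h
    exact ⟨f, hf⟩
  induction R using Finset.induction_on with
  | empty =>
    obtain ⟨f, h1, h2, h3⟩ := hP
    exact ⟨f, h2, by simpa using h1, by simpa using fun x hx => hUS (h2 x hx), by simpa using h3⟩
  | insert v R hv ih =>
    obtain ⟨f, hU, hinj, hS, hadj⟩ := ih (fun x hx => hdeg x (mem_insert_of_mem hx))
      (fun x hx y hy => hR x (mem_insert_of_mem hx) y (mem_insert_of_mem hy))
    rw [union_insert]
    by_cases hvP : v ∈ P ∪ R
    · rw [insert_eq_of_mem hvP]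
      exact ⟨f, hU, hinj, hS, hadj⟩
    have hQ : image f {y ∈ P | H.Adj v y} ⊆ U := by
      intro w hw
      obtain ⟨y, hy, rfl⟩ := mem_image.1 hw
      exact hU y (mem_filter.1 hy).1
    have hbig := hrich _ hQ (card_image_le.trans (hdeg v (mem_insert_self _ _)))
    have hsmall : #(image f (P ∪ R)) < b := by
      refine lt_of_lt_of_le (card_image_le.trans_lt ?_) hb
      exact card_lt_univ_of_notMem hvP
    obtain ⟨w, hw, hwn⟩ := exists_mem_notMem_of_card_lt_card (hsmall.trans_le hbig)
    simp only [mem_filter] at hw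
    have hne : ∀ x ∈ P ∪ R, x ≠ v := fun x hx h => hvP (h ▸ hx)
    have hupd : ∀ x ∈ P ∪ R, Function.update f v w x = f x := fun x hx =>
      Function.update_of_ne (hne x hx) _ _
    have hvadj : ∀ y ∈ P ∪ R, H.Adj v y → Γ.Adj w (f y) := by
      intro y hy hvy
      rcases mem_union.1 hy with hy | hy
      · exact (hw.2 _ (mem_image_of_mem f (mem_filter.2 ⟨hy, hvy⟩))).symm
      · exact absurd hvy (hR v (mem_insert_self _ _) y (mem_insert_of_mem hy))
    refine ⟨Function.update f v w, ?_, ?_, ?_, ?_⟩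
    · intro x hx
      rw [hupd x (mem_union_left _ hx)]
      exact hU x hx
    · rw [coe_insert, Set.injOn_insert (by simpa using hvP)]
      refine ⟨fun x hx y hy hxy => hinj hx hy ?_, ?_⟩
      · rwa [hupd x hx, hupd y hy] at hxy
      · rintro ⟨x, hx, hxw⟩
        rw [hupd x hx, Function.update_self] at hxw
        exact hwn (hxw ▸ mem_image_of_mem f hx)
    · intro x hx
      rcases mem_insert.1 hx with rfl | hx'
      · rw [Function.update_self]; exact hw.1
      · rw [hupd x hx']; exact hS x hx'
    · intro x hx y hy hxy
      rcases mem_insert.1 hx with rfl | hx'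
      · rcases mem_insert.1 hy with rfl | hy'
        · exact absurd hxy (H.loopless.irrefl _)
        · rw [Function.update_self, hupd y hy']; exact hvadj y hy' hxy
      · rcases mem_insert.1 hy with rfl | hy'
        · rw [Function.update_self, hupd x hx']; exact (hvadj x hx' hxy.symm).symm
        · rw [hupd x hx', hupd y hy']; exact hadj x hx' y hy' hxy

lemma EmbedsOn.mono {H : SimpleGraph α} {Γ : SimpleGraph W} {P : Finset α} {S S' : Finset W}
    (h : EmbedsOn H Γ P S) (hS : S ⊆ S') : EmbedsOn H Γ P S' :=
  let ⟨f, h1, h2, h3⟩ := h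
  ⟨f, h1, fun x hx => hS (h2 x hx), h3⟩

lemma EmbedsOn.insert_of_neighbors {H : SimpleGraph α} {Γ : SimpleGraph W} {P : Finset α}
    {S : Finset W} {w : W} (hw : w ∈ S) (h : EmbedsOn H Γ P {y ∈ S | Γ.Adj w y}) (v : α)
    (hvP : v ∉ P) : EmbedsOn H Γ (insert v P) S := by
  obtain ⟨f, hinj, hS, hadj⟩ := h
  simp only [mem_filter] at hS
  have hne : ∀ x ∈ P, x ≠ v := fun x hx h => hvP (h ▸ hx)
  have hupd : ∀ x ∈ P, Function.update f v w x = f x := fun x hx =>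
    Function.update_of_ne (hne x hx) _ _
  refine ⟨Function.update f v w, ?_, ?_, ?_⟩
  · rw [coe_insert, Set.injOn_insert (by simpa using hvP)]
    refine ⟨fun x hx y hy hxy => hinj hx hy ?_, ?_⟩
    · rwa [hupd x hx, hupd y hy] at hxy
    · rintro ⟨x, hx, hxw⟩
      rw [hupd x hx, Function.update_self] at hxw
      exact (hS x hx).2.ne hxw.symm
  · intro x hx
    rcases mem_insert.1 hx with rfl | hx'
    · rw [Function.update_self]; exact hw
    · rw [hupd x hx']; exact (hS x hx').1
  · intro x hx y hy hxy
    rcases mem_insert.1 hx with rfl | hx'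
    · rcases mem_insert.1 hy with rfl | hy'
      · exact absurd hxy (H.loopless.irrefl _)
      · rw [Function.update_self, hupd y hy']; exact (hS y hy').2
    · rcases mem_insert.1 hy with rfl | hy'
      · rw [Function.update_self, hupd x hx']; exact (hS x hx').2.symm
      · rw [hupd x hx', hupd y hy']; exact hadj x hx' y hy' hxy

/-- Sets of vertices of small degree spanning a graph of bounded chromatic number embed. -/
lemma NoIndep.embedsOn_of_degree_le [Fintype α] {H : SimpleGraph α} {Γ : SimpleGraph W} {n : ℕ}
    (h : NoIndep Γ n) (hn : 2 ≤ n) {k b : ℕ} (hk : 0 < k) (hb : Fintype.card α ≤ n ^ b)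
    {col : α → ℕ} (hcol : ∀ x y, H.Adj x y → col x ≠ col y) (ℓ : ℕ) :
    ∀ (P : Finset α) (S : Finset W), (∀ x ∈ P, H.degree x ≤ k) → (∀ x ∈ P, col x < ℓ) →
      n ^ (2 * b + 7 + ℓ * (4 * k + 2)) ≤ #S → EmbedsOn H Γ P S := by
  induction ℓ with
  | zero =>
    intro P S _ hc hS
    obtain ⟨w, -⟩ : S.Nonempty := card_pos.1 (lt_of_lt_of_le (by positivity) hS)
    obtain rfl : P = ∅ := eq_empty_of_forall_notMem fun x hx => by simpa using hc x hx
    exact ⟨fun _ => w, by simp, by simp, by simp⟩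
  | succ ℓ ih =>
    intro P S hdeg hc hS
    obtain ⟨S', hsub, hS'⟩ := exists_subset_card_eq hS
    obtain ⟨U, hUS, hU, hrich⟩ := h.exists_commonlyRich hn hk (b := b)
      (e := 2 * b + 7 + ℓ * (4 * k + 2)) (by omega)
      (by rw [add_one_mul ℓ]; omega) hS'
    have hlow := ih {x ∈ P | col x < ℓ} U (fun x hx => hdeg x (mem_filter.1 hx).1)
      (fun x hx => (mem_filter.1 hx).2) hU
    have hall := hlow.union_indep hUS hrich hb {x ∈ P | ¬ col x < ℓ}
      (fun x hx => by
        refine le_trans (card_le_card fun y hy => ?_) (hdeg x (mem_filter.1 hx).1)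
        simpa using (mem_filter.1 hy).2)
      (fun x hx y hy hxy => by
        have h1 := mem_filter.1 hx
        have h2 := mem_filter.1 hy
        have h3 := hc x h1.1
        have h4 := hc y h2.1
        exact hcol x y hxy (by omega))
    rw [filter_union_filter_not_eq] at hall
    exact hall.mono hsub

/-- Vertices of arbitrary degree can be added to a set at the cost of a factor `n` each. -/
lemma NoIndep.embedsOn_union {H : SimpleGraph α} {Γ : SimpleGraph W} {n : ℕ}
    (h : NoIndep Γ n) (hn : 0 < n) {a : ℕ} {P : Finset α}
    (hP : ∀ S : Finset W, n ^ a ≤ #S → EmbedsOn H Γ P S) (R : Finset α) :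
    ∀ S : Finset W, n ^ (a + #R) ≤ #S → EmbedsOn H Γ (P ∪ R) S := by
  induction R using Finset.induction_on with
  | empty => simpa using hP
  | insert v R hv ih =>
    intro S hS
    rw [card_insert_of_notMem hv, ← add_assoc, pow_succ'] at hS
    obtain ⟨w, hw, hwd⟩ := h.exists_large_degree S (by positivity) hS
    rw [union_insert]
    by_cases hvP : v ∈ P ∪ R
    · rw [insert_eq_of_mem hvP]
      exact (ih _ hwd).mono (filter_subset _ _)
    · exact (ih _ hwd).insert_of_neighbors hw v hvP

lemma sum_degrees_eq_two_mul_ncard [Fintype α] (H : SimpleGraph α) :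
    ∑ v, H.degree v = 2 * H.edgeSet.ncard := by
  rw [H.sum_degrees_eq_twice_card_edges, Set.ncard_eq_toFinset_card']
  rfl

lemma card_le_two_mul_ncard_edgeSet [Fintype α] (H : SimpleGraph α) (h : ∀ v, ∃ w, H.Adj v w) :
    Fintype.card α ≤ 2 * H.edgeSet.ncard := by
  rw [← sum_degrees_eq_two_mul_ncard, ← card_univ, card_eq_sum_ones]
  refine sum_le_sum fun v _ => ?_
  obtain ⟨w, hw⟩ := h v
  exact (H.degree_pos_iff_exists_adj v).2 ⟨w, hw⟩

lemma noIndep_of_not_containsCopy {β : Type*} [Fintype β] {G : SimpleGraph β}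
    {Γ : SimpleGraph W} {n : ℕ} (hβ : Fintype.card β ≤ n) (h : ¬ Γᶜ.ContainsCopy G) :
    NoIndep Γ n := by
  intro I hI
  by_contra! hc
  obtain ⟨f⟩ : Nonempty (β ↪ I) :=
    Function.Embedding.nonempty_of_card_le (by simpa [hI] using hβ)
  refine h ⟨⟨fun x => f x, fun {x y} hxy => ?_⟩, fun x y hxy => f.injective (Subtype.ext hxy)⟩
  rw [SimpleGraph.compl_adj]
  exact ⟨fun hf => hxy.ne (f.injective (Subtype.ext hf)), hc _ (f x).2 _ (f y).2⟩

/-- A quantitative bound for graphs `H` with fewer than `k ^ 2` edges. -/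
lemma ramseyNumber_le {β : Type*} [Fintype α] [Fintype β] {H : SimpleGraph α}
    {G : SimpleGraph β} {n k ℓ : ℕ} (hn : 2 ≤ n) (hk : H.edgeSet.ncard < k ^ 2)
    (hH : ∀ v, ∃ w, H.Adj v w) (hℓ : H.Colorable ℓ) (hβ : Fintype.card β ≤ n) :
    ramseyNumber H G ≤ n ^ (6 * k + 9 + ℓ * (4 * k + 2)) := by
  refine Nat.sInf_le ⟨by positivity, fun Γ => ?_⟩
  by_contra! hc
  obtain ⟨hcH, hcG⟩ := hc
  have hk0 : 0 < k := Nat.pos_of_ne_zero (by rintro rfl; simp at hk)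
  have hind := noIndep_of_not_containsCopy hβ hcG
  obtain ⟨C⟩ := hℓ
  have hα : Fintype.card α ≤ n ^ (2 * k + 1) := by
    have h1 := card_le_two_mul_ncard_edgeSet H hH
    have h2 : k < 2 ^ k := Nat.lt_two_pow_self
    calc Fintype.card α ≤ 2 * (k * k) := by nlinarith
      _ ≤ 2 * (2 ^ k * 2 ^ k) := by gcongr
      _ = 2 ^ (2 * k + 1) := by ring
      _ ≤ n ^ (2 * k + 1) := by gcongr
  have hhigh : #{x : α | ¬ H.degree x ≤ k} ≤ 2 * k := by
    have h1 : #{x : α | ¬ H.degree x ≤ k} • k ≤ ∑ x, H.degree x :=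
      (card_nsmul_le_sum _ _ _ fun x hx => by
        have := (mem_filter.1 hx).2
        omega).trans (sum_le_sum_of_subset (subset_univ _))
    rw [sum_degrees_eq_two_mul_ncard, smul_eq_mul] at h1
    by_contra hlt
    nlinarith
  have hlow := hind.embedsOn_of_degree_le (H := H) hn hk0 hα (col := fun x => (C x : ℕ))
    (fun x y hxy => fun h => C.valid hxy (Fin.ext h)) ℓ
  obtain ⟨f, hinj, -, hadj⟩ := hind.embedsOn_union (by omega)
    (fun S hS => hlow {x : α | H.degree x ≤ k} S (fun x hx => (mem_filter.1 hx).2)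
      (fun x _ => (C x).2) hS) {x : α | ¬ H.degree x ≤ k} univ (by
        rw [card_univ, Fintype.card_fin]
        exact Nat.pow_le_pow_right (by omega) (by omega))
  rw [filter_union_filter_not_eq] at hinj hadj
  exact hcH ⟨⟨f, fun {x y} hxy => hadj x (mem_univ _) y (mem_univ _) hxy⟩,
    Set.injOn_univ.1 (by simpa using hinj)⟩

end RamseySize

theorem stmt_4 (ℓ : ℕ) (hℓ : 2 ≤ ℓ) :
    ∃ c : ℝ, 0 < c ∧ ∃ M : ℕ, ∀ m : ℕ, M ≤ m →
      ∀ (α β : Type) [Fintype α] [Fintype β]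
        (H : SimpleGraph α) (G : SimpleGraph β) (t : ℕ),
        H.edgeSet.ncard = t → H.chromaticNumber = (ℓ : ℕ∞) → (∀ v, ∃ w, H.Adj v w) →
        G.edgeSet.ncard = m → (∀ v, ∃ w, G.Adj v w) →
        (ramseyNumber H G : ℝ) ≤ (m : ℝ) ^ (c * Real.sqrt t) := by
  refine ⟨60 + 24 * ℓ, by positivity, 2, ?_⟩
  intro m hm α β _ _ H G t ht hχ hH hG hG'
  have hcol : H.Colorable ℓ := SimpleGraph.chromaticNumber_le_iff_colorable.1 hχ.le
  have hβ := RamseySize.card_le_two_mul_ncard_edgeSet G hG'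
  rw [hG] at hβ
  have ht1 : 1 ≤ t := by
    by_contra! h0
    have hα := RamseySize.card_le_two_mul_ncard_edgeSet H hH
    have : IsEmpty α := Fintype.card_eq_zero_iff.1 (by omega)
    have h1 : H.chromaticNumber ≤ (0 : ℕ) :=
      SimpleGraph.chromaticNumber_le_iff_colorable.2 (.of_isEmpty 0)
    rw [hχ] at h1
    have : ℓ ≤ 0 := by exact_mod_cast h1
    omega
  set k := Nat.sqrt t + 1 with hk
  have hkt : H.edgeSet.ncard < k ^ 2 := by
    rw [ht, pow_two]; exact Nat.lt_succ_sqrt t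
  have hbound := RamseySize.ramseyNumber_le (G := G) (n := 2 * m) (by omega) hkt hH hcol hβ
  have hsqrt : (k : ℝ) ≤ 2 * Real.sqrt t := by
    have h1 : (Nat.sqrt t : ℝ) ≤ Real.sqrt t := Real.nat_sqrt_le_real_sqrt
    have h2 : 1 ≤ Real.sqrt t := Real.one_le_sqrt.2 (by exact_mod_cast ht1)
    rw [hk]; push_cast; linarith
  set A := 6 * k + 9 + ℓ * (4 * k + 2) with hA
  have hAk : 2 * A ≤ (30 + 12 * ℓ) * k := by
    have : 1 ≤ k := by omega
    have : ℓ * 1 ≤ ℓ * k := by gcongr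
    rw [hA]; nlinarith
  have hpow : (2 * m) ^ A ≤ m ^ (2 * A) := by
    rw [pow_mul]
    gcongr
    nlinarith
  calc (ramseyNumber H G : ℝ) ≤ ((m ^ (2 * A) : ℕ) : ℝ) := by
        exact_mod_cast hbound.trans hpow
    _ = (m : ℝ) ^ ((2 * A : ℕ) : ℝ) := by rw [Real.rpow_natCast]; push_cast; rfl
    _ ≤ _ := by
      apply Real.rpow_le_rpow_of_exponent_le
      · exact_mod_cast (by omega : 1 ≤ m)
      · have h1 : ((2 * A : ℕ) : ℝ) ≤ (30 + 12 * ℓ) * k := by exact_mod_cast hAk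
        have h2 : ((30 + 12 * ℓ : ℝ)) * k ≤ (30 + 12 * ℓ) * (2 * Real.sqrt t) := by gcongr
        linarith
end
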